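/- There is no finite set V ⊆ ℝ⁴ such that the polytope P = convexHull ℝ V has exactly 10 proper faces of dimension 0, 33 of dimension 1, 35 of dimension 2, and 12 of dimension 3; that is, (10,33,35,12) is not the f-vector of any convex 4-polytope. -/

import Mathlib

open Module

/-- The number of proper faces of dimension `k` of the polytope `convexHull ℝ V`. -/
noncomputable def fVec (V : Set (EuclideanSpace ℝ (Fin 4))) (k : ℕ) : ℕ :=
  {F : Set (EuclideanSpace ℝ (Fin 4)) | F ≠ ∅ ∧ F ≠ convexHull ℝ V ∧
    IsExposed ℝ (convexHull ℝ V) F ∧ finrank ℝ (vectorSpan ℝ F) = k}.ncard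

def pairN : Nat := 0x300a01809014030220480a018210440901403082108220480a0188110421044090140320240882108220480a01a0140481104210440901403
def tripN : Nat := 0xe0340b01c0c82a068260580e0c429064250540d08c1302c070c228862248520c88a1282a06886118260580e304a11849114431224490a41921445094150348310c2304c0b01cc0a8260a42508c2889222886284912248520ca0a4288a1282a06a0641886118260580ec068160641504c1885212846184511244510c60942489124290660541485114250540d80d0320c4308c1302c07
def quadN : Nat := 0xf03a0d82e078390d42d074330ac1b09c1703c388d22c872328aa1a89a1683a318a619896158362384e0b81e384d12c471324a91a49916439314a519495154352344d0b41d30ca318c9314c3322c4b0ac1b21c4709c1703ce0b42b09c2c8aa268a62588e2c4a9264a52548d28c9322c872c2a8a62a4a528ca8a92a2a86a8691a2685a0eb06a19869194631a26498a619a1645896158368390e2384e0b81ee0741b05c1c86a168661584e1c469164651544d18c5312c471c268962649524c98a5292a46986519264590e705a15859154531625494a51961545495154358350d2344d0b41dc0e8360e4350cc388d2328c6384d1324c530ce0b42c8b12c2b06e0741c8711c2705c0f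
/-! ## The search -/

abbrev Fct := Nat × List Nat
abbrev Tab := List (Nat × Nat)

noncomputable def force {α : Type} (n : Nat) (k : Nat → α) : α :=
  Nat.rec (motive := fun _ => α) (k 0) (fun m _ => k (Nat.succ m)) n

theorem force_eq {α : Type} (n : Nat) (k : Nat → α) : force n k = k n := by
  cases n <;> rfl

noncomputable def decH (fuel n : Nat) (rest : List Nat) : List Nat :=
  Nat.rec (motive := fun _ => Nat → List Nat) (fun _ => rest)
    (fun _ ih n => List.cons (Nat.land n 127) (force (Nat.shiftRight n 7) ih)) fuel n

noncomputable def decAll (cs : List Nat) : List Nat :=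
  List.rec (motive := fun _ => List Nat) [] (fun c _ ih => decH 60 c ih) cs

/-- union of the entries whose key meets `m` -/
noncomputable def orSel (tab : Tab) (m : Nat) : Nat :=
  List.rec (motive := fun _ => Nat) 0 (fun v _ ih =>
    Nat.rec (motive := fun _ => Nat) ih (fun _ _ => Nat.lor v.2 ih) (Nat.land m v.1)) tab

noncomputable def andForb (nc : Tab) (fs : List Nat) (B : Nat) : Nat :=
  List.rec (motive := fun _ => Nat) B (fun f _ ih => Nat.land (orSel nc f) ih) fs

/-- candidates of `B` compatible with the facet `(m, fs)` -/
noncomputable def compat (dv ev nc : Tab) (m : Nat) (fs : List Nat) (B : Nat) : Nat :=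
  force (Nat.xor 1023 m) fun m' =>
    andForb nc fs (Nat.land (orSel dv m') (Nat.land (orSel ev m') B))

noncomputable def noSub (fs : List Nat) (m : Nat) : Bool :=
  List.rec (motive := fun _ => Bool) true
    (fun f _ ih => Bool.rec (motive := fun _ => Bool) ih false (Nat.beq (Nat.land f m) f)) fs

/-- exactly one facet of the list contains `t`, and `t` contains no forbidden set of it -/
noncomputable def openB (t : Nat) (L : List Fct) (b : Bool) : Bool :=
  List.rec (motive := fun _ => Bool → Bool) (fun b => b)
    (fun h _ ih b => Bool.rec (motive := fun _ => Bool) (ih b)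
      (Bool.rec (motive := fun _ => Bool)
        (Bool.rec (motive := fun _ => Bool) false (ih true) (noSub h.2 t)) false b)
      (Nat.beq (Nat.land t h.1) t)) L b

noncomputable def pairAt (d : Nat) : Nat := Nat.land (Nat.shiftRight pairN (Nat.mul 10 d)) 1023
noncomputable def tripAt (d : Nat) : Nat := Nat.land (Nat.shiftRight tripN (Nat.mul 10 d)) 1023
noncomputable def quadAt (d : Nat) : Nat := Nat.land (Nat.shiftRight quadN (Nat.mul 10 d)) 1023

noncomputable def candF (j : Nat) : Fct :=
  Bool.rec (motive := fun _ => Fct)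
    (force (quadAt (Nat.sub j 5400)) fun q => (q, [q]))
    (force (pairAt (Nat.div j 120)) fun d => force (tripAt (Nat.mod j 120)) fun e =>
        force (Nat.lor d e) fun m => (m, [d, e]))
    (Nat.ble j 5399)

abbrev SearchT := List Fct → Nat → Nat → Nat → List Nat → Nat → List Nat → Option (List Nat)

/-- position of the leading bit -/
noncomputable def hiBit (ss : List Nat) : Nat → Nat → Nat :=
  List.rec (motive := fun _ => Nat → Nat → Nat) (fun _ p => p)
    (fun s _ ih C p => Nat.rec (motive := fun _ => Nat) (ih C p)
      (fun _ _ => ih C (Nat.add p s)) (Nat.shiftRight C (Nat.add p s))) ss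

/-- loop over the candidates in the bit set `C` -/
noncomputable def loopC (f : Nat → List Nat → Option (List Nat)) (fuel C : Nat) (hs : List Nat) :
    Option (List Nat) :=
  Nat.rec (motive := fun _ => Nat → List Nat → Option (List Nat)) (fun _ _ => none)
    (fun _ ih C hs => Nat.rec (motive := fun _ => Option (List Nat)) (some hs)
      (fun _ _ => force (hiBit [4096, 2048, 1024, 512, 256, 128, 64, 32, 16, 8, 4, 2, 1] C 128) fun p =>
        Option.rec (motive := fun _ => Option (List Nat)) none
          (fun hs => force (Nat.xor C (Nat.shiftLeft 1 p)) fun C => ih C hs) (f (Nat.sub p 128) hs))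
      (Nat.shiftRight C 128)) fuel C hs

/-- number of used labels after adding the set `g` -/
noncomputable def newK (k g : Nat) : Nat :=
  Bool.rec (motive := fun _ => Nat)
    (Bool.rec (motive := fun _ => Nat) (Nat.add k 2) (Nat.add k 1)
      (Nat.beq (Nat.shiftRight g (Nat.add k 1)) 0)) k (Nat.beq (Nat.shiftRight g k) 0)

noncomputable def tryJ (dv ev nc : Tab) (S : SearchT) (L : List Fct) (B sa k : Nat) (al : List Nat)
    (tb : Nat) (j : Nat) (hs : List Nat) : Option (List Nat) :=
  Prod.rec (motive := fun _ => Option (List Nat)) (fun g gf =>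
    force (Nat.add (Nat.mul sa 37) j) fun sa' =>
      force (Nat.lor sa' (compat dv ev nc g gf B)) fun B' => force (newK k g) fun k' =>
      S (List.cons (g, gf) L) B' sa' k' al (Nat.sub tb (Nat.div j 5400)) hs) (candF j)

noncomputable def nthL (l : List Nat) (k : Nat) : Nat :=
  List.rec (motive := fun _ => Nat → Nat) (fun _ => 0)
    (fun x _ ih k => Nat.rec (motive := fun _ => Nat) x (fun k' _ => ih k') k) l k

def memB (g : Fct) (L : List Fct) : Bool := L.any fun h => h.1 == g.1 && h.2 == g.2

def bipF (a x p q y : Nat) : Fct :=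
  (2^a ||| 2^x ||| 2^p ||| 2^q ||| 2^y, [2^a ||| 2^x, 2^p ||| 2^q ||| 2^y])

def patB (L : List Fct) (hs : List Nat) : Bool :=
  match hs with
  | [c, d, u, v, r, s, x, y, z, w, k, l] =>
    memB (63, [3, 12, 48]) L &&
    memB (bipF c x u r y) L && memB (bipF d y u s x) L &&
    memB (bipF c z v s w) L && memB (bipF d w v r z) L &&
    memB (bipF u k d r l) L && memB (bipF v l d s k) L &&
    [2^c ||| 2^d, 2^u ||| 2^v, 2^r ||| 2^s].isPerm [3, 12, 48] &&
    decide ([c, d, u, v, r, s].Nodup) &&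
    [x, y, z, w, k, l].all (fun i => decide (6 ≤ i ∧ i < 10)) && [c, d, u, v, r, s].all (fun i => decide (i < 6)) &&
    decide (x ≠ y) && decide (z ≠ w) && decide (k ≠ l)
  | _ => false

noncomputable def closedB (L : List Fct) : Bool :=
  Nat.ble 8 L.length && Nat.ble L.length 11 && decide ((L.map Prod.fst).Nodup) &&
  L.all fun h => (List.range 120).all fun e =>
    !(Nat.beq (Nat.land (tripAt e) h.1) (tripAt e)) || !(noSub h.2 (tripAt e)) ||
      L.any fun g => !(Nat.beq g.1 h.1) && Nat.beq (Nat.land (tripAt e) g.1) (tripAt e)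

noncomputable def search (dv ev nc : Tab) (allN bipN : Nat) (fuel : Nat) : SearchT :=
  Nat.rec (motive := fun _ => SearchT) (fun _ _ _ _ _ _ _ => none)
    (fun _ S L B sa k al tb hs =>
      List.rec (motive := fun _ => Option (List Nat)) none
        (fun h hs _ =>
          Bool.rec (motive := fun _ => Option (List Nat))
          (Bool.rec (motive := fun _ => Option (List Nat))
          (force (tripAt (Nat.mod h 120)) fun t =>
            Bool.rec (motive := fun _ => Option (List Nat)) none
              (force (Nat.land (nthL al k) (Nat.land B (Nat.xor allN (orSel nc t)))) fun C =>
               force (Nat.rec (motive := fun _ => Nat) (Nat.land C bipN) (fun _ _ => C) tb) fun C =>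
               loopC (tryJ dv ev nc S L B sa k al tb) 200 C hs)
              (openB t L false))
          (cond (closedB L) (some hs) none) (Nat.beq h 126))
          (cond (patB L (hs.take 12)) (some (hs.drop 12)) none) (Nat.beq h 127)) hs) fuel

noncomputable def forceTab {α : Type} (l : Tab) (k : Tab → α) : α :=
  List.rec (motive := fun _ => (Tab → α) → α) (fun k => k [])
    (fun x _ ih k => force x.1 fun a => force x.2 fun b => ih fun l => k (List.cons (a, b) l)) l k

noncomputable def forceL {α : Type} (l : List Nat) (k : List Nat → α) : α :=
  List.rec (motive := fun _ => (List Nat → α) → α) (fun k => k [])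
    (fun x _ ih k => force x fun b => ih fun l => k (List.cons b l)) l k

theorem forceTab_eq {α : Type} (l : Tab) (k : Tab → α) : forceTab l k = k l := by
  induction l generalizing k with
  | nil => rfl
  | cons x l ih =>
    show force x.1 (fun a => force x.2 fun b => forceTab l fun l => k (List.cons (a, b) l)) = _
    rw [force_eq, force_eq, ih]

theorem forceL_eq {α : Type} (l : List Nat) (k : List Nat → α) : forceL l k = k l := by
  induction l generalizing k with
  | nil => rfl
  | cons x l ih =>
    show force x (fun b => forceL l fun l => k (List.cons b l)) = _
    rw [force_eq, ih]

/-! tables -/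

noncomputable def rep (f : Nat → Nat) (w n : Nat) : Nat :=
  Nat.rec (motive := fun _ => Nat) 0 (fun d ih => Nat.lor ih (Nat.shiftLeft (f d) (Nat.mul w d))) n

noncomputable def onesN (n : Nat) : Nat := Nat.sub (Nat.shiftLeft 1 n) 1
noncomputable def bitAt (m i : Nat) : Nat := Nat.land (Nat.shiftRight m i) 1

noncomputable def dvb (i : Nat) : Nat :=
  Nat.shiftLeft (rep (fun d => Nat.mul (bitAt (pairAt d) i) (onesN 120)) 120 45) 128
noncomputable def evb (i : Nat) : Nat :=
  force (rep (fun e => bitAt (tripAt e) i) 1 120) fun t =>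
  Nat.shiftLeft (Nat.lor (rep (fun _ => t) 120 45)
    (Nat.shiftLeft (rep (fun e => bitAt (quadAt e) i) 1 210) 5400)) 128
noncomputable def tetN : Nat := Nat.shiftLeft (Nat.shiftLeft (onesN 210) 5400) 128
noncomputable def all0 : Nat := Nat.shiftLeft (onesN 5610) 128
noncomputable def mkT (f : Nat → Nat) : Tab :=
  [(1, f 0), (2, f 1), (4, f 2), (8, f 3), (16, f 4), (32, f 5), (64, f 6), (128, f 7), (256, f 8), (512, f 9)]

structure Tabs where
  dv : Tab
  ev : Tab
  nc : Tab
  al : List Nat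
  allN : Nat
  bipN : Nat
  b0 : Nat

/-- the label sets allowed when `k` labels are in use -/
noncomputable def alF (dv ev cv : Tab) (allN bipN k : Nat) : Nat :=
  Nat.lor (Nat.xor allN (orSel cv (Nat.shiftLeft (onesN 10) (Nat.add k 1))))
    (Nat.land (Nat.land bipN (Nat.xor allN (orSel cv (Nat.shiftLeft (onesN 10) (Nat.add k 2)))))
      (Nat.land (orSel dv (Nat.shiftLeft 1 k)) (orSel ev (Nat.shiftLeft 1 (Nat.add k 1)))))

noncomputable def withTabs (K : Tabs → Bool) : Bool :=
  forceTab (mkT dvb) fun db => forceTab (mkT evb) fun ev =>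
  force all0 fun a0 => force tetN fun tn => force (onesN 5738) fun allN => force (onesN 5528) fun bipN =>
  forceTab (List.map (fun p => (p.1, Nat.lor p.2 tn)) db) fun dv =>
  forceTab (List.map (fun p => (p.1.1, Nat.lor p.1.2 p.2.2)) (List.zip db ev)) fun cv =>
  forceTab (List.map (fun p => (p.1, Nat.xor a0 p.2)) cv) fun nc =>
  forceL (List.map (alF dv ev cv allN bipN) [0, 1, 2, 3, 4, 5, 6, 7, 8, 9, 10]) fun al =>
  force (Nat.xor a0 (orSel (List.map (fun p => (p.1.1, Nat.land p.1.2 p.2.2)) (List.zip db ev)) 1023)) fun b0 =>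
  K ⟨dv, ev, nc, al, allN, bipN, b0⟩

noncomputable def initB (t : Tabs) (L : List Fct) : Nat :=
  List.rec (motive := fun _ => Nat) t.b0 (fun h _ ih => Nat.lor 0 (compat t.dv t.ev t.nc h.1 h.2 ih)) L

noncomputable def run (t : Tabs) (L : List Fct) (k tb : Nat) (hints : List Nat) : Bool :=
    force (initB t L) fun B =>
      (search t.dv t.ev t.nc t.allN t.bipN 14 L B 1 k t.al tb (decAll hints)).isSome

/-- mask of the labels whose table entry has bit `p` -/
noncomputable def colsAt (tab : Tab) (p : Nat) : Nat :=
  List.rec (motive := fun _ => Nat) 0 (fun v _ ih =>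
    Nat.rec (motive := fun _ => Nat) ih (fun _ _ => Nat.lor v.1 ih) (bitAt v.2 p)) tab

noncomputable def allK (f : Nat → Bool) : Bool :=
  List.rec (motive := fun _ => Bool) true (fun k _ ih => Bool.rec (motive := fun _ => Bool) false ih (f k))
    [0, 1, 2, 3, 4, 5, 6, 7, 8, 9, 10]

noncomputable def checkBip (t : Tabs) (p d e : Nat) : Bool :=
  Bool.rec (motive := fun _ => Bool) true
    (force (Nat.lor d e) fun g =>
      Nat.beq (Nat.xor (colsAt t.nc p) g) 1023 && (Nat.beq (bitAt t.allN p) 1 &&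
      (Nat.beq (colsAt t.dv p) d && (Nat.beq (colsAt t.ev p) e && (Nat.beq (bitAt t.bipN p) 1 &&
      (Nat.beq (bitAt t.b0 p) 1 &&
      allK fun k => Nat.beq (bitAt (nthL t.al k) p) 1 ||
        !(Nat.beq (Nat.shiftRight g (Nat.add k 1)) 0 || (Nat.beq (Nat.shiftRight g (Nat.add k 2)) 0 &&
          (Nat.beq (bitAt d k) 1 && Nat.beq (bitAt e (Nat.add k 1)) 1)))))))))
    (Nat.beq (Nat.land d e) 0)

noncomputable def checkTet (t : Tabs) (p g : Nat) : Bool :=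
  Nat.beq (Nat.xor (colsAt t.nc p) g) 1023 && (Nat.beq (bitAt t.allN p) 1 &&
  (Nat.beq (colsAt t.dv p) 1023 && (Nat.beq (colsAt t.ev p) g && (Nat.beq (bitAt t.b0 p) 1 &&
  allK fun k => Nat.beq (bitAt (nthL t.al k) p) 1 ||
    !(Nat.beq (Nat.shiftRight g (Nat.add k 1)) 0)))))

noncomputable def allLt (f : Nat → Bool) (n : Nat) : Bool :=
  Nat.rec (motive := fun _ => Bool) true
    (fun j ih => Bool.rec (motive := fun _ => Bool) false ih (f j)) n

noncomputable def checkAll (t : Tabs) : Bool :=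
  allLt (fun d => allLt (fun e => force (Nat.add 128 (Nat.add (Nat.mul 120 d) e)) fun p =>
    force (pairAt d) fun d => force (tripAt e) fun e => checkBip t p d e) 120) 45 &&
  allLt (fun q => force (Nat.add 5528 q) fun p => force (quadAt q) fun g => checkTet t p g) 210

/-! ## Soundness of the search: bit sets -/

theorem beqt_iff {a b : Nat} : Nat.beq a b = true ↔ a = b := by rw [Nat.beq_eq]
theorem beqf_iff {a b : Nat} : Nat.beq a b = false ↔ a ≠ b := by
  rw [← Bool.not_eq_true, beqt_iff]

theorem orSel_bit (tab : Tab) (m p : Nat) :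
    (orSel tab m).testBit p = true ↔ ∃ v ∈ tab, m &&& v.1 ≠ 0 ∧ v.2.testBit p = true := by
  induction tab with
  | nil => simp [orSel]
  | cons v l ih =>
    have : orSel (v :: l) m = if m &&& v.1 = 0 then orSel l m else v.2 ||| orSel l m := by
      show Nat.rec (motive := fun _ => Nat) (orSel l m) (fun _ _ => Nat.lor v.2 (orSel l m)) (m &&& v.1) = _
      cases m &&& v.1 <;> simp
    rw [this]
    split_ifs with h
    · rw [ih]; simp [h]
    · rw [Nat.testBit_or, Bool.or_eq_true, ih]; simp [h]

theorem bitAt_eq (m i : Nat) : bitAt m i = (m.testBit i).toNat := by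
  show (m >>> i) &&& 1 = _
  rw [Nat.testBit, Nat.and_comm]
  rcases Nat.mod_two_eq_zero_or_one (m >>> i) with h | h <;> simp [h]

theorem colsAt_bit (tab : Tab) (p i : Nat) :
    (colsAt tab p).testBit i = true ↔ ∃ v ∈ tab, v.1.testBit i = true ∧ v.2.testBit p = true := by
  induction tab with
  | nil => simp [colsAt]
  | cons v l ih =>
    have : colsAt (v :: l) p = if v.2.testBit p = true then v.1 ||| colsAt l p else colsAt l p := by
      show Nat.rec (motive := fun _ => Nat) (colsAt l p) (fun _ _ => Nat.lor v.1 (colsAt l p)) (bitAt v.2 p) = _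
      rw [bitAt_eq]
      cases v.2.testBit p <;> simp
    rw [this]
    split_ifs with h
    · rw [Nat.testBit_or, Bool.or_eq_true, ih]; simp [h]
    · rw [ih]; simp [h]

theorem cols_orSel {tab : Tab} {m p i : Nat} (h : m.testBit i = true)
    (h2 : (colsAt tab p).testBit i = true) : (orSel tab m).testBit p = true := by
  rw [colsAt_bit] at h2
  obtain ⟨v, hv, h3, h4⟩ := h2
  rw [orSel_bit]
  refine ⟨v, hv, ?_, h4⟩
  intro h0
  have := congrArg (fun n => n.testBit i) h0
  simp [Nat.testBit_and, h, h3] at this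

theorem orSel_cols {tab : Tab} {m p : Nat} (h : (orSel tab m).testBit p = true) :
    ∃ i, m.testBit i = true ∧ (colsAt tab p).testBit i = true := by
  rw [orSel_bit] at h
  obtain ⟨v, hv, h3, h4⟩ := h
  obtain ⟨i, hi⟩ := Nat.exists_testBit_of_ne_zero h3
  rw [Nat.testBit_and, Bool.and_eq_true] at hi
  exact ⟨i, hi.1, (colsAt_bit _ _ _).2 ⟨v, hv, hi.2, h4⟩⟩

theorem noSub_iff (fs : List Nat) (m : Nat) : noSub fs m = true ↔ ∀ f ∈ fs, f &&& m ≠ f := by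
  induction fs with
  | nil => simp [noSub]
  | cons f l ih =>
    have : noSub (f :: l) m = if f &&& m = f then false else noSub l m := by
      show Bool.rec (motive := fun _ => Bool) (noSub l m) false (Nat.beq (f &&& m) f) = _
      by_cases h : f &&& m = f
      · rw [if_pos h, beqt_iff.2 h]
      · rw [if_neg h, beqf_iff.2 h]
    rw [this]
    split_ifs with h
    · simp [h]
    · rw [ih]; simp [h]

theorem openB_true {t : Nat} {L : List Fct} (h : openB t L true = true) :
    ∀ g ∈ L, t &&& g.1 ≠ t := by
  induction L with
  | nil => simp
  | cons g l ih =>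
    have : openB t (g :: l) true = Bool.rec (motive := fun _ => Bool) (openB t l true) false
      (Nat.beq (t &&& g.1) t) := rfl
    rw [this] at h
    by_cases h2 : t &&& g.1 = t
    · rw [beqt_iff.2 h2] at h; simp at h
    · rw [beqf_iff.2 h2] at h
      intro g' hg'
      rcases List.mem_cons.1 hg' with rfl | hg'
      · exact h2
      · exact ih h _ hg'

theorem openB_false {t : Nat} {L : List Fct} (h : openB t L false = true) :
    ∃ g ∈ L, t &&& g.1 = t ∧ noSub g.2 t = true ∧ ∀ g' ∈ L, t &&& g'.1 = t → g' = g := by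
  induction L with
  | nil => simp [openB] at h
  | cons g l ih =>
    have : openB t (g :: l) false = Bool.rec (motive := fun _ => Bool) (openB t l false)
      (Bool.rec (motive := fun _ => Bool) false (openB t l true) (noSub g.2 t))
      (Nat.beq (t &&& g.1) t) := rfl
    rw [this] at h
    by_cases h2 : t &&& g.1 = t
    · rw [beqt_iff.2 h2] at h
      refine ⟨g, by simp, h2, ?_, ?_⟩
      · by_contra hc
        rw [Bool.not_eq_true] at hc
        rw [hc] at h; simp at h
      · intro g' hg' h3
        rcases List.mem_cons.1 hg' with rfl | hg'
        · rfl
        · exfalso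
          cases hn : noSub g.2 t <;> rw [hn] at h <;> simp at h
          exact openB_true h _ hg' h3
    · rw [beqf_iff.2 h2] at h
      obtain ⟨g0, hg0, a, b, c⟩ := ih h
      refine ⟨g0, by simp [hg0], a, b, ?_⟩
      intro g' hg' h3
      rcases List.mem_cons.1 hg' with rfl | hg'
      · exact absurd h3 h2
      · exact c _ hg' h3

theorem loopC_sound {f : Nat → List Nat → Option (List Nat)} {fuel C : Nat} {hs r : List Nat}
    (h : loopC f fuel C hs = some r) (j : Nat) (hj : C.testBit (128 + j) = true) :
    ∃ hs' r', f j hs' = some r' := by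
  induction fuel generalizing C hs with
  | zero => simp [loopC] at h
  | succ n ih =>
    have e : loopC f (n+1) C hs = Nat.rec (motive := fun _ => Option (List Nat)) (some hs)
      (fun _ _ => force (hiBit [4096, 2048, 1024, 512, 256, 128, 64, 32, 16, 8, 4, 2, 1] C 128) fun p =>
        Option.rec (motive := fun _ => Option (List Nat)) none
          (fun hs => force (Nat.xor C (Nat.shiftLeft 1 p)) fun C => loopC f n C hs) (f (Nat.sub p 128) hs))
      (C >>> 128) := rfl
    rw [e] at h
    have hne : C >>> 128 ≠ 0 := by
      intro h0
      have := congrArg (fun n => n.testBit j) h0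
      simp [Nat.testBit_shiftRight, hj] at this
    obtain ⟨x, hx⟩ := Nat.exists_eq_succ_of_ne_zero hne
    rw [hx] at h
    simp only [force_eq] at h
    generalize hiBit [4096, 2048, 1024, 512, 256, 128, 64, 32, 16, 8, 4, 2, 1] C 128 = p at h
    cases hf : f (Nat.sub p 128) hs with
    | none => rw [hf] at h; simp at h
    | some hs' =>
      rw [hf] at h
      simp only at h
      by_cases hp : p = 128 + j
      · subst hp
        refine ⟨hs, hs', ?_⟩
        rw [← hf]
        exact congrArg (fun x => f x hs) (Nat.add_sub_cancel_left _ _).symm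
      · refine ih h ?_
        show (C ^^^ (1 <<< p)).testBit (128 + j) = true
        rw [Nat.testBit_xor, hj, Nat.one_shiftLeft, Nat.testBit_two_pow_of_ne hp]; rfl

/-- a valid candidate -/
structure Cand (j g : Nat) (fs : List Nat) : Prop where
  eq : candF j = (g, fs)
  val : (∃ d e, d < 45 ∧ e < 120 ∧ j = 120 * d + e ∧ fs = [pairAt d, tripAt e] ∧ g = pairAt d ||| tripAt e ∧
      pairAt d &&& tripAt e = 0) ∨
    (∃ q, q < 210 ∧ j = 5400 + q ∧ g = quadAt q ∧ fs = [g])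

theorem cand_bip {d e : Nat} (hd : d < 45) (he : e < 120) (h : pairAt d &&& tripAt e = 0) :
    Cand (120 * d + e) (pairAt d ||| tripAt e) [pairAt d, tripAt e] := by
  refine ⟨?_, Or.inl ⟨d, e, hd, he, rfl, rfl, rfl, h⟩⟩
  have h1 : Nat.ble (120 * d + e) 5399 = true := by rw [Nat.ble_eq]; omega
  have h2 : Nat.div (120 * d + e) 120 = d := by show (120 * d + e) / 120 = d; omega
  have h3 : Nat.mod (120 * d + e) 120 = e := by show (120 * d + e) % 120 = e; omega
  simp only [candF, h1, h2, h3, force_eq]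
  rfl

theorem cand_tet {q : Nat} (hq : q < 210) : Cand (5400 + q) (quadAt q) [quadAt q] := by
  refine ⟨?_, Or.inr ⟨q, hq, rfl, rfl, rfl⟩⟩
  have h1 : Nat.ble (5400 + q) 5399 = false := by
    rw [← Bool.not_eq_true, Nat.ble_eq]; omega
  have h2 : Nat.sub (5400 + q) 5400 = q := Nat.add_sub_cancel_left _ _
  simp only [candF, h1, h2, force_eq]

structure TabsOK (t : Tabs) : Prop where
  nc : ∀ {j g fs}, Cand j g fs → ∀ i < 10, (colsAt t.nc (128 + j)).testBit i = !g.testBit i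
  alln : ∀ {j g fs}, Cand j g fs → t.allN.testBit (128 + j) = true
  bip : ∀ {j g fs}, Cand j g fs → j < 5400 → t.bipN.testBit (128 + j) = true
  b0 : ∀ {j g fs}, Cand j g fs → t.b0.testBit (128 + j) = true
  dv : ∀ {j g fs}, Cand j g fs → ∀ m < 1024, noSub fs m = true →
    (orSel t.dv (Nat.xor 1023 m)).testBit (128 + j) = true
  ev : ∀ {j g fs}, Cand j g fs → ∀ m < 1024, noSub fs m = true →
    (orSel t.ev (Nat.xor 1023 m)).testBit (128 + j) = true
  al1 : ∀ {j g fs}, Cand j g fs → ∀ k ≤ 10, g < 2 ^ (k + 1) → (nthL t.al k).testBit (128 + j) = true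
  al2 : ∀ {j g d e}, Cand j g [d, e] → ∀ k ≤ 10, g < 2 ^ (k + 2) → d.testBit k = true →
    e.testBit (k + 1) = true → (nthL t.al k).testBit (128 + j) = true

theorem allLt_iff (f : Nat → Bool) (n : Nat) (h : allLt f n = true) : ∀ j < n, f j = true := by
  induction n with
  | zero => simp
  | succ n ih =>
    have e : allLt f (n+1) = Bool.rec (motive := fun _ => Bool) false (allLt f n) (f n) := rfl
    rw [e] at h
    cases hf : f n <;> rw [hf] at h <;> simp at h
    intro j hj
    rcases Nat.lt_succ_iff_lt_or_eq.1 hj with h2 | rfl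
    · exact ih h j h2
    · exact hf

theorem allK_iff (f : Nat → Bool) (h : allK f = true) : ∀ k ≤ 10, f k = true := by
  have key : ∀ l : List Nat, List.rec (motive := fun _ => Bool) true
      (fun k _ ih => Bool.rec (motive := fun _ => Bool) false ih (f k)) l = true → ∀ k ∈ l, f k = true := by
    intro l
    induction l with
    | nil => simp
    | cons x l ih =>
      intro h
      change Bool.rec (motive := fun _ => Bool) false (List.rec (motive := fun _ => Bool) true
        (fun k _ ih => Bool.rec (motive := fun _ => Bool) false ih (f k)) l) (f x) = true at h
      cases hf : f x <;> rw [hf] at h <;> simp at h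
      intro k hk
      rcases List.mem_cons.1 hk with rfl | hk
      · exact hf
      · exact ih h k hk
  intro k hk
  exact key [0, 1, 2, 3, 4, 5, 6, 7, 8, 9, 10] h k (by simp; omega)

theorem sr_zero {g n : Nat} (h : g < 2 ^ n) : Nat.beq (Nat.shiftRight g n) 0 = true := by
  rw [beqt_iff]
  show g >>> n = 0
  rw [Nat.shiftRight_eq_div_pow, Nat.div_eq_of_lt h]

theorem bitAt_one {m i : Nat} : Nat.beq (bitAt m i) 1 = true ↔ m.testBit i = true := by
  rw [beqt_iff, bitAt_eq]; cases m.testBit i <;> simp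

theorem nc_aux {c g : Nat} (h : Nat.beq (Nat.xor c g) 1023 = true) : ∀ i < 10, c.testBit i = !g.testBit i := by
  intro i hi
  rw [beqt_iff] at h
  have := congrArg (fun n => n.testBit i) h
  have h2 : (1023 : Nat).testBit i = true := by interval_cases i <;> rfl
  have h3 : (Nat.xor c g).testBit i = (c.testBit i ^^ g.testBit i) := Nat.testBit_xor ..
  simp only [h2, h3] at this
  revert this
  cases c.testBit i <;> cases g.testBit i <;> simp

theorem sub_aux {f m : Nat} (hf : f < 1024) (h : f &&& m ≠ f) :
    ∃ i < 10, f.testBit i = true ∧ (Nat.xor 1023 m).testBit i = true := by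
  by_contra hc
  push Not at hc
  apply h
  apply Nat.eq_of_testBit_eq
  intro i
  rw [Nat.testBit_and]
  by_cases hi : i < 10
  · cases hfi : f.testBit i
    · simp
    · have := hc i hi hfi
      have h3 : (Nat.xor 1023 m).testBit i = ((1023 : Nat).testBit i ^^ m.testBit i) := Nat.testBit_xor ..
      have h2 : (1023 : Nat).testBit i = true := by interval_cases i <;> rfl
      rw [h3, h2] at this
      simpa using this
  · have : f.testBit i = false := Nat.testBit_lt_two_pow (lt_of_lt_of_le hf
      (by calc 1024 = 2 ^ 10 := by norm_num
           _ ≤ 2 ^ i := Nat.pow_le_pow_right (by norm_num) (by omega)))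
    simp [this]

theorem at_lt (n : Nat) : Nat.land n 1023 < 1024 := by
  have : n &&& 1023 ≤ 1023 := Nat.and_le_right
  exact Nat.lt_succ_of_le this

theorem bip_aux {t : Tabs} {p d e : Nat} (h : checkBip t p d e = true) (h0 : d &&& e = 0) :
    Nat.beq (Nat.xor (colsAt t.nc p) (d ||| e)) 1023 = true ∧ Nat.beq (bitAt t.allN p) 1 = true ∧
      Nat.beq (colsAt t.dv p) d = true ∧ Nat.beq (colsAt t.ev p) e = true ∧ Nat.beq (bitAt t.bipN p) 1 = true ∧
      Nat.beq (bitAt t.b0 p) 1 = true ∧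
      allK (fun k => Nat.beq (bitAt (nthL t.al k) p) 1 ||
        !(Nat.beq (Nat.shiftRight (d ||| e) (k + 1)) 0 || (Nat.beq (Nat.shiftRight (d ||| e) (k + 2)) 0 &&
          (Nat.beq (bitAt d k) 1 && Nat.beq (bitAt e (k + 1)) 1)))) = true := by
  have e2 : Nat.beq (Nat.land d e) 0 = true := beqt_iff.2 h0
  rw [checkBip, e2] at h
  simp only [force_eq, Bool.and_eq_true] at h
  exact h

theorem tet_aux {t : Tabs} {p g : Nat} (h : checkTet t p g = true) :
    Nat.beq (Nat.xor (colsAt t.nc p) g) 1023 = true ∧ Nat.beq (bitAt t.allN p) 1 = true ∧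
      Nat.beq (colsAt t.dv p) 1023 = true ∧ Nat.beq (colsAt t.ev p) g = true ∧
      Nat.beq (bitAt t.b0 p) 1 = true ∧
      allK (fun k => Nat.beq (bitAt (nthL t.al k) p) 1 || !(Nat.beq (Nat.shiftRight g (k + 1)) 0)) = true := by
  rw [checkTet] at h
  simp only [Bool.and_eq_true] at h
  exact h

theorem tabsOK_of {t : Tabs} (h : checkAll t = true) : TabsOK t := by
  rw [checkAll, Bool.and_eq_true] at h
  obtain ⟨h1, h2⟩ := h
  have B : ∀ d < 45, ∀ e < 120, pairAt d &&& tripAt e = 0 →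
      checkBip t (128 + (120 * d + e)) (pairAt d) (tripAt e) = true := by
    intro d hd e he _
    have := allLt_iff _ _ (allLt_iff _ _ h1 d hd) e he
    simp only [force_eq] at this
    exact this
  have T : ∀ q < 210, checkTet t (128 + (5400 + q)) (quadAt q) = true := by
    intro q hq
    have := allLt_iff _ _ h2 q hq
    simp only [force_eq] at this
    rw [← Nat.add_assoc]
    exact this
  clear h1 h2
  have B' := fun d hd e he h0 => bip_aux (B d hd e he h0) h0
  have T' := fun q hq => tet_aux (T q hq)
  clear B T
  refine ⟨?_, ?_, ?_, ?_, ?_, ?_, ?_, ?_⟩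
  · rintro j g fs ⟨-, ⟨d, e, hd, he, rfl, rfl, rfl, h0⟩ | ⟨q, hq, rfl, rfl, rfl⟩⟩
    · exact nc_aux (B' d hd e he h0).1
    · exact nc_aux (T' q hq).1
  · rintro j g fs ⟨-, ⟨d, e, hd, he, rfl, rfl, rfl, h0⟩ | ⟨q, hq, rfl, rfl, rfl⟩⟩
    · exact bitAt_one.1 (B' d hd e he h0).2.1
    · exact bitAt_one.1 (T' q hq).2.1
  · rintro j g fs ⟨-, ⟨d, e, hd, he, rfl, rfl, rfl, h0⟩ | ⟨q, hq, rfl, rfl, rfl⟩⟩ hj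
    · exact bitAt_one.1 (B' d hd e he h0).2.2.2.2.1
    · omega
  · rintro j g fs ⟨-, ⟨d, e, hd, he, rfl, rfl, rfl, h0⟩ | ⟨q, hq, rfl, rfl, rfl⟩⟩
    · exact bitAt_one.1 (B' d hd e he h0).2.2.2.2.2.1
    · exact bitAt_one.1 (T' q hq).2.2.2.2.1
  · rintro j g fs ⟨-, ⟨d, e, hd, he, rfl, rfl, rfl, h0⟩ | ⟨q, hq, rfl, rfl, rfl⟩⟩ m hm hn
    · rw [noSub_iff] at hn
      obtain ⟨i, hi, h3, h4⟩ := sub_aux (at_lt _) (hn (pairAt d) (by simp))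
      refine cols_orSel h4 ?_
      rw [beqt_iff.1 (B' d hd e he h0).2.2.1]
      exact h3
    · rw [noSub_iff] at hn
      obtain ⟨i, hi, h3, h4⟩ := sub_aux (at_lt _) (hn (quadAt q) (by simp))
      refine cols_orSel h4 ?_
      rw [beqt_iff.1 (T' q hq).2.2.1]
      interval_cases i <;> rfl
  · rintro j g fs ⟨-, ⟨d, e, hd, he, rfl, rfl, rfl, h0⟩ | ⟨q, hq, rfl, rfl, rfl⟩⟩ m hm hn
    · rw [noSub_iff] at hn
      obtain ⟨i, hi, h3, h4⟩ := sub_aux (at_lt _) (hn (tripAt e) (by simp))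
      refine cols_orSel h4 ?_
      rw [beqt_iff.1 (B' d hd e he h0).2.2.2.1]
      exact h3
    · rw [noSub_iff] at hn
      obtain ⟨i, hi, h3, h4⟩ := sub_aux (at_lt _) (hn (quadAt q) (by simp))
      refine cols_orSel h4 ?_
      rw [beqt_iff.1 (T' q hq).2.2.2.1]
      exact h3
  · rintro j g fs ⟨-, ⟨d, e, hd, he, rfl, rfl, rfl, h0⟩ | ⟨q, hq, rfl, rfl, rfl⟩⟩ k hk hg
    · have := allK_iff _ (B' d hd e he h0).2.2.2.2.2.2 k hk
      have h5 := sr_zero hg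
      rw [h5] at this
      exact bitAt_one.1 (by simpa using this)
    · have := allK_iff _ (T' q hq).2.2.2.2.2 k hk
      have h5 := sr_zero hg
      rw [h5] at this
      exact bitAt_one.1 (by simpa using this)
  · rintro j g d' e' ⟨-, ⟨d, e, hd, he, rfl, hf, rfl, h0⟩ | ⟨q, hq, rfl, rfl, hf⟩⟩ k hk hg hdk hek
    · obtain ⟨rfl, rfl⟩ : d' = pairAt d ∧ e' = tripAt e := by simpa using hf
      have := allK_iff _ (B' d hd e he h0).2.2.2.2.2.2 k hk
      have h5 := sr_zero hg
      have h7 := bitAt_one.2 hdk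
      have h8 : Nat.beq (bitAt (tripAt e) (k + 1)) 1 = true := bitAt_one.2 hek
      rw [h5, h7, h8] at this
      exact bitAt_one.1 (by simpa using this)
    · simp at hf

/-- the candidates compatible with the list survive in `B` -/
def InvB (L : List Fct) (B : Nat) : Prop :=
  ∀ j g fs, Cand j g fs → (∀ h ∈ L, noSub h.2 g = true ∧ noSub fs h.1 = true) → B.testBit (128 + j) = true

theorem andForb_bit {nc : Tab} {fs : List Nat} {B p : Nat} (h : B.testBit p = true)
    (h2 : ∀ f ∈ fs, (orSel nc f).testBit p = true) : (andForb nc fs B).testBit p = true := by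
  induction fs with
  | nil => exact h
  | cons f l ih =>
    show (orSel nc f &&& andForb nc l B).testBit p = true
    rw [Nat.testBit_and, Bool.and_eq_true]
    exact ⟨h2 f (by simp), ih fun f hf => h2 f (by simp [hf])⟩

theorem InvB.step {t : Tabs} (ht : TabsOK t) {L : List Fct} {B : Nat} (h : InvB L B) (sa g : Nat) (gf : List Nat)
    (hg : g < 1024) (hgf : ∀ f ∈ gf, f < 1024) :
    InvB ((g, gf) :: L) (Nat.lor sa (compat t.dv t.ev t.nc g gf B)) := by
  intro j c fs hc hL
  show (sa ||| compat t.dv t.ev t.nc g gf B).testBit (128 + j) = true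
  rw [Nat.testBit_or, Bool.or_eq_true]
  right
  have hb := h j c fs hc fun x hx => hL x (by simp [hx])
  obtain ⟨h1, h2⟩ := hL (g, gf) (by simp)
  simp only [compat, force_eq]
  apply andForb_bit
  · show (_ &&& (_ &&& B)).testBit (128 + j) = true
    rw [Nat.testBit_and, Nat.testBit_and, hb, ht.dv hc g hg h2, ht.ev hc g hg h2]; rfl
  · intro f hf
    rw [noSub_iff] at h1
    obtain ⟨i, hi, h3, h4⟩ := sub_aux (hgf f hf) (h1 f hf)
    refine cols_orSel h3 ?_
    rw [ht.nc hc i hi]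
    have h5 : (Nat.xor 1023 c).testBit i = ((1023 : Nat).testBit i ^^ c.testBit i) := Nat.testBit_xor ..
    have h6 : (1023 : Nat).testBit i = true := by interval_cases i <;> rfl
    rw [h5, h6] at h4
    simpa using h4

theorem InvB.init {t : Tabs} (ht : TabsOK t) (L : List Fct) (hL : ∀ h ∈ L, h.1 < 1024 ∧ ∀ f ∈ h.2, f < 1024) :
    InvB L (initB t L) := by
  induction L with
  | nil => intro j g fs hc _; exact ht.b0 hc
  | cons x l ih =>
    exact (ih fun h hh => hL h (by simp [hh])).step ht 0 x.1 x.2 (hL x (by simp)).1 (hL x (by simp)).2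

/-- membership of a candidate in the set of candidates at a node -/
theorem cand_mem {t : Tabs} (ht : TabsOK t) {j g : Nat} {fs : List Nat} (hc : Cand j g fs) {T : Nat} (hT : T < 1024)
    (hTg : T &&& g = T) : (Nat.xor t.allN (orSel t.nc T)).testBit (128 + j) = true := by
  show (t.allN ^^^ (orSel t.nc T)).testBit (128 + j) = true
  rw [Nat.testBit_xor, ht.alln hc]
  have : (orSel t.nc T).testBit (128 + j) = false := by
    by_contra hcon
    rw [Bool.not_eq_false] at hcon
    obtain ⟨i, h1, h2⟩ := orSel_cols hcon
    have hi : i < 10 := by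
      by_contra hi
      rw [Nat.testBit_lt_two_pow (lt_of_lt_of_le hT
      (by calc 1024 = 2 ^ 10 := by norm_num
           _ ≤ 2 ^ i := Nat.pow_le_pow_right (by norm_num) (by omega)))] at h1
      simp at h1
    rw [ht.nc hc i hi] at h2
    have := congrArg (fun n => n.testBit i) hTg
    simp only [Nat.testBit_and, h1, Bool.true_and] at this
    simp [this] at h2
  rw [this]; rfl

/-! ## The abstract model and soundness of the search -/

section Model

variable {ι : Type} [DecidableEq ι]

def Good (Fac Tri Spec : Finset ι → Prop) (F : Finset ι) (fs : List (Finset ι)) : Prop :=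
  Fac F ∧ (∀ f ∈ fs, f ⊆ F ∧ (∀ G, Fac G → f ⊆ G → G = F ∨ (Spec F ∧ Spec G)) ∧ ∀ T, Tri T → T ⊆ F → ¬ f ⊆ T) ∧
    ∀ T, T ⊆ F → T.card = 3 → (∀ f ∈ fs, ¬ f ⊆ T) → Tri T

structure IsModel (Fac Tri Spec : Finset ι → Prop) (tb : ℕ) : Prop where
  tri3 : ∀ T, Tri T → T.card = 3
  nbr : ∀ T H, Tri T → Fac H → T ⊆ H → ∃ G, Fac G ∧ G ≠ H ∧ T ⊆ G
  cls : ∀ G, Fac G → Spec G ∨ (G.card = 4 ∧ Good Fac Tri Spec G [G]) ∨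
    ∃ a x p q y, [a, x, p, q, y].Nodup ∧ G = {a, x, p, q, y} ∧ Good Fac Tri Spec G [{a, x}, {p, q, y}]
  closed : ∀ A : Finset (Finset ι), (∀ F ∈ A, Fac F) → 8 ≤ A.card → A.card ≤ 11 →
    ∃ H ∈ A, ∃ T, Tri T ∧ T ⊆ H ∧ ∀ G ∈ A, T ⊆ G → G = H
  tets : ∀ A : Finset (Finset ι), (∀ F ∈ A, Fac F ∧ ¬ Spec F ∧ F.card = 4) → A.card ≤ tb
  pattern : ∀ (H : Finset ι) (c d u v r s x y z w k l : ι), Fac H → H.card = 6 →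
    [c, d, u, v, r, s].Nodup → (∀ i ∈ [c, d, u, v, r, s], i ∈ H) →
    (∀ i ∈ [x, y, z, w, k, l], i ∉ H) → x ≠ y → z ≠ w → k ≠ l →
    Good Fac Tri Spec {c, x, u, r, y} [{c, x}, {u, r, y}] → Good Fac Tri Spec {d, y, u, s, x} [{d, y}, {u, s, x}] →
    Good Fac Tri Spec {c, z, v, s, w} [{c, z}, {v, s, w}] → Good Fac Tri Spec {d, w, v, r, z} [{d, w}, {v, r, z}] →
    Good Fac Tri Spec {u, k, d, r, l} [{u, k}, {d, r, l}] → Good Fac Tri Spec {v, l, d, s, k} [{v, l}, {d, s, k}] → False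

/-- the set of points with labels in the mask `m` -/
def RR (v : ℕ → ι) (m : ℕ) : Finset ι := ((Finset.range 10).filter fun i => m.testBit i = true).image v

theorem lt10 {m i k : ℕ} (hm : m < 2 ^ k) (hi : m.testBit i = true) : i < k := by
  by_contra h
  rw [Nat.testBit_lt_two_pow (lt_of_lt_of_le hm (Nat.pow_le_pow_right (by norm_num) (not_lt.1 h)))] at hi
  simp at hi

theorem RR_mem {v : ℕ → ι} {k m : ℕ} (hk : k ≤ 10) (hm : m < 2 ^ k) {x : ι} :
    x ∈ RR v m ↔ ∃ i, m.testBit i = true ∧ v i = x := by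
  simp only [RR, Finset.mem_image, Finset.mem_filter, Finset.mem_range]
  constructor
  · rintro ⟨i, ⟨_, h⟩, rfl⟩; exact ⟨i, h, rfl⟩
  · rintro ⟨i, h, rfl⟩; exact ⟨i, ⟨(lt10 hm h).trans_le hk, h⟩, rfl⟩

theorem RR_mem_lab {v : ℕ → ι} {k m : ℕ} (hk : k ≤ 10) (hv : Set.InjOn v {n | n < k}) (hm : m < 2 ^ k) {i : ℕ}
    (hi : i < k) : v i ∈ RR v m ↔ m.testBit i = true := by
  rw [RR_mem hk hm]
  constructor
  · rintro ⟨j, h, e⟩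
    have := hv (lt10 hm h) hi e
    exact this ▸ h
  · intro h; exact ⟨i, h, rfl⟩

theorem RR_sub {v : ℕ → ι} {k m m' : ℕ} (hk : k ≤ 10) (hv : Set.InjOn v {n | n < k}) (hm : m < 2 ^ k)
    (hm' : m' < 2 ^ k) : RR v m ⊆ RR v m' ↔ m &&& m' = m := by
  constructor
  · intro h
    apply Nat.eq_of_testBit_eq
    intro i
    rw [Nat.testBit_and]
    cases hi : m.testBit i
    · rfl
    · have := h ((RR_mem_lab hk hv hm (lt10 hm hi)).2 hi)
      rw [RR_mem_lab hk hv hm' (lt10 hm hi)] at this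
      rw [this]; rfl
  · intro h x hx
    rw [RR_mem hk hm] at hx
    obtain ⟨i, hi, rfl⟩ := hx
    rw [RR_mem hk hm']
    refine ⟨i, ?_, rfl⟩
    rw [← h, Nat.testBit_and, Bool.and_eq_true] at hi
    exact hi.2

theorem RR_inj {v : ℕ → ι} {k m m' : ℕ} (hk : k ≤ 10) (hv : Set.InjOn v {n | n < k}) (hm : m < 2 ^ k)
    (hm' : m' < 2 ^ k) (h : RR v m = RR v m') : m = m' := by
  have h1 := (RR_sub hk hv hm hm').1 h.le
  have h2 := (RR_sub hk hv hm' hm).1 h.ge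
  rw [← h1, Nat.and_comm, h2]

theorem RR_congr {v v' : ℕ → ι} {k m : ℕ} (hm : m < 2 ^ k) (h : ∀ n < k, v' n = v n) : RR v' m = RR v m := by
  unfold RR
  apply Finset.image_congr
  intro i hi
  simp at hi
  exact h i (lt10 hm hi.2)

theorem RR_or (v : ℕ → ι) (m m' : ℕ) : RR v (m ||| m') = RR v m ∪ RR v m' := by
  unfold RR
  rw [← Finset.image_union, ← Finset.filter_or]
  simp [Nat.testBit_or]

theorem RR_pow (v : ℕ → ι) {i : ℕ} (hi : i < 10) : RR v (2 ^ i) = {v i} := by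
  ext x
  rw [RR_mem le_rfl (Nat.pow_lt_pow_right (by norm_num) hi)]
  simp only [Nat.testBit_two_pow, decide_eq_true_eq, Finset.mem_singleton]
  constructor
  · rintro ⟨j, rfl, rfl⟩; rfl
  · rintro rfl; exact ⟨i, rfl, rfl⟩

theorem RR_exists {v : ℕ → ι} {k : ℕ} (hk : k ≤ 10) {S : Finset ι} (hS : ∀ x ∈ S, ∃ n < k, v n = x) :
    ∃ m < 2 ^ k, RR v m = S := by
  have hlt : Nat.ofBits (fun i : Fin k => decide (v i ∈ S)) < 2 ^ k := Nat.ofBits_lt_two_pow _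
  refine ⟨Nat.ofBits (fun i : Fin k => decide (v i ∈ S)), hlt, ?_⟩
  ext x
  rw [RR_mem hk hlt]
  constructor
  · rintro ⟨i, hi, rfl⟩
    rw [Nat.testBit_ofBits_lt _ _ (lt10 hlt hi)] at hi
    simpa using hi
  · intro hx
    obtain ⟨n, hn, rfl⟩ := hS x hx
    refine ⟨n, ?_, rfl⟩
    rw [Nat.testBit_ofBits_lt _ _ hn]
    simpa using hx

def pcN (m : ℕ) : ℕ := ((List.range 10).filter fun i => m.testBit i).length

theorem RR_card {v : ℕ → ι} {k m : ℕ} (hv : Set.InjOn v {n | n < k}) (hm : m < 2 ^ k) :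
    (RR v m).card = pcN m := by
  unfold RR
  rw [Finset.card_image_of_injOn]
  · simp [Finset.card_def, Finset.filter_val, Finset.range_val, Multiset.range, Multiset.filter_coe, pcN]
  · intro i hi j hj
    simp at hi hj
    exact hv (lt10 hm hi.2) (lt10 hm hj.2)

theorem trip_ex : ∀ m, m < 1024 → pcN m = 3 → ∃ e, e < 120 ∧ tripAt e = m := by
  have : ((List.range 1024).all fun m => !(pcN m == 3) || (List.range 120).any fun e => tripAt e == m) = true := by
    decide +kernel
  intro m hm h
  have := List.all_eq_true.1 this m (by simpa using hm)
  simpa [h] using this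

theorem pair_ex : ∀ m, m < 1024 → pcN m = 2 → ∃ e, e < 45 ∧ pairAt e = m := by
  have : ((List.range 1024).all fun m => !(pcN m == 2) || (List.range 45).any fun e => pairAt e == m) = true := by
    decide +kernel
  intro m hm h
  have := List.all_eq_true.1 this m (by simpa using hm)
  simpa [h] using this

theorem quad_ex : ∀ m, m < 1024 → pcN m = 4 → ∃ e, e < 210 ∧ quadAt e = m := by
  have : ((List.range 1024).all fun m => !(pcN m == 4) || (List.range 210).any fun e => quadAt e == m) = true := by
    decide +kernel
  intro m hm h
  have := List.all_eq_true.1 this m (by simpa using hm)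
  simpa [h] using this

theorem trip_pc : ∀ e, e < 120 → pcN (tripAt e) = 3 := by
  have : ((List.range 120).all fun e => pcN (tripAt e) == 3) = true := by
    decide +kernel
  intro m hm
  have := List.all_eq_true.1 this m (by simpa using hm)
  simpa using this

theorem ext1 (v : ℕ → ι) (k : ℕ) (hv : Set.InjOn v {n | n < k}) (x : ι) :
    ∃ v' k', (∀ n < k, v' n = v n) ∧ Set.InjOn v' {n | n < k'} ∧ (∃ n < k', v' n = x) ∧
      (k' = k ∨ (k' = k + 1 ∧ v' k = x)) := by
  by_cases h : ∃ n < k, v n = x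
  · exact ⟨v, k, fun _ _ => rfl, hv, h, Or.inl rfl⟩
  · have h0 : ∀ n < k, Function.update v k x n = v n := fun n hn => Function.update_of_ne hn.ne _ _
    refine ⟨Function.update v k x, k + 1, h0, ?_, ⟨k, by omega, by simp⟩, Or.inr ⟨rfl, by simp⟩⟩
    push Not at h
    intro a ha b hb e
    simp only [Set.mem_ofPred_eq, Nat.lt_succ_iff] at ha hb
    rcases ha.lt_or_eq with ha | rfl <;> rcases hb.lt_or_eq with hb | rfl
    · rw [h0 a ha, h0 b hb] at e; exact hv ha hb e
    · rw [h0 a ha] at e; simp at e; exact absurd e (h a ha)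
    · rw [h0 b hb] at e; simp at e; exact absurd e.symm (h b hb)
    · rfl

end Model

section Model2

variable {ι : Type} [DecidableEq ι]

theorem tri_nosub {Fac Tri Spec : Finset ι → Prop}
    {T H : Finset ι} (hT : Tri T) (hTH : T ⊆ H) {fs : List (Finset ι)} (hH : Good Fac Tri Spec H fs) :
    ∀ f ∈ fs, ¬ f ⊆ T := fun f hf => (hH.2.1 f hf).2.2 T hT hTH

variable [Fintype ι]

theorem newK_prop {k g k' : ℕ} (h1 : k ≤ k') (h2 : k' ≤ k + 2) (h3 : g < 2 ^ k') :
    g < 2 ^ newK k g ∧ newK k g ≤ k' ∧ k ≤ newK k g := by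
  have e : newK k g = if g < 2 ^ k then k else if g < 2 ^ (k + 1) then k + 1 else k + 2 := by
    unfold newK
    have h : ∀ n, Nat.beq (Nat.shiftRight g n) 0 = decide (g < 2 ^ n) := by
      intro n
      by_cases h : g < 2 ^ n
      · rw [sr_zero h]; simp [h]
      · simp only [h, decide_false]
        rw [beqf_iff]
        show g >>> n ≠ 0
        rw [Nat.shiftRight_eq_div_pow]
        exact (Nat.div_pos (not_lt.1 h) (by positivity)).ne'
    rw [h, show Nat.add k 1 = k + 1 from rfl, h]
    split_ifs with a b <;> simp [*]
  rw [e]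
  split_ifs with a b
  · exact ⟨a, h1, le_rfl⟩
  · refine ⟨b, ?_, by omega⟩
    by_contra h
    have : k' = k := by omega
    subst this; exact a h3
  · have : k' = k + 2 := by
      by_contra h
      have : k' = k ∨ k' = k + 1 := by omega
      rcases this with rfl | rfl
      · exact a h3
      · exact b h3
    subst this
    exact ⟨h3, le_rfl, by omega⟩

structure SInv (Fac Tri Spec : Finset ι → Prop) (tb0 : ℕ) (v : ℕ → ι) (L : List Fct) (B k tb : ℕ) : Prop where
  inj : Set.InjOn v {n | n < k}
  lt : ∀ h ∈ L, h.1 < 2 ^ k ∧ ∀ f ∈ h.2, f < 2 ^ k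
  good : ∀ h ∈ L, Good Fac Tri Spec (RR v h.1) (h.2.map (RR v))
  spec : ∀ G, Spec G → ∃ h ∈ L, G = RR v h.1
  tet : ∃ A : Finset (Finset ι), (∀ F ∈ A, Fac F ∧ ¬ Spec F ∧ F.card = 4 ∧ ∃ h ∈ L, F = RR v h.1) ∧ tb0 ≤ A.card + tb
  invB : InvB L B

theorem SInv.k_le {Fac Tri Spec : Finset ι → Prop} {tb0 : ℕ} {v : ℕ → ι} {L : List Fct} {B k tb : ℕ}
    (hc : Fintype.card ι = 10) (h : SInv Fac Tri Spec tb0 v L B k tb) : k ≤ 10 := by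
  have := Finset.card_le_univ ((Finset.range k).image v)
  rwa [Finset.card_image_of_injOn, Finset.card_range, hc] at this
  intro a ha b hb e
  exact h.inj (by simpa using ha) (by simpa using hb) e

theorem k_le_of_inj (hc : Fintype.card ι = 10) {v : ℕ → ι} {k : ℕ} (h : Set.InjOn v {n | n < k}) : k ≤ 10 := by
  have := Finset.card_le_univ ((Finset.range k).image v)
  rwa [Finset.card_image_of_injOn, Finset.card_range, hc] at this
  intro a ha b hb e
  exact h (by simpa using ha) (by simpa using hb) e

/-- adding a facet to the list -/
theorem SInv.add {t : Tabs} (ht : TabsOK t) {Fac Tri Spec : Finset ι → Prop} {tb0 : ℕ}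
    (hc : Fintype.card ι = 10) (M : IsModel Fac Tri Spec tb0)
    {v : ℕ → ι} {L : List Fct} {B k tb : ℕ} (h : SInv Fac Tri Spec tb0 v L B k tb) {T G : Finset ι}
    (hTri : Tri T) (hTk : ∀ x ∈ T, ∃ n < k, v n = x) (hG : Fac G) (hTG : T ⊆ G)
    (hnL : ∀ x ∈ L, G ≠ RR v x.1) :
    ∃ j g fs, Cand j g fs ∧ B.testBit (128 + j) = true ∧ (nthL t.al k).testBit (128 + j) = true ∧
      (tb = 0 → j < 5400) ∧ (∀ t', RR v t' = T → t' < 2 ^ k → t' &&& g = t') ∧ g < 1024 ∧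
      (∀ sa, ∃ v', SInv Fac Tri Spec tb0 v' ((g, fs) :: L)
        (Nat.lor sa (compat t.dv t.ev t.nc g fs B)) (newK k g) (tb - j / 5400)) := by
  have hk := h.k_le hc
  have hnS : ¬ Spec G := fun hs => by
    obtain ⟨x, hx, e⟩ := h.spec G hs
    exact hnL x hx e
  have hT3 := M.tri3 T hTri
  -- the common part
  have main : ∀ (v' : ℕ → ι) (k' j g : ℕ) (fs : List ℕ), Cand j g fs → (∀ n < k, v' n = v n) →
      Set.InjOn v' {n | n < k'} → k ≤ k' → k' ≤ k + 2 → g < 2 ^ k' → (∀ f ∈ fs, f &&& g = f) →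
      RR v' g = G → Good Fac Tri Spec G (fs.map (RR v')) →
      (nthL t.al k).testBit (128 + j) = true → (j < 5400 ∨ j < 10800 ∧ G.card = 4) → 
      ∃ j g fs, Cand j g fs ∧ B.testBit (128 + j) = true ∧ (nthL t.al k).testBit (128 + j) = true ∧
      (tb = 0 → j < 5400) ∧ (∀ t', RR v t' = T → t' < 2 ^ k → t' &&& g = t') ∧ g < 1024 ∧
      (∀ sa, ∃ v', SInv Fac Tri Spec tb0 v' ((g, fs) :: L)
        (Nat.lor sa (compat t.dv t.ev t.nc g fs B)) (newK k g) (tb - j / 5400)) := by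
    intro v' k' j g fs hcand hvv hinj hkk hkk2 hg hfs hRG hgood hal hj
    have hk' : k' ≤ 10 := k_le_of_inj hc hinj
    have hlt : ∀ m, m < 2 ^ k → m < 2 ^ k' := fun m hm => hm.trans_le (Nat.pow_le_pow_right (by norm_num) hkk)
    have hfs' : ∀ f ∈ fs, f < 2 ^ k' := fun f hf => by
      rw [← hfs f hf]; exact lt_of_le_of_lt Nat.and_le_right hg
    have h1024 : ∀ m, m < 2 ^ k' → m < 1024 := fun m hm => hm.trans_le (by
      calc 2 ^ k' ≤ 2 ^ 10 := Nat.pow_le_pow_right (by norm_num) hk'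
        _ = 1024 := by norm_num)
    have hRc : ∀ m, m < 2 ^ k → RR v' m = RR v m := fun m hm => RR_congr hm hvv
    obtain ⟨n1, n2, n3⟩ := newK_prop hkk hkk2 hg
    have hA : tb = 0 → j < 5400 := by
      intro h0
      rcases hj with hj | ⟨-, hG4⟩
      · exact hj
      · exfalso
        obtain ⟨A, hA, hcard⟩ := h.tet
        have : G ∉ A := fun hGA => by
          obtain ⟨-, -, -, x, hx, e⟩ := hA G hGA
          exact hnL x hx e
        have h3 := M.tets (insert G A) (by
          intro F hF
          rcases Finset.mem_insert.1 hF with rfl | hF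
          · exact ⟨hG, hnS, hG4⟩
          · exact ⟨(hA F hF).1, (hA F hF).2.1, (hA F hF).2.2.1⟩)
        rw [Finset.card_insert_of_notMem this] at h3
        omega
    refine ⟨j, g, fs, hcand, ?_, hal, hA, ?_, h1024 g hg, ?_⟩
    · refine h.invB j g fs hcand ?_
      intro x hx
      obtain ⟨l1, l2⟩ := h.lt x hx
      have hgx := h.good x hx
      constructor
      · rw [noSub_iff]
        intro f hf hfg
        rw [← RR_sub hk' hinj (hlt f (l2 f hf)) hg, hRG, hRc _ (l2 f hf)] at hfg
        exact hnL x hx (((hgx.2.1 (RR v f) (List.mem_map_of_mem hf)).2.1 G hG hfg).resolve_right fun hh => hnS hh.2)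
      · rw [noSub_iff]
        intro f hf hfg
        rw [← RR_sub hk' hinj (hfs' f hf) (hlt _ l1), hRc _ l1] at hfg
        exact hnL x hx (((hgood.2.1 (RR v' f) (List.mem_map_of_mem hf)).2.1 _ hgx.1 hfg).resolve_right fun hh => hnS hh.1).symm
    · intro t' ht' htk
      rw [← RR_sub hk' hinj (hlt t' htk) hg, hRG, hRc _ htk, ht']
      exact hTG
    · intro sa
      refine ⟨v', ⟨?_, ?_, ?_, ?_, ?_, ?_⟩⟩
      · exact fun a ha b hb e => hinj (lt_of_lt_of_le ha n2) (lt_of_lt_of_le hb n2) e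
      · have hlt2 : ∀ m, m < 2 ^ k → m < 2 ^ newK k g := fun m hm =>
          hm.trans_le (Nat.pow_le_pow_right (by norm_num) n3)
        intro x hx
        rcases List.mem_cons.1 hx with rfl | hx
        · refine ⟨n1, fun f hf => ?_⟩
          rw [← hfs f hf]; exact lt_of_le_of_lt Nat.and_le_right n1
        · exact ⟨hlt2 _ (h.lt x hx).1, fun f hf => hlt2 _ ((h.lt x hx).2 f hf)⟩
      · intro x hx
        rcases List.mem_cons.1 hx with rfl | hx
        · rw [hRG]; exact hgood
        · rw [hRc _ (h.lt x hx).1]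
          have : List.map (RR v') x.2 = List.map (RR v) x.2 :=
            List.map_congr_left fun f hf => hRc _ ((h.lt x hx).2 f hf)
          rw [this]
          exact h.good x hx
      · intro F hF
        obtain ⟨x, hx, e⟩ := h.spec F hF
        exact ⟨x, by simp [hx], by rw [hRc _ (h.lt x hx).1]; exact e⟩
      · obtain ⟨A, hA2, hcard⟩ := h.tet
        have hGA : G ∉ A := fun hGA => by
          obtain ⟨-, -, -, x, hx, e⟩ := hA2 G hGA
          exact hnL x hx e
        have old : ∀ F ∈ A, Fac F ∧ ¬ Spec F ∧ F.card = 4 ∧ ∃ h ∈ (g, fs) :: L, F = RR v' h.1 := by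
          intro F hF
          obtain ⟨a, b, c, x, hx, e⟩ := hA2 F hF
          exact ⟨a, b, c, x, by simp [hx], by rw [hRc _ (h.lt x hx).1]; exact e⟩
        rcases hj with hj | ⟨hj, hG4⟩
        · refine ⟨A, old, ?_⟩
          rw [Nat.div_eq_of_lt hj]; exact hcard
        · refine ⟨insert G A, ?_, ?_⟩
          · intro F hF
            rcases Finset.mem_insert.1 hF with rfl | hF
            · exact ⟨hG, hnS, hG4, (g, fs), by simp, hRG.symm⟩
            · exact old F hF
          · rw [Finset.card_insert_of_notMem hGA]
            have : j / 5400 ≤ 1 := by omega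
            omega
      · exact h.invB.step ht sa g fs (h1024 g hg) (fun f hf => h1024 f (hfs' f hf))
  rcases M.cls G hG with hs | ⟨hG4, hgood⟩ | ⟨a, x, p, q, y, hnd, hGe, hgood⟩
  · exact absurd hs hnS
  · -- a tetrahedron
    have hcs : (G \ T).card = 1 := by rw [Finset.card_sdiff_of_subset hTG, hG4, hT3]
    obtain ⟨z, hz⟩ := Finset.card_eq_one.1 hcs
    obtain ⟨v', k', hvv, hinj, hzx, hk'⟩ := ext1 v k h.inj z
    have hkk : k ≤ k' := by omega
    have hk10 := k_le_of_inj hc hinj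
    obtain ⟨m, hm, hR⟩ := RR_exists (v := v') (S := G) hk10 (by
      intro x hx
      by_cases hxT : x ∈ T
      · obtain ⟨n, hn, e⟩ := hTk x hxT
        exact ⟨n, by omega, by rw [hvv n hn]; exact e⟩
      · have : x ∈ G \ T := by simp [hx, hxT]
        rw [hz, Finset.mem_singleton] at this
        rw [this]; exact hzx)
    have hpc : pcN m = 4 := by rw [← RR_card hinj hm, hR, hG4]
    have h10 : m < 1024 := hm.trans_le (by
      calc 2 ^ k' ≤ 2 ^ 10 := Nat.pow_le_pow_right (by norm_num) hk10
        _ = 1024 := by norm_num)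
    obtain ⟨e, he, rfl⟩ := quad_ex m h10 hpc
    refine main v' k' (5400 + e) (quadAt e) [quadAt e] (cand_tet he) hvv hinj hkk (by omega) hm (by simp) hR
      (by simpa [hR] using hgood) (ht.al1 (cand_tet he) k hk ?_) (Or.inr ⟨by omega, hG4⟩)
    exact hm.trans_le (Nat.pow_le_pow_right (by norm_num) (by omega))
  · -- a bipyramid
    have hns := tri_nosub hTri hTG hgood
    have hD : ∃ x' ∈ ({a, x} : Finset ι), x' ∉ T := Finset.not_subset.1 (hns {a, x} (by simp))
    have hE : ∃ y' ∈ ({p, q, y} : Finset ι), y' ∉ T := Finset.not_subset.1 (hns {p, q, y} (by simp))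
    obtain ⟨x', hx', hxT⟩ := hD
    obtain ⟨y', hy', hyT⟩ := hE
    simp only [List.nodup_cons, List.mem_cons, List.not_mem_nil, or_false, not_or, List.nodup_nil] at hnd
    have hdisj : Disjoint ({a, x} : Finset ι) {p, q, y} := by
      rw [Finset.disjoint_left]; simp; grind
    have hxy : x' ≠ y' := fun e => Finset.disjoint_left.1 hdisj hx' (e ▸ hy')
    have hGu : G = {a, x} ∪ {p, q, y} := by rw [hGe]; ext; simp; tauto
    have hDc : ({a, x} : Finset ι).card = 2 := Finset.card_pair (by grind)
    have hEc : ({p, q, y} : Finset ι).card = 3 := Finset.card_eq_three.2 ⟨p, q, y, by grind, by grind, by grind, rfl⟩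
    have hG5 : G.card = 5 := by rw [hGu, Finset.card_union_of_disjoint hdisj, hDc, hEc]
    have hcs : (G \ T).card = 2 := by rw [Finset.card_sdiff_of_subset hTG, hG5, hT3]
    have hGT : {x', y'} = G \ T := by
      apply Finset.eq_of_subset_of_card_le
      · intro z hz
        rw [Finset.mem_insert, Finset.mem_singleton] at hz
        rw [Finset.mem_sdiff, hGu, Finset.mem_union]
        rcases hz with rfl | rfl
        · exact ⟨Or.inl hx', hxT⟩
        · exact ⟨Or.inr hy', hyT⟩
      · rw [hcs, Finset.card_pair hxy]
    obtain ⟨v1, k1, hvv1, hinj1, hz1, hk1⟩ := ext1 v k h.inj x'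
    obtain ⟨v2, k2, hvv2, hinj2, hz2, hk2⟩ := ext1 v1 k1 hinj1 y'
    have hvv : ∀ n < k, v2 n = v n := fun n hn => by rw [hvv2 n (by omega), hvv1 n hn]
    have hk10 := k_le_of_inj hc hinj2
    have hkk : k ≤ k2 := by omega
    have hcov : ∀ x ∈ G, ∃ n < k2, v2 n = x := by
      intro x hx
      by_cases hxT : x ∈ T
      · obtain ⟨n, hn, e⟩ := hTk x hxT
        exact ⟨n, by omega, by rw [hvv n hn]; exact e⟩
      · have : x ∈ G \ T := by simp [hx, hxT]
        rw [← hGT, Finset.mem_insert, Finset.mem_singleton] at this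
        rcases this with rfl | rfl
        · obtain ⟨n, hn, e⟩ := hz1
          exact ⟨n, by omega, by rw [hvv2 n hn]; exact e⟩
        · exact hz2
    obtain ⟨d, hd, hRd⟩ := RR_exists (v := v2) (S := {a, x}) hk10 (fun x hx => hcov x (by rw [hGu]; exact Finset.mem_union_left _ hx))
    obtain ⟨e, he, hRe⟩ := RR_exists (v := v2) (S := {p, q, y}) hk10 (fun x hx => hcov x (by rw [hGu]; exact Finset.mem_union_right _ hx))
    have hle : 2 ^ k2 ≤ 1024 := by
      calc 2 ^ k2 ≤ 2 ^ 10 := Nat.pow_le_pow_right (by norm_num) hk10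
        _ = 1024 := by norm_num
    have hpd : pcN d = 2 := by rw [← RR_card hinj2 hd, hRd, hDc]
    have hpe : pcN e = 3 := by rw [← RR_card hinj2 he, hRe, hEc]
    obtain ⟨d, hd45, rfl⟩ := pair_ex d (hd.trans_le hle) hpd
    obtain ⟨e, he120, rfl⟩ := trip_ex e (he.trans_le hle) hpe
    have h0 : pairAt d &&& tripAt e = 0 := by
      by_contra hne
      obtain ⟨i, hi⟩ := Nat.exists_testBit_of_ne_zero hne
      rw [Nat.testBit_and, Bool.and_eq_true] at hi
      have m1 := (RR_mem_lab hk10 hinj2 hd (lt10 hd hi.1)).2 hi.1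
      have m2 := (RR_mem_lab hk10 hinj2 he (lt10 hd hi.1)).2 hi.2
      rw [hRd] at m1
      rw [hRe] at m2
      exact Finset.disjoint_left.1 hdisj m1 m2
    have hcand := cand_bip hd45 he120 h0
    have hm : pairAt d ||| tripAt e < 2 ^ k2 := Nat.or_lt_two_pow hd he
    have hR : RR v2 (pairAt d ||| tripAt e) = G := by rw [RR_or, hRd, hRe, hGu]
    have hal : (nthL t.al k).testBit (128 + (120 * d + e)) = true := by
      by_cases hk2' : k2 = k + 2
      · have hk1' : k1 = k + 1 := by omega
        refine ht.al2 hcand k hk (hk2' ▸ hm) ?_ ?_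
        · rw [← RR_mem_lab hk10 hinj2 hd (by omega), hRd, hvv2 k (by omega)]
          rcases hk1 with h1 | h1
          · omega
          · rw [h1.2]; exact hx'
        · rw [← RR_mem_lab hk10 hinj2 he (by omega), hRe]
          rcases hk2 with h1 | h1
          · omega
          · rw [hk1'] at h1
            rw [h1.2]; exact hy'
      · exact ht.al1 hcand k hk (hm.trans_le (Nat.pow_le_pow_right (by norm_num) (by omega)))
    refine main v2 k2 (120 * d + e) _ _ hcand hvv hinj2 hkk (by omega) hm ?_ hR
      (by simpa [hRd, hRe] using hgood) hal (Or.inl (by omega))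
    intro f hf
    simp only [List.mem_cons, List.not_mem_nil, or_false] at hf
    rcases hf with rfl | rfl
    · apply Nat.eq_of_testBit_eq; intro i; simp only [Nat.testBit_and, Nat.testBit_or]
      cases (pairAt d).testBit i <;> simp
    · apply Nat.eq_of_testBit_eq; intro i; simp only [Nat.testBit_and, Nat.testBit_or]
      cases (tripAt e).testBit i <;> simp

end Model2

section Model3

variable {ι : Type} [DecidableEq ι] [Fintype ι]

theorem closedB_false {Fac Tri Spec : Finset ι → Prop} {tb0 : ℕ}
    (hc : Fintype.card ι = 10) (M : IsModel Fac Tri Spec tb0)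
    {v : ℕ → ι} {L : List Fct} {B k tb : ℕ} (h : SInv Fac Tri Spec tb0 v L B k tb) (hcl : closedB L = true) :
    False := by
  have hk := h.k_le hc
  have hle : 2 ^ k ≤ 1024 := by
    calc 2 ^ k ≤ 2 ^ 10 := Nat.pow_le_pow_right (by norm_num) hk
      _ = 1024 := by norm_num
  unfold closedB at hcl
  simp only [Bool.and_eq_true, Nat.ble_eq, decide_eq_true_eq, List.all_eq_true] at hcl
  obtain ⟨⟨⟨h8, h11⟩, hnd⟩, hall⟩ := hcl
  have hcard : ((L.map Prod.fst).map (RR v)).toFinset.card = L.length := by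
    rw [List.toFinset_card_of_nodup]
    · simp
    · refine (List.nodup_map_iff_inj_on hnd).2 ?_
      intro a ha b hb e
      obtain ⟨x, hx, rfl⟩ := List.mem_map.1 ha
      obtain ⟨y, hy, rfl⟩ := List.mem_map.1 hb
      exact RR_inj hk h.inj (h.lt x hx).1 (h.lt y hy).1 e
  obtain ⟨H, hH, T, hT, hTH, huniq⟩ := M.closed ((L.map Prod.fst).map (RR v)).toFinset (by
    intro F hF
    simp only [List.mem_toFinset, List.mem_map] at hF
    obtain ⟨a, ⟨x, hx, rfl⟩, rfl⟩ := hF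
    exact (h.good x hx).1) (by rw [hcard]; exact h8) (by rw [hcard]; exact h11)
  simp only [List.mem_toFinset, List.mem_map] at hH
  obtain ⟨a, ⟨x, hx, rfl⟩, rfl⟩ := hH
  have hxlt := (h.lt x hx).1
  obtain ⟨m, hm, rfl⟩ := RR_exists (v := v) (S := T) hk (by
    intro z hz
    obtain ⟨i, hi, e⟩ := (RR_mem hk hxlt).1 (hTH hz)
    exact ⟨i, lt10 hxlt hi, e⟩)
  obtain ⟨e, he, rfl⟩ := trip_ex m (hm.trans_le hle) (by rw [← RR_card h.inj hm]; exact M.tri3 _ hT)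
  have := hall x hx e (by simpa using he)
  have h1 : Nat.beq (Nat.land (tripAt e) x.1) (tripAt e) = true :=
    beqt_iff.2 ((RR_sub hk h.inj hm hxlt).1 hTH)
  have h2 : noSub x.2 (tripAt e) = true := by
    rw [noSub_iff]
    intro f hf hs
    rw [← RR_sub hk h.inj ((h.lt x hx).2 f hf) hm] at hs
    exact tri_nosub hT hTH (h.good x hx) _ (List.mem_map_of_mem hf) hs
  rw [h1, h2] at this
  simp only [Bool.not_true, Bool.or_self, Bool.false_or, List.any_eq_true, Bool.and_eq_true,
    Bool.not_eq_true', beqf_iff, beqt_iff] at this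
  obtain ⟨y, hy, hne, hs⟩ := this
  have hs' := (RR_sub hk h.inj hm (h.lt y hy).1).2 hs
  exact hne (RR_inj hk h.inj (h.lt y hy).1 hxlt
    (huniq _ (by simp only [List.mem_toFinset, List.mem_map]; exact ⟨_, ⟨y, hy, rfl⟩, rfl⟩) hs'))

theorem memB_mem {g : Fct} {L : List Fct} (h : memB g L = true) : g ∈ L := by
  unfold memB at h
  simp only [List.any_eq_true, Bool.and_eq_true, beq_iff_eq] at h
  obtain ⟨x, hx, h1, h2⟩ := h
  have : x = g := Prod.ext h1 h2
  exact this ▸ hx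

theorem bipF_good {Fac Tri Spec : Finset ι → Prop} {tb0 : ℕ}
    {v : ℕ → ι} {L : List Fct} {B k tb : ℕ} (h : SInv Fac Tri Spec tb0 v L B k tb) {a x p q y : ℕ}
    (hL : memB (bipF a x p q y) L = true) (ha : a < 10) (hx : x < 10) (hp : p < 10) (hq : q < 10) (hy : y < 10) :
    Good Fac Tri Spec {v a, v x, v p, v q, v y} [{v a, v x}, {v p, v q, v y}] := by
  have := h.good _ (memB_mem hL)
  simp only [bipF, List.map_cons, List.map_nil, RR_or, RR_pow v ha, RR_pow v hx, RR_pow v hp, RR_pow v hq,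
    RR_pow v hy] at this
  have e1 : ({v a} ∪ {v x} ∪ {v p} ∪ {v q} ∪ {v y} : Finset ι) = {v a, v x, v p, v q, v y} := by
    ext; simp
  have e2 : ({v a} ∪ {v x} : Finset ι) = {v a, v x} := by
    ext; simp
  have e3 : ({v p} ∪ {v q} ∪ {v y} : Finset ι) = {v p, v q, v y} := by
    ext; simp
  rwa [e1, e2, e3] at this

theorem patB_false {Fac Tri Spec : Finset ι → Prop} {tb0 : ℕ}
    (hc : Fintype.card ι = 10) (M : IsModel Fac Tri Spec tb0)
    {v : ℕ → ι} {L : List Fct} {B k tb : ℕ} (h : SInv Fac Tri Spec tb0 v L B k tb) {hs : List ℕ}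
    (hp : patB L hs = true) : False := by
  have hk := h.k_le hc
  unfold patB at hp
  split at hp
  · rename_i c d u v' r s x y z w k' l
    simp only [Bool.and_eq_true, decide_eq_true_eq, List.all_eq_true] at hp
    obtain ⟨⟨⟨⟨⟨⟨⟨⟨⟨⟨⟨⟨⟨h0, h1⟩, h2⟩, h3⟩, h4⟩, h5⟩, h6⟩, -⟩, hnd⟩, hout⟩, hin⟩, hxy⟩, hzw⟩, hkl⟩ := hp
    have ho : ∀ i ∈ [x, y, z, w, k', l], 6 ≤ i ∧ i < 10 := fun i hi => hout i hi
    have hi6 : ∀ i ∈ [c, d, u, v', r, s], i < 6 := fun i hi => hin i hi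
    have m0 := memB_mem h0
    have lt63 := (h.lt _ m0).1
    have hk6 : 6 ≤ k := by
      by_contra hk6
      have : 2 ^ k ≤ 2 ^ 5 := Nat.pow_le_pow_right (by norm_num) (by omega)
      simp only at lt63
      omega
    -- labels in use are below `k`
    have hb : ∀ {a x p q y : ℕ}, memB (bipF a x p q y) L = true → x < k ∧ y < k := by
      intro a x p q y hm
      have hl := (h.lt _ (memB_mem hm)).1
      simp only [bipF] at hl
      constructor
      · apply lt10 hl; simp [Nat.testBit_or, Nat.testBit_two_pow]
      · apply lt10 hl; simp [Nat.testBit_or, Nat.testBit_two_pow]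
    have lab : ∀ i ∈ [x, y, z, w, k', l], i < k := by
      have a1 := hb h1
      have a3 := hb h3
      have a5 := hb h5
      intro i hi
      simp only [List.mem_cons, List.not_mem_nil, or_false] at hi
      rcases hi with rfl | rfl | rfl | rfl | rfl | rfl
      exacts [a1.1, a1.2, a3.1, a3.2, a5.1, a5.2]
    have hinjv : ∀ a b, a < k → b < k → a ≠ b → v a ≠ v b := fun a b ha hb hne e => hne (h.inj ha hb e)
    simp only [List.mem_cons, List.not_mem_nil, or_false, forall_eq_or_imp, forall_eq] at ho hi6 lab
    refine M.pattern (RR v 63) (v c) (v d) (v u) (v v') (v r) (v s) (v x) (v y) (v z) (v w) (v k') (v l)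
      (h.good _ m0).1 (by rw [RR_card h.inj lt63]; rfl) ?_ ?_ ?_
      (hinjv _ _ (by omega) (by omega) hxy) (hinjv _ _ (by omega) (by omega) hzw) (hinjv _ _ (by omega) (by omega) hkl)
      (bipF_good h h1 ?_ ?_ ?_ ?_ ?_) (bipF_good h h2 ?_ ?_ ?_ ?_ ?_) (bipF_good h h3 ?_ ?_ ?_ ?_ ?_)
      (bipF_good h h4 ?_ ?_ ?_ ?_ ?_) (bipF_good h h5 ?_ ?_ ?_ ?_ ?_) (bipF_good h h6 ?_ ?_ ?_ ?_ ?_)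
    · have : ([c, d, u, v', r, s].map v).Nodup := (List.nodup_map_iff_inj_on hnd).2 (by
        intro a ha b hb e
        have h1 := hin a ha
        have h2 := hin b hb
        exact h.inj (show a < k by omega) (show b < k by omega) e)
      exact this
    · have : ∀ i, i < 6 → v i ∈ RR v 63 := fun i hi => by
        rw [RR_mem_lab hk h.inj lt63 (by omega)]
        interval_cases i <;> rfl
      simp only [List.mem_cons, List.not_mem_nil, or_false, forall_eq_or_imp, forall_eq]
      exact ⟨this _ hi6.1, this _ hi6.2.1, this _ hi6.2.2.1, this _ hi6.2.2.2.1, this _ hi6.2.2.2.2.1,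
        this _ hi6.2.2.2.2.2⟩
    · have : ∀ i, 6 ≤ i ∧ i < 10 → i < k → v i ∉ RR v 63 := fun i hi hik => by
        rw [RR_mem_lab hk h.inj lt63 hik]
        obtain ⟨a, b⟩ := hi
        interval_cases i <;> decide
      simp only [List.mem_cons, List.not_mem_nil, or_false, forall_eq_or_imp, forall_eq]
      exact ⟨this _ ho.1 lab.1, this _ ho.2.1 lab.2.1, this _ ho.2.2.1 lab.2.2.1, this _ ho.2.2.2.1 lab.2.2.2.1,
        this _ ho.2.2.2.2.1 lab.2.2.2.2.1, this _ ho.2.2.2.2.2 lab.2.2.2.2.2⟩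
    all_goals omega
  · simp at hp

theorem search_sound {t : Tabs} (ht : TabsOK t) {Fac Tri Spec : Finset ι → Prop} {tb0 : ℕ}
    (hc : Fintype.card ι = 10) (M : IsModel Fac Tri Spec tb0) (fuel : ℕ) :
    ∀ (v : ℕ → ι) (L : List Fct) (B sa k tb : ℕ) (hs : List ℕ) (r : List ℕ),
      SInv Fac Tri Spec tb0 v L B k tb →
      search t.dv t.ev t.nc t.allN t.bipN fuel L B sa k t.al tb hs = some r → False := by
  induction fuel with
  | zero => intro v L B sa k tb hs r _ h; simp [search] at h
  | succ n ih =>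
    intro v L B sa k tb hs r inv h
    have hk := inv.k_le hc
    have hle : 2 ^ k ≤ 1024 := by
      calc 2 ^ k ≤ 2 ^ 10 := Nat.pow_le_pow_right (by norm_num) hk
        _ = 1024 := by norm_num
    cases hs with
    | nil => simp [search] at h
    | cons x hs =>
      have e : search t.dv t.ev t.nc t.allN t.bipN (n + 1) L B sa k t.al tb (x :: hs) =
          Bool.rec (motive := fun _ => Option (List Nat))
          (Bool.rec (motive := fun _ => Option (List Nat))
          (force (tripAt (Nat.mod x 120)) fun t' =>
            Bool.rec (motive := fun _ => Option (List Nat)) none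
              (force (Nat.land (nthL t.al k) (Nat.land B (Nat.xor t.allN (orSel t.nc t')))) fun C =>
               force (Nat.rec (motive := fun _ => Nat) (Nat.land C t.bipN) (fun _ _ => C) tb) fun C =>
               loopC (tryJ t.dv t.ev t.nc (search t.dv t.ev t.nc t.allN t.bipN n) L B sa k t.al tb) 200 C hs)
              (openB t' L false))
          (cond (closedB L) (some hs) none) (Nat.beq x 126))
          (cond (patB L (hs.take 12)) (some (hs.drop 12)) none) (Nat.beq x 127) := rfl
      rw [e] at h
      clear e
      cases h127 : Nat.beq x 127
      swap
      · rw [h127] at h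
        simp only at h
        cases hp : patB L (hs.take 12)
        · rw [hp] at h; simp at h
        · exact patB_false hc M inv hp
      rw [h127] at h
      simp only at h
      cases h126 : Nat.beq x 126
      swap
      · rw [h126] at h
        simp only at h
        cases hp : closedB L
        · rw [hp] at h; simp at h
        · exact closedB_false hc M inv hp
      rw [h126] at h
      simp only [force_eq] at h
      have hx120 : Nat.mod x 120 < 120 := Nat.mod_lt _ (by norm_num)
      generalize Nat.mod x 120 = e at h hx120
      cases ho : openB (tripAt e) L false
      · rw [ho] at h; simp at h
      rw [ho] at h
      simp only at h
      obtain ⟨H, hHL, hHs, hHn, huniq⟩ := openB_false ho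
      have hHlt := (inv.lt H hHL)
      have htk : tripAt e < 2 ^ k := by rw [← hHs]; exact lt_of_le_of_lt Nat.and_le_right hHlt.1
      have hTH : RR v (tripAt e) ⊆ RR v H.1 := (RR_sub hk inv.inj htk hHlt.1).2 hHs
      have hTri : Tri (RR v (tripAt e)) := by
        refine (inv.good H hHL).2.2 _ hTH ?_ ?_
        · rw [RR_card inv.inj htk, trip_pc e hx120]
        · intro f hf
          obtain ⟨f, hf', rfl⟩ := List.mem_map.1 hf
          rw [RR_sub hk inv.inj (hHlt.2 f hf') htk]
          exact (noSub_iff _ _).1 hHn f hf'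
      obtain ⟨G, hG, hne, hTG⟩ := M.nbr _ _ hTri (inv.good H hHL).1 hTH
      obtain ⟨j, g, fs, hcand, hB, hal, htb, hsub, hg, hnew⟩ := inv.add ht hc M hTri (by
        intro z hz
        obtain ⟨i, hi, e⟩ := (RR_mem hk htk).1 hz
        exact ⟨i, lt10 htk hi, e⟩) hG hTG (by
          rintro y hy rfl
          have := huniq y hy ((RR_sub hk inv.inj htk (inv.lt y hy).1).1 hTG)
          exact hne (by rw [this]))
      have hmem := cand_mem ht hcand (htk.trans_le hle) (hsub _ rfl htk)
      have hC : (Nat.land (nthL t.al k) (Nat.land B (Nat.xor t.allN (orSel t.nc (tripAt e))))).testBit (128 + j)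
          = true := by
        show Nat.testBit (_ &&& (_ &&& _)) (128 + j) = true
        rw [Nat.testBit_and, Nat.testBit_and, hB, hal, hmem]; rfl
      generalize Nat.land (nthL t.al k) (Nat.land B (Nat.xor t.allN (orSel t.nc (tripAt e)))) = C at h hC
      have hC' : (Nat.rec (motive := fun _ => Nat) (Nat.land C t.bipN) (fun _ _ => C) tb : Nat).testBit (128 + j)
          = true := by
        cases tb with
        | zero =>
          show (C &&& t.bipN).testBit (128 + j) = true
          rw [Nat.testBit_and, hC, ht.bip hcand (htb rfl)]; rfl
        | succ m => exact hC
      obtain ⟨hs', r', hr⟩ := loopC_sound h j hC'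
      simp only [tryJ, hcand.eq, force_eq] at hr
      obtain ⟨v', inv'⟩ := hnew (Nat.add (Nat.mul sa 37) j)
      exact ih v' _ _ _ _ _ _ _ inv' hr

theorem run_sound {Fac Tri Spec : Finset ι → Prop} {tb0 : ℕ}
    (hall : withTabs checkAll = true)
    (hc : Fintype.card ι = 10) (M : IsModel Fac Tri Spec tb0) (L : List Fct) (k : ℕ) (hints : List ℕ)
    (v : ℕ → ι) (hinj : Set.InjOn v {n | n < k})
    (lt : ∀ h ∈ L, h.1 < 2 ^ k ∧ ∀ f ∈ h.2, f < 2 ^ k)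
    (good : ∀ h ∈ L, Good Fac Tri Spec (RR v h.1) (h.2.map (RR v)))
    (spec : ∀ G, Spec G → ∃ h ∈ L, G = RR v h.1)
    (hrun : withTabs (fun t => run t L k tb0 hints) = true) : False := by
  have hk := k_le_of_inj hc hinj
  have hle : 2 ^ k ≤ 1024 := by
    calc 2 ^ k ≤ 2 ^ 10 := Nat.pow_le_pow_right (by norm_num) hk
      _ = 1024 := by norm_num
  have key : ∃ t : Tabs, ∀ K, withTabs K = K t := by
    simp only [withTabs, forceTab_eq, forceL_eq, force_eq]
    exact ⟨_, fun K => rfl⟩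
  obtain ⟨t, htK⟩ := key
  rw [htK] at hall hrun
  have ht := tabsOK_of hall
  simp only [run, force_eq, Option.isSome_iff_exists] at hrun
  obtain ⟨r, hr⟩ := hrun
  refine search_sound ht hc M 14 v L _ 1 k tb0 _ r ⟨hinj, lt, good, spec, ⟨∅, by simp, by simp⟩, ?_⟩ hr
  exact InvB.init ht L fun h hh => ⟨(lt h hh).1.trans_le hle, fun f hf => ((lt h hh).2 f hf).trans_le hle⟩

end Model3

def hints0 : List Nat := [
2484666337661613226937963226916770000795961642047288205479919249174366059663918548756656811284291494685075338731368160759404068,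
2498817069260932836501369792351763347452312175428434168074334512095239806011938968166052039134258073583075431692422163798003734,
1242908356644421051657887741745669800943188689220380806697301244071489880668277120687354670748675326283537723092801883669827332,
961129830015614248519445151365632563674976920959045088349216793689461710952934534729496696378965301333443801436453296822441138,
2487862302912481894137415429125739660501855452721644613104510203322190560968435886534769880680697502949593221199944467213965101,
1154309999861786690799382635556074898211364958810419153010355812651721678056610612246235008109834383876183077619640443678183074,
482671910645660331962229123824218979797640265426927252068538948478998052879238655756219789100527087696871398832861663885875902,
2365102792689454305516793304696975505585826324310499217498151794957081918593216276707824113892375842564432887926395709204657943,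
226812324658042490855485581778663014429993904264749765558168167607865463495662485127586583738874327114533809140280449045446951,
679376528909623158863549028933154487287223427359526851452032100454487218953134794121800471271493708214953650252927829032776397,
1194015375963402698994861787011339445498834902802475966485868948480300658620975760776391446837885866695356979675975894495917878,
531313172265346356079630928780291012636130376740243798342516757071015132352450705547699692570372687673369465695890863654777422,
680689572928711156469982429532338936595960197952552928504784173432712227975421250682213392751484729261273701684643723836290741,
486970115016497688432735162800578276261013402722139081238465377834310805999516990522519360274835755777466911166453208907432587,
1010448775054293195442443474267158694303360046979740042802536320819009011988501114102341217267269424939065948230464886327592736,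
470686610114095645153128916678398678848453032463210334235076952637102624919747510722604810742299929954008415806169221260095279,
1420403666664936846309324098104429363100572682576254474484035965767034512653908382408460441720525637758480616061185818807584868,
1449785498989106232882157948124651894379112677174060775139922867256384090991901652653962358184432525503883274708515250978477184,
1174493448796714832048655978330162876319483235678271494043899402966379779513093223177784511805934106345665512022783180235343250,
575657667705989029742980700779227477622395894698590710785285081165219674235732123539798258312785087049510641504487212937412921,
2304049414315111105000043349765117458691075525939889744806680358367181979612902517118192263095754665417061173726679497686765952,
1390985368819909151755890278563511759302961015629666408117512333114586948718891426863300935100874910340509466938190893139970868,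
863479691823328466567688273842405820242743808412946289451725785261896771783915237534304012625255720574694589883364991063646789,
1180251455508288799010771477905870321087228559158161111832947223283026141245656694191345953979481632004779311452500329531792426,
302775663186231932893805912213806930982454246531992196004786238035264440450218390003224488184216345653272294180566373326331065,
1449945902558541187996896908368216608126486070573338677375280079637654742683702730893672416507673159162720843576997659803371273,
2484666186589422542403804312038391509211797007536420164862859678332311694081435020433025049620105182540366534783328333574791365,
1984370188387023493767921753401621495406980841052526478697133810443555838121928065999042367352498332173815400207938990310264854,
2240662895550016669735920964233443169631743523842550202367774842911229069531069151066069127465182397064729469716372703716077148,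
2207731559757804065240415322089633551492400052254597356745124174093995698282363034404282975154135491754844123610685563903112415,
1424329669636976954955656761683092236453313819661613752919799075896523151428320306113992089775683690574918516545227971403765559,
660216040103578656594913189580126295281116651831298398075643986110981210693972261724468467288655562560227556049258660300521555,
2124372324855169572013074474807483482187399051638868122508506359437454248708649933160384494734250206180028418434468451534810736,
1160931593827225391252926128222771116452707753782507466768076504516997606844622107441291235259040329674034779586263703846684894,
43028053548411803399021762045013300278476129146010166077224988868612653219126912533307582157429291251886469098436571453321390,
2419579608193425616289432464301334878175179202365795097057060037898171062821545070467665637838201467846765524045155043041657220,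
2208565670749321301898694231613233629886641926184026793866605896250639078888597879136451829525443391687546249305312423650718797,
2311624678717595082623149532190266731008746238754887765293562246693758503183135340756504113296507868901304414983220585069017050,
2427308625609851294763439757084925877662078205590040586628285979032270603812431820958536595873382347033583069620992117262933229,
2130713515981128477738080177936904980770245105318350782556239420039425666855986019132302765589909856468659678533335583457828025,
2207663371942497809300850702700190032148571177150436083853824868269528553252305615249120536068742608901530305376090124136100580,
1440128528295433767202474620722181098916295024067151491650697736330311387289638413278953365662134405210046004520694014679969121,
2530887365779580367738341032489886133329699313005305478756328559963499402982389689575609734502474727349551657234279663504961119,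
723732514561312467026737962814008964098836006623781716078791196229975747160461531852063176906156688397981776559913957788896100,
1087334133917136642705215729326243118567269979570155107919507385777004782888572960950088566803838338717143552303686426698512287,
1004600970706475789914992842073411106595762954851109217035283618263897635415524256491324308944450216440671914119400531080141954,
1662411321431916383145101173903964271266946769282532368047196769262275974759915403921398281772143169162103126058111712792246894,
2006919105026301583000965590824343049399292745327660089187987236222356630876632219524376344254696179054664449771613866709624657,
610856858415840670898965879591073684353192564931044645696042265849697814083688171144510968213308828838113871532788042203377119,
249456226406690618051791003959018963263321355960285681659755391978522722479100934383135527407740800930616175116427000612920505,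
1180221763964334052732866863842924871923763405304655036716895530564041545908622565247089284602297085923607021640656532431742348,
2080952245785832177665286057657221992190859751893985411904830009474512643466280615720670426054833573358723436502796110260559033,
1594526876218371810926423864712748777029812355753861752407299829004410551712493547325290947916596165664225198427460256360279260,
2236984893039380299416498900451998462114242255845629958586421214894960323439669980567671090539484753907974344852806779264100801,
203094277490593679267175166633630518144315619891135314338215687353569272891962407007430887145879900647186502560247100715538232,
1961652093339893304193845650882581868648449910442746787818667082259678334488971764078002855199505223843091708646160481031152586,
1034556529942193160199810997287660621582097370639371714034175317162343445561072439617058778650985623071045552381639272522782428,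
2214503403663166920609705505547697362465321419835491137580477317077284365686059459101640073689510730311063973276693290205572812,
952585570805882723707076336986584816342660027065512367166600350159487935038473428442132941815153719332682553780804272366076914,
1001910424624593263798911695306759047135328250361350209578452875948842281839608413834643235441024255459501098226428041974847420,
280828885897351202042066912710891134543264122308661229882148464646263499428592601004653042564220411607986155654481711602931760,
1340030214681456464004688229351783172976804640957009129093765436035553762426819669309967285232715411395723439056493903921254812,
1613351076927842012964272138770646349691513534054782651095528571983486701496958189308642766823367608089745817998420064097476159,
1419870459151747930054425098738075453726321368487865308068357058243924244193920464982355027680606967295629650739656820630489352,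
446908908408771420312395230066616103693169240104615235324393710114965211701243445658270189443001602759522039801047241007908805,
28975873208275968024505100727327345490013061124483793409578870443006907563904362425429871867435715508524124495288929666533403,
1566968719434324058984811905346591650488458094879748379645938490163438671437965379300435896864396147827938122134755595187525121,
619230913143852293364954700904906470107650210458803094273115757233787625000994096162608862283922983929681898830903788564547016,
1601038210005479009783794869332561735035791585611494744899575358915673388911548328912982631399099368767727916571924872409475053,
482691277528981392629531451449681399743034288459177123334099032639686527720214389629200579053425998369472222556377334513050963,
1203542375397785322772853048847733455094783399586545054866636417591031390561073296432842331387135085077135784324579730210076439,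
1921122723042365745468023137725574418139948250059377780288976939874177866438768223925042587824865889127235326893695778843309544,
2323822998781083425946586071042480207453595383076895317178779833203954373197928825155350553308203049910078245588517520711038959,
1668959258576185230079238582347436143904262921057150938043078839463448729229699167065563373155582957704111097556198293691053262,
2132025299472398084933433476910428174805800166442667164847690673863956070653668208079833536964878522841257919769157279889597262,
2069192422667137639638819644612459484969896150129780621269043590383138755457144994774077976483016258559121488420467716996163301,
1003980522567539921358941292893751398339454508155555991458819103116850591018770069402450583255818127884170474612619405279623130,
741706699517516678469785144353105157931692633191015336136381934395889691805036284013093778538139923495101950650256417574715567,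
2403247228345952922278702758288426557036190925163320137650126308806597915140061191740830842580844952269288995072535704275306380,
1023211364703328307780934247024088707379469431735027724600039389503006441299172298828879329558845581194897568794573520602435414,
703165860079599747683573864587742270458591146405704499388]
def hints1 : List Nat := [
554321679235942561696759403252509375221794420810697683671056883759857853684244639413589009570352833526111649114249594117932937,
616788712183786820735247223583804543830116086429399986706078632465702108192715567811655437022914769078483658339892415597866331,
1546057688752019956829486811518815862711428445084357304841444484519661714472881878842430047091561064162354202132497191643025440,
576311987113780090300100308964955579712195694138825947786244345571075543680909906504950383961804725616749895681816210159618889,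
2067714200271907908096247322141594820905455255760396425835087720624040134137612229988717811060434555057069348283077793375784605,
2259889264903440960326981398509051722897793848094203002061608294526899027095323619071010249938812075915708444883816566419299160,
2108897252068762543810233365256298075316994616125115477701542171504463429974831463394501327173226034151439492584321667322615090,
575813501764388162815874038179304968712319522017778548430713419425541269666368938875467509151297343915267205113261351317770010,
382264712905612813364084840992202926753560537271533148591549677981448559459783865119951152656428570049012924942256874805726604,
1662903480793981039509549680720986224210854090704793101834830725359540368159495902214945594019955017971407852557208235425995105,
1627129412383974864057378529184917538435559744711227285959799073811666480824278712367349896061677706456066194536519986236249291,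
2046747744850949771264296113005667531821119100433639991980711714153429568601337935586191777112635469697808630822722921682880272,
341167722797429809534107469796318786413656085069717898105874415093437454998306973836067110980775001975059147159939417161322002,
742566710541178753293535490189585717632582115715491517034736337928664270628266601671570481982070126471938312058229228733576534,
1886104584818876784324015060944680952654257293174849844367759765792354349748583938904045634328192050750756305092426450262869667,
1214955816050872849329819126780758238116378771722333274616776189433571307234531388811253023901396561881468742353725685399570905,
1974965874796882033684916934151893674329250625544034861797956010343084934268797184517785787102977769563946630205814058169051086,
834799360791907192030509598086720841489601222835989792387433027929935570865319342325839384197401455134749330508219355967448861,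
149077240241934973123031974761800931528519598184647545105003588719972957146600106083168098204073521355760492376049935666570683,
1289033929619132007253363467638667001145496942279549331121887091940097741984120616332354994732498551225781651599859595167489673,
191215603553000983300625567187441658173061702775793815217333552558874162916493756123325639716982592033281450916660512857865194,
2346617345147622237114185666475059300474203824818588848361192303246788453578910829342418567901731039550804758496535713446724488,
1876303731557327510578457681892353162125180572956087342737589535948845749651985849127987805000062970861482465779040499415028661,
1213707887834095732862256933363425255924888723419674500341445544117096835379189085543780078820325166209099050781815661384832985,
419740606219835212402084481300443820992078955593072985949726636674660370156868627427453339761345066543539261524525156991889809,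
595959828274088802388429530758154172141118576469677021321479012700244608110063500141914480431684691006811144782873921773423075,
1982544587768327002803520638838310683875477324640953874571470696303378039816454546791247403762039553615305651142178149992040587,
593983513277382344491664744658882129966048311389839050594478770380975866583815670168890441303362143410246119328933948851482075,
1193608135663152428553886792503590056953075952723945842699799285138294953390680290629089685889341727713480492566504334578682013,
2046854861962915752012728585797639033370085406900523770331039761268313457987718225709908119880863127112475173370118215329263287,
1112321649562366743138864535777042130749978107095745551809422967883362825385288363862206227386617620864567125398684139137857631,
1139139775524380900832830123572697895512200914445936131759781055904994221753687000412982875348153140748673870919906703919421877,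
1125314940691987020705049877120492234668724272458074925931178456918940204652294127859392736091460069952174623756921904442952279,
106594562280111207599616812371801753247056117879059562975329904514081753714032682465235719382483188011158273340320193032088755,
1889366824147500971196321956759075933322512573062172152656812669604535532554133655986983925410305987337818746988432793731629184,
1343155301888704974356403024738417284832378288414517069574591726160770762165744460986281894145089716359944921014754892641548834,
723548636475216946546920739297703585562400275504312520763017063850935918944638950649950791053380902934945941646116831240300327,
361476488250950975917012257165702282381901850755313955402658990138920733639631722778918538461391350452260524705760858934292834,
488953120828585827302397932286281381846104614436692193989232685083611939081981026532865742078211423235768826810718948442801556,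
881129119287386039926174876207808854279261121408868004809975278249734139364930743141232481511314595220364455515285974970279572,
1631027925021157805775386758434264412872537347787196535541086298033331579549918557380755382899105742871494039267942523841797565,
607254124024976805486793896467158323659980702467023820163574382145661175928355671856239823950221075990161433078186396988286878,
1254880088564420243381579821218052700499124694580172899716269135141989813762092721132275943347219015911464091738492312356803916,
2494239845629486017209792301313276269009611591187093092332294248066738823661966051092708185746527038663857575279575026980022573,
21156403830813328123822690959238058848685185802420882182884032349856108557526852130320560501921805467451179341561370463823477,
1872067586152602295371861667346691650936480696767118951366343207834081584592013248198293800560694502965420912254553445393089672,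
897286195388923416516241822510709645714581043639733535275078124609909955743565544615838063519413469698241878452389392961380343,
1114819069419632491468211438217315414724457395544907070378554342523710442184605195491754051781523001019126637960844476165084858,
435494391086579876941124755654944878208223283864330083609858554624251176478756206128073256124225096842537196984555382301480523,
1024922660023587268526364367803604430456119313929085068208250065846372060636497015873940793596228302823638027536582903077866588,
170397566186532361339552777479140998260706851686109768636745284842208755254480350415934920810608601346631204653057249194678329,
838820184774209803839155333828987092695154936850839707143297518278197884445331377981844260290308268310822128034577402256523145,
551940041603648206310399002712176411553341753201517392302840634076179443562630017293170667186488958384127654486487720973458100,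
1150140358152211225987683105825746853978793823390946474549814408204801991083339369781184083592979788743675409715550093043564799,
2310570397800177524458176726471608638569731800984805350393797074325664009676832532341700467871605844445878889930973484612948909,
566052713701261214641868285698387128982036914836109638602041003606772606470153839719386868216636710387887812095195080203923546,
191386102810351970229193585908803509507879569616011435709552572925447918439322315304519270151699985212648151394784863329955099,
900960472984160050491031161802176501423615164265651050131178516299577971972638743153992751308264446942246271867173389313328006,
1151739726565070427997704722622649307370726945010719000417162186429600670772209480663979567768248450102360284198966194369365330,
2003478739964187672399179533399079070988403053132498151257880163933492774774825245886105543615418634990834754817797258775891610,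
855220675798449541112916617787043271202921674069023562762420293025251592771870291241073391530873621864110406945946829218650663,
2523074093071528068955222476071406485996548491552554756175194774225023264297678025049743766576624517269630423589178404825947341,
1768588944290924571670892682114189502564393368519549646920698252244451071732225216925940686600176947370450681478655319916099866,
128420542274586638980477866320731576786893260877521489940889612391332866255202009550972235884120176968219035550041162728662732,
1757767341484164378227195326133776232612592809536671069957265681250314462503483784465559648205401908239306265463923112859117260,
437314501327356876881006154729417755354067498960143182119536148523590357399326975525009076224516654719563619296908837777086890,
1950800305487606666418655519687591053756710518457831852809392070416947959710859520256402959957505281463399520621094637840657625,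
575484374722565945038804872810216545710074033327084692370328038318545833539271437733901831695500646919785132191783684902684826,
255880437099140578634094769780336138882624754727931861962967549411041932280447885829535656403652536361531099894442744451680527,
981985628609877995829560011324254781163965103698370534954479486126241301453083002285246323811607968830097557928323650031881366,
1636556826404197703277751069782484089038031593331538025374595505852183093245834373120501584661213319260944472820130780199770160,
427894598163708052880549095625235700495838535209647280496421312520247972521862322136614477766369081060703900707542994946714928,
1948832025029446487141572839069661744064821943104208287132542567909785631971680785362402835886795663173357672143167002464057626,
879903084850625676231650753239066388806751749748674321927045966786096775986725700766946532749455393317678204362512308478680504,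
1030812831260692562601057468082411575787352341310065395279796009329722952201428183657933123385453526440766411657118269607053098,
149406486557266466814335668283959052799566192862954779942739196724589944876310108603067422994169398488706684714696641679874105,
1824615044759395153274393971246773148148500948122568817569477822456136073331094535888030935983837644998192769355117812292502664,
1022376504778915220549957093915954059228702605634034376684811557579500907636992372190423145301613772650811154918949342751854709,
1108326695247279644065895642461626956082131556690219890984981673384517166432322109404806347406747541886745925974077978899750831,
1119039572142457580093258706142816600465707577190643270616828288901454101757435226287292310602026398221456206530181392421467596,
2217296389733080258530673345778860533308920949438973726842993948654025085389684835123058353614182956917103539040339595093187158,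
1304659382099086710038491588697548581748036180927493559170223019571591976078414292290415010541426776887594337681925472812767284,
1656910282123248071014529812593174720472330610514376878207462763683137703305774259144119359289100816689372543375743076724788012,
2699292590798057065473465697230716922640388305858563784243199098048430505279903034496212581910481957407598779458251099290692051,
1008222472205561976488773255878855647817462090156903651954329612028087595179547835469242016525001739939742741516743827479609603,
1001719701829200594617744730169410222692853942676608984353055817992609431669566059827680581621611036420477941180278710301529238,
2266285095347079275367718792925854289825777410084897004122673596061904404245939853442992397541568168667512634225274980905344440,
438795475392577110241048914633106087130160376218046989144280885564915307108927246515950438587190098468786799564472956228473717,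
1620436599609443739277138622320025733487512679465725652922220273593021694082924698127914841597532732273809786959262954711309083,
2691047883287133556252122553959314424419258956300458179521396018378433119454363837846230470702924367386916076709268985087307226,
2272861309869016878577668739903793495314484760461924897682649609387772032363452848365888701651954089638542270365469057826717697,
191548744128055134752538741587391844360980020252342020771205316487983169409065564271640376974315821256765782065014007889392911,
386411929952735623163455909423064725949564859426264880834162503261625007085286654179536042565703362762279230145597569067222152,
407598907823523677664725365849821704786540869134126919199117158711430259398958540916670627453720248113376600983696333460623635,
1087171988565821100570258245399761434343728852269235450988996234496815881774705154102916337577547774764092896622370808422455005,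
837512364325079516622032743885713723899164224996789421361042067043951386509240295653997306597455045118880924192947203506320947,
2300867751267618327812206830790094376708775072564831269673451825576941735153251547783350815644143130672125008063594481878422570,
1869936696573811948571964100536742950600580254933362923736034500497298226311495655848752781696849889746683932035522674757957100,
882044374903621643835874085552766774416261923487523357632400345980831392227606166971110706534059478874240739202401430097458735,
2668643389896585159980902923591049574214412613520950375257744059298034337959223777372001948960577442457799232815595486176340048,
1212317807405517877760992626278796338425150924258585669942962203438702828435764050614877438148953203384076085379859111320790003,
1982773208142483105358404665252057631687359737714358999742491022055046888936325783582967314118336261434756991632982826543425611,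
191386102810332581845079988833475591330582698255148434073866679998289101710207967315859304634928209479877607380875133412685914,
170397566187773142187235310290108420307625426135570388450937147579804581201672522943914950100238390885721216420506120055636870,
191717922156699440811213649972990978911515907565229441580938943412918009605808521997421671605455855933955450045165881399962633,
353438841007927981305392438627947857018377301923122266651301946343741371356347547114876331942771343003103113421394003132046342,
2363347939222970091641586033752952404986402729638370914454428675956336400093852587465413268719310384619157421043022618272671599,
1578326145432699488426981538489866363198736972534859082246466858605804018647609870059859224795280250126100381439304913224618702,
1940510305754948940178508772934803971289234364968483369586913108523355145169164415656641463617477131214291256081472621508765515,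
191215603553000968672706449986982227940147904308384339931382687633287452339977684270055273453603370565368688875505776669807730,
384104690957309962673466268276357391701685142823916802332562246338489812167446818979138196213671802654976452673612725245559814,
988169496410418974253843351849248047478328597581247795876770893199847997497470883670209558050877196749770876857373726404996633,
2426692211570117142036072303653484489409291425743663548067780260805353953964626630111429970990221945895885565367302480448089136,
604636817973284796431599070308389774357584689724672116889720274421112114713534307794386791794808754176274254397938971696733241,
170061832881296433061274088754999966928843247304088680331326624726313306539011135228464134351275429062191979600557428758088093,
170726802732633714767376823444778154843773346902729441840054623061359992063095770147455548514519738122268376888715278416970633,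
191386102969171918732581349843341253683467773642805943026871416238040472568509477695328790696699612928323417567798177833616137,
1125809372935119653906417897954050587245897082674701033555494534104713146368753338295876303253899286734852299445994549411644294,
1282720478167493615275457885653858566898395429227827655797900966861439974671725796166953410305412200081249563208813612864572946,
1133434135180463635582641173974386040240499936864392273955520659596011138381092942848689905474824859961873873118578356186339250,
1218756280645084807518854505567794102354232566101069421078074585456211271019643574053331094699321235969972076608873049704993615,
2408296049070330092782274246319740205922064130701595199309583827717842903556711085078100759025391932368758194184674047402042864,
39]
def hints2 : List Nat := [
2045045668172149751064714471184691070975937105520356372834442065231388504140110148434766458005049845693030327788847260584052104,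
2193970576414251589987515680429908433739942964541065112104101569825244564418883332694059928046732959575043145772382197688243871,
2046249278886807039801079766415989138033684416078043047298342303385840673132747709473454182239168256495720579253542331422638662,
2066266780913475075917951971326244914781406075676373161115178429703044635629688626798543656255954459756541847367976082797210976,
426223785874125855132772144396789244085683261582926522814540815625531817260910270649362344855354990540576683159761583097032026,
1599025094678873964553236320201812867353894082173899093205647130312855923444575833988379517868370179869382197744704817033580550,
891543279030214445283606869019064174421668562710790340430049935602760616691332993292912330578352467068729179553563076858243271,
1918830334978969274774226681548065432154744572216196716609733693657431113325919372865398353989833359676511055430603705965960626,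
1957114805422580933058196501322708517992960739155286838797970527298317413586652542903680661002623524640564393515940005235939645,
1876197581142987651447705514658585496703825001926495356795296402009412327261993071298269674894910298667390988333999110717658844,
1918830397292563890384287055506588721123236276414469834993446620875344251299697574669284808719116040147502405808997133832301661,
2062891424901595408824927819897439423886531965058827717268349445414413257736610655674383663504824945970712107966148364320579928,
2045725126477641069474295722552302217554475302139066282777715118642366061767068113817775459742336044631792326693980968540530639,
981069549925613302216159269890209838527473811111923098570769421681361189629964222784723484473617582836790494488143050749521249,
1556389468599047403342361562992262866163170727136746250542362547701572261017596203196291332273372328580091126586973834669957032,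
1847595130729444366652098738787748013343913635288220086569700706985180572635422993051350917154949479560132893390890113257767431,
1451292291856230036325156961453775854008113282285040237734334049792935966347154651784472155795039995005526621319931958751256534,
2174677539247769407258961804992315249206660722578007622587674296176901747736262107904197251152884145446718158787397911284328651,
677972798044147510271385837078112638612162291323007946647099228063688043950306500444596924372918095566558172395953101378709710,
1070388487622472716399772611066961708965939674079396582609707907880208664980397362401880834476935850579144026619662896462283680,
1620511193615887082211166998142071417461515441145374012397996679999228470897071583437542312267530140761198074360101369599352240,
2424521806946049380203091983443917944219333253000702159556763247098329445523920249388230779172135414637451815200095122983604945,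
2130166953231333162151311967875924751118212357479762961800879112511896114217942053231677079416153949632121247898077705599673452,
311319622955508963442091415023607979407294746670997952830139858266935052420840110869389167232305407801852153884870389045587275,
888339299939983196015486919151648076779975149994606973210784500845928113259962215167566244859974158188875603493001980797508,
6995910067490264228499404760474250274346826821949199494953582059807290218033945922473223525091979818602558070117576053606151,
2089388238366818372729878830115175604415647373508547485947590642327232902301345414355544564995989035297136509985391725586268167,
1897844816213865213291000102735255470126914614701415693549182145099948264643102082988928434694994130709502989628457419506154076,
1529947643831889192813841194941307394641308189132124697801640002354743826760868179540635231303746896950198088156667047500148187,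
1023158146862928903341196663584445665454672472978081185874123025168044849755099221432847813871653247323033843563837682097737932,
1340498990110923228044716332599430327595952255903650539681462434341489733293318920957534120012841744880418113052679318782530439,
1023218127461673746346329287399945682854656003360772481213020809742697749145718002300448580068875991550629264886907842946192679,
2275623515466341447417346556461974298738667845800316719405869339822494224413855573366106703404554587902794312970099455704670644,
1939772302037530188138923289102341198443244739674920543964454821215523826929229737736057329613894476576082107457356015970051305,
1107931989430100957945953591908749785236519942437222860302006061221833420005410250446502268885954775864119480313928508929141851,
93443059318288401364643720050842576886950474191233262058568562277583511768277153401720333384516461561049304799261459088966360,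
1463015828227280289118143587189348684626899063914236208535150957772760366921025058590015644362573750623689943426818715318966319,
148248680630483652845835318991442646464899107189991486984110786140938449840030193553223539513475450142372427914099148138285637,
148304263820346950752628360425819009934952160030557688779084922763594980985115396465627333532076102767257668819456299618979732,
1642666775192980970569357884860468411460717129527301488855607864687301419345872479655118045231968743301298801675008246124921729,
1620016549478043377248887897352023529488129256825783112012285780027499363544775687047541708969553923758646488055268458991742580,
1939434556212237072687588669074802397319577177442777935013755508392585555854911214974009214689657884746218354126110077082616524,
155070629337869681466725761212283406703283341832595317975505623896272563230167644505979033487158179391994877979434673446102305,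
962385497145083323682870206729111153368931054592371736466073654970595577195178402657224318179281039728099531986697896269372845,
1106991692984948361175120929404781074134043381243133946899478581116708174612211795004871518136788343437276109771370459680694704,
2238945882027605529537498165905470397693172526678876163306718084594279478060383586151565987453059316128887467072771997188826947,
1620344260923328355630003851143800258772656837886410131638112932334579410254742224347480487927213694615636371417866803927806040,
1552874703733571616320818494274269088821948012051167350107579707595248748617699319548478164926216071137713147245494562425349705,
868035454481521871936915986120684398957709607326163667774037249496265106415503418586377949877510157911351555390504935491113221,
896777045407246443240539706297468773573681112340413953841228346852431375377481419678155927889125741487818533898964337125645994,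
2234482465859990252086421714654323590080255636420281776184975471495466635439148032587412693824995799763186378896816986664244903,
1704962261186150225283778610445881025598589202893222692208708309955647893762904478115900636965991808477776247430333702809063757,
1536089657146571081608898523262805019853866376311847503094659388369671619204007692876875996346956258128863130412304641161241543,
1133157936985658388175374750966088499084916372394144233028681848526746958382597504547300799515332507755261134951836970921354570,
886292470491070269585762146013853202916585003154722319310212315487303276951130953483905905923162215821721045828556545064316377,
920939816016730691667681786718006753482724013105460464452223719866547376760758689984456680904846760023179493645432813369308359,
1454082363830309325405259046706620583927965276970506216218657599930947246115707430895888839761481017658137183854240189434586945,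
1856304232935111193662915188451770100000094984032770883122541285647091677017136177615885826642681915642515355670871722146980451,
1552914182319032637258401380260081777908013518682779076108717116520040882096838614203771431105396198378278605296422873841014242,
1978236009880589264033636006024967905780083821865923234506525139716460726733900389005904938488497014468386110778216214498077134,
1725765765530338661733533807709461776820899233076119435213448024103106110990662757823884559078845448653642172276228983471026912,
981105976948702195625938169723589807250350440382824258539129666029351372114065124927353252654244365247140940528453208901408081,
1915193453482571872123726246394357765219929866778014008461291517872346889271456677730168729825415367236878606528561404104026286,
2280440059831516665389543010728020168645733142717085352579686223059382879623777695747280402374610711099652513112405069813328989,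
2132163035866681454081953654174584850466310456836627294137262356585614922791900113954658982544732224484446919238115680133771615,
162521083839589897645040027731029906787018402021746752420282660614956279084346891771250863526319910581851347280387407522470453,
1535402708699189805164802979905077149117368968660060451576512722347837997352710338662492830392100558172204543070014092763981132,
2487682376653526738485930748998658313456810914501892476316651891062577205540401541044232599466028094973760700843626320979534922,
1705578026991137200219644321361309115744252673975050688228802751638462311309229395430639254146136346112148571439858131378234969,
894681885985304572664777221931750915949400272825936127019085783294213881661346888953746553916676650170091408533171026124903721,
1940317703997165785496216528864905492353648547959822496998822573982046037027363945451556359570595419256692931602838687010346279,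
1470443487645000214834115659659242887278191387227034041172121410177649959267239250606388109687387592676756724489150432911390576,
1449464109396948589628023578263134718946130034230694878274912179592203125770730814606552517717260067560459087200904259923289281,
1451777825932466366647768517162864044237788987904023249098929991814457687368939396246643895216653070634245427604433252759382057,
1704963573120304199538141933116688814530925318499332933603606686367578043945095057778404505380868842680082000579423579728719453,
2280763858334271740852937831595338850345464643732164591832040008393094230131468529733904691316990180766444421465866460686573863,
1109875254545236828028272805148687219514290869486010332251635621487781506360702223743703732472645489977488289972192885257874267,
1320031273324389032559600022441443201620348332450314255412470414097236521132641840961005452180463931124842766464676721864075559,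
916002293821790723962868646195867641529514383583851517018797847152384183549144766180234072610270489864480378570085831977]
def hints3 : List Nat := [
1459663019208469590284916807679983313531871001452109400490046950989361903494058184269569169887459497981988459848478184347723658,
1431073395980526322322730581654855451618902224294326623237658153863422693253776596812961682176055199052946404618407041114660818,
2458945885316199378530475266250640499462689955051535288695844409661099720720875486609443298703734251505946245089653563453432516,
1445030705234538478145458412229549060626957814879189635645291854418038026618309368815759588563059310854123875652657183662379125,
980065910278263053967033870108617852661277104149576062993259208085343094980631782197725969642851947321754030091833846415453420,
1837363057418031193184299617289625193393709175243971846259338055640757900628959179248876143898955446448371210770792050535733171,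
1180515058411161231950361326476266105771375619432452872686322984072226190358733811526382811683570705980327354489874399137328306,
1256969118324620715279103422349803178675004996309972823885941959137602059017596766827921202678278608984909144326375795306060599,
589365026366479702752044126105243970631786124315150666067139625005327426686773105180119153747396134766655164119835467931285656,
151744875351526119156318590509608837945205648756424751094535544811493558811697450989846890581586029771619277156428919790155803,
50635815914318775514850632133156370614614150247016310692646499703435585733581384210737061734555307416028568045550049105286966,
1720007622631308581571013040841319492537930039968226261626738002053083880940237733591868009665788251200673784149135670164950169,
1074845865049848016895475933810465802640602514019658951608536810198850280372632533723589597389542512816920382030613881069578571,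
1066013826968877931116517302314810342242766423439450280935739221329482880766606196825327319540766936838493653888462122046151920,
1887357712264403420704227271907021420595511776408316457539057576973770280597084457100761156349476380236055020496513846757042087,
106670751085846849566255450019205372381174310588733088912190551844471606832872042245893626059964563012876304801717]

set_option maxRecDepth 100000

theorem run0 : withTabs (fun t => run t [(15, [15])] 4 0 hints0) = true := by decide +kernel

theorem run1 : withTabs (fun t => run t [(63, [3, 12, 48])] 6 2 hints1) = true := by decide +kernel

theorem run2 : withTabs (fun t => run t [(63, [17, 34, 33, 14, 28])] 6 2 hints2) = true := by decide +kernel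

theorem run3 : withTabs (fun t => run t [(61, [20, 40]), (62, [20, 40])] 6 0 hints3) = true := by decide +kernel

theorem check_all : withTabs checkAll = true := by decide +kernel

set_option linter.unusedSectionVars false

/-! ## Faces of a cone -/

section Cone

variable {ι : Type} [Fintype ι] [DecidableEq ι] {W : Type} [AddCommGroup W] [Module ℝ W]

def CFace (v : ι → W) (S : Finset ι) : Prop :=
  ∃ φ : W →ₗ[ℝ] ℝ, ∀ i, 0 ≤ φ (v i) ∧ (φ (v i) = 0 ↔ i ∈ S)

def csp (v : ι → W) (S : Finset ι) : Submodule ℝ W := Submodule.span ℝ (v '' (S : Set ι))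

noncomputable def crk (v : ι → W) (S : Finset ι) : ℕ := Module.finrank ℝ (csp v S)

variable {v : ι → W}

theorem csp_mem {S : Finset ι} {i : ι} (h : i ∈ S) : v i ∈ csp v S :=
  Submodule.subset_span ⟨i, h, rfl⟩

theorem csp_mono {S T : Finset ι} (h : S ⊆ T) : csp v S ≤ csp v T :=
  Submodule.span_mono (Set.image_mono h)

theorem csp_le {S : Finset ι} {P : Submodule ℝ W} (h : ∀ i ∈ S, v i ∈ P) : csp v S ≤ P := by
  rw [csp, Submodule.span_le]
  rintro _ ⟨i, hi, rfl⟩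
  exact h i hi

theorem csp_zero {S : Finset ι} {φ : W →ₗ[ℝ] ℝ} (h : ∀ i ∈ S, φ (v i) = 0) {x : W} (hx : x ∈ csp v S) : φ x = 0 :=
  (csp_le (P := LinearMap.ker φ) (fun i hi => h i hi)) hx

theorem CFace.inter {S T : Finset ι} (hS : CFace v S) (hT : CFace v T) : CFace v (S ∩ T) := by
  obtain ⟨φ, hφ⟩ := hS
  obtain ⟨ψ, hψ⟩ := hT
  refine ⟨φ + ψ, fun i => ?_⟩
  have a := hφ i
  have b := hψ i
  rw [LinearMap.add_apply, Finset.mem_inter, ← a.2, ← b.2]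
  refine ⟨add_nonneg a.1 b.1, ?_⟩
  constructor
  · intro h; exact ⟨by linarith, by linarith⟩
  · rintro ⟨h1, h2⟩; linarith

theorem CFace.mem_of_span {S : Finset ι} (hS : CFace v S) {i : ι} (h : v i ∈ csp v S) : i ∈ S := by
  obtain ⟨φ, hφ⟩ := hS
  rw [← (hφ i).2]
  exact csp_zero (fun j hj => (hφ j).2.2 hj) h

/-- a face of a face is a face -/
theorem CFace.face_of {T S : Finset ι} (hT : CFace v T) (hST : S ⊆ T) (ψ : W →ₗ[ℝ] ℝ)
    (h : ∀ i ∈ T, 0 ≤ ψ (v i) ∧ (ψ (v i) = 0 ↔ i ∈ S)) : CFace v S := by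
  obtain ⟨φ, hφ⟩ := hT
  obtain ⟨N, hN⟩ : ∃ N : ℝ, ∀ i, i ∉ T → 0 < N * φ (v i) + ψ (v i) := by
    have : ∀ i, ∃ N : ℝ, 0 ≤ N ∧ (i ∉ T → 0 < N * φ (v i) + ψ (v i)) := by
      intro i
      by_cases hi : i ∈ T
      · exact ⟨0, le_rfl, fun h => absurd hi h⟩
      · have hpos : 0 < φ (v i) := lt_of_le_of_ne (hφ i).1 fun e => hi ((hφ i).2.1 e.symm)
        refine ⟨(|ψ (v i)| + 1) / φ (v i), by positivity, fun _ => ?_⟩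
        rw [div_mul_cancel₀ _ hpos.ne']
        have := neg_abs_le (ψ (v i))
        linarith
    choose N hN0 hN using this
    refine ⟨∑ i, N i, fun i hi => ?_⟩
    have h1 := hN i hi
    have h2 : N i ≤ ∑ j, N j := Finset.single_le_sum (fun j _ => hN0 j) (Finset.mem_univ i)
    have h3 := mul_le_mul_of_nonneg_right h2 (hφ i).1
    linarith
  refine ⟨N • φ + ψ, fun i => ?_⟩
  simp only [LinearMap.add_apply, LinearMap.smul_apply, smul_eq_mul]
  by_cases hi : i ∈ T
  · rw [(hφ i).2.2 hi, mul_zero, zero_add]; exact h i hi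
  · have := hN i hi
    exact ⟨this.le, fun e => absurd e this.ne', fun e => absurd (hST e) hi⟩

variable [FiniteDimensional ℝ W]

theorem crk_mono {S T : Finset ι} (h : S ⊆ T) : crk v S ≤ crk v T :=
  Submodule.finrank_mono (csp_mono h)

theorem CFace.crk_lt {S T : Finset ι} (hS : CFace v S) (h : S ⊂ T) : crk v S < crk v T := by
  apply Submodule.finrank_lt_finrank_of_lt
  refine lt_of_le_of_ne (csp_mono h.subset) fun e => ?_
  obtain ⟨i, hi, hi'⟩ := Finset.exists_of_ssubset h
  exact hi' (hS.mem_of_span (e ▸ csp_mem hi))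

theorem crk_le_card (S : Finset ι) : crk v S ≤ S.card := by
  classical
  unfold crk csp
  rw [← Finset.coe_image]
  exact (finrank_span_finset_le_card _).trans Finset.card_image_le

theorem crk_insert (S : Finset ι) (i : ι) : crk v (insert i S) ≤ crk v S + 1 := by
  unfold crk csp
  rw [Finset.coe_insert, Set.image_insert_eq, Submodule.span_insert]
  refine (Submodule.finrank_add_le_finrank_add_finrank _ _).trans ?_
  have := finrank_span_le_card (R := ℝ) ({v i} : Set W)
  simp at this
  omega

/-- two faces strictly between `S` and `T` -/
theorem CFace.between {S T : Finset ι} (hS : CFace v S) (hT : CFace v T) (hST : S ⊂ T)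
    (hr : crk v S + 2 ≤ crk v T) :
    ∃ U V, CFace v U ∧ CFace v V ∧ S ⊂ U ∧ U ⊂ T ∧ S ⊂ V ∧ V ⊂ T ∧ U ≠ V := by
  obtain ⟨φ, hφ⟩ := id hS
  obtain ⟨i0, h0, h0'⟩ := Finset.exists_of_ssubset hST
  obtain ⟨i1, h1, h1'⟩ : ∃ i1 ∈ T, v i1 ∉ csp v (insert i0 S) := by
    by_contra hc
    push Not at hc
    have := Submodule.finrank_mono (csp_le hc)
    have h2 := crk_insert (v := v) S i0
    unfold crk at h2 hr
    omega
  obtain ⟨ψ, hψ1, hψ⟩ := Submodule.exists_le_ker_of_notMem h1'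
  have hψ0 : ∀ i ∈ insert i0 S, ψ (v i) = 0 := fun i hi => hψ (csp_mem hi)
  have hi1S : i1 ∉ S := fun h => h1' (csp_mem (Finset.mem_insert_of_mem h))
  have hpos : ∀ i, i ∉ S → 0 < φ (v i) := fun i hi =>
    lt_of_le_of_ne (hφ i).1 fun e => hi ((hφ i).2.1 e.symm)
  have hφ0 : ∀ i ∈ S, φ (v i) = 0 := fun i hi => (hφ i).2.2 hi
  have hne : (T \ S).Nonempty := ⟨i0, by simp [h0, h0']⟩
  obtain ⟨a, ha, hamin⟩ := Finset.exists_min_image (T \ S) (fun i => ψ (v i) / φ (v i)) hne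
  obtain ⟨b, hb, hbmax⟩ := Finset.exists_max_image (T \ S) (fun i => ψ (v i) / φ (v i)) hne
  rw [Finset.mem_sdiff] at ha hb
  have key : ∀ (s c : ℝ), (∀ i ∈ T \ S, s * c ≤ s * (ψ (v i) / φ (v i))) →
      CFace v (T.filter fun i => i ∈ S ∨ s * ψ (v i) = s * (c * φ (v i))) := by
    intro s c hc
    refine hT.face_of (Finset.filter_subset _ _) (s • ψ - (s * c) • φ) ?_
    intro i hi
    simp only [LinearMap.sub_apply, LinearMap.smul_apply, smul_eq_mul, Finset.mem_filter, hi, true_and]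
    by_cases hiS : i ∈ S
    · rw [hψ0 i (Finset.mem_insert_of_mem hiS), hφ0 i hiS]; simp [hiS]
    · have hp := hpos i hiS
      have h3 := mul_le_mul_of_nonneg_right (hc i (by simp [hi, hiS])) hp.le
      have h4 : ψ (v i) / φ (v i) * φ (v i) = ψ (v i) := div_mul_cancel₀ _ hp.ne'
      rw [mul_assoc s (ψ (v i) / φ (v i)), h4] at h3
      refine ⟨by linarith, ?_⟩
      simp only [hiS, false_or]
      constructor <;> intro h <;> linarith
  have hab : ψ (v a) / φ (v a) < ψ (v b) / φ (v b) := by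
    have e0 : ψ (v i0) / φ (v i0) = 0 := by rw [hψ0 i0 (by simp)]; simp
    have e1 : ψ (v i1) / φ (v i1) ≠ 0 := div_ne_zero hψ1 (hpos i1 hi1S).ne'
    have m0 := hamin i0 (by simp [h0, h0'])
    have m1 := hamin i1 (by simp [h1, hi1S])
    have M0 := hbmax i0 (by simp [h0, h0'])
    have M1 := hbmax i1 (by simp [h1, hi1S])
    simp only [e0] at m0 M0
    rcases lt_or_gt_of_ne e1 with h | h
    · exact lt_of_le_of_lt m1 (lt_of_lt_of_le h M0)
    · exact lt_of_le_of_lt m0 (lt_of_lt_of_le h M1)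
  have ea : ψ (v a) = ψ (v a) / φ (v a) * φ (v a) := (div_mul_cancel₀ _ (hpos a ha.2).ne').symm
  have eb : ψ (v b) = ψ (v b) / φ (v b) * φ (v b) := (div_mul_cancel₀ _ (hpos b hb.2).ne').symm
  have Fa := key 1 (ψ (v a) / φ (v a)) (fun i hi => by simpa using hamin i hi)
  have Fb := key (-1) (ψ (v b) / φ (v b)) (fun i hi => by simpa using hbmax i hi)
  have sub : ∀ (s c : ℝ), S ⊆ (T.filter fun i => i ∈ S ∨ s * ψ (v i) = s * (c * φ (v i))) := by
    intro s c i hi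
    simp [hi, hST.subset hi]
  have ma : a ∈ (T.filter fun i => i ∈ S ∨ 1 * ψ (v i) = 1 * (ψ (v a) / φ (v a) * φ (v i))) := by
    rw [Finset.mem_filter]; exact ⟨ha.1, Or.inr (by rw [← ea])⟩
  have mb : b ∈ (T.filter fun i => i ∈ S ∨ (-1) * ψ (v i) = (-1) * (ψ (v b) / φ (v b) * φ (v i))) := by
    rw [Finset.mem_filter]; exact ⟨hb.1, Or.inr (by rw [← eb])⟩
  have na : b ∉ (T.filter fun i => i ∈ S ∨ 1 * ψ (v i) = 1 * (ψ (v a) / φ (v a) * φ (v i))) := by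
    rw [Finset.mem_filter]
    rintro ⟨-, h | h⟩
    · exact hb.2 h
    · rw [one_mul, one_mul, ← div_eq_iff (hpos b hb.2).ne'] at h
      exact hab.ne' h
  have nb : a ∉ (T.filter fun i => i ∈ S ∨ (-1) * ψ (v i) = (-1) * (ψ (v b) / φ (v b) * φ (v i))) := by
    rw [Finset.mem_filter]
    rintro ⟨-, h | h⟩
    · exact ha.2 h
    · rw [neg_one_mul, neg_one_mul, neg_inj, ← div_eq_iff (hpos a ha.2).ne'] at h
      exact hab.ne h
  exact ⟨_, _, Fa, Fb, Finset.ssubset_iff_subset_ne.2 ⟨sub _ _, fun e => ha.2 (e ▸ ma)⟩,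
    Finset.ssubset_iff_subset_ne.2 ⟨Finset.filter_subset _ _, fun e => na (by rw [e]; exact hb.1)⟩,
    Finset.ssubset_iff_subset_ne.2 ⟨sub _ _, fun e => hb.2 (e ▸ mb)⟩,
    Finset.ssubset_iff_subset_ne.2 ⟨Finset.filter_subset _ _, fun e => nb (by rw [e]; exact ha.1)⟩,
    fun e => nb (e ▸ ma)⟩

/-- a nontrivial combination falling in a subspace -/
theorem dep3 {P Q : Submodule ℝ W} (hPQ : P ≤ Q) (h : Module.finrank ℝ Q < Module.finrank ℝ P + 3)
    (x : Fin 3 → W) (hx : ∀ j, x j ∈ Q) : ∃ α : Fin 3 → ℝ, (∃ j, α j ≠ 0) ∧ ∑ j, α j • x j ∈ P := by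
  let f : Q →ₗ[ℝ] W ⧸ P := P.mkQ.comp Q.subtype
  have hf : Module.finrank ℝ (LinearMap.range f) + Module.finrank ℝ (LinearMap.ker f) = Module.finrank ℝ Q :=
    f.finrank_range_add_finrank_ker
  have hker : Module.finrank ℝ (LinearMap.ker f) = Module.finrank ℝ P := by
    have : LinearMap.ker f = P.comap Q.subtype := by
      ext z; simp [f]
    rw [this]
    exact (Submodule.comapSubtypeEquivOfLe hPQ).finrank_eq
  have hdep : ¬ LinearIndependent ℝ (fun j => (⟨f ⟨x j, hx j⟩, ⟨_, rfl⟩⟩ : LinearMap.range f)) := by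
    intro hl
    have := hl.fintype_card_le_finrank
    simp at this
    omega
  rw [Fintype.not_linearIndependent_iff] at hdep
  obtain ⟨α, h0, hne⟩ := hdep
  refine ⟨α, hne, ?_⟩
  have := congrArg Subtype.val h0
  simp [f, Fin.sum_univ_three] at this
  rw [Fin.sum_univ_three, ← Submodule.Quotient.mk_eq_zero]
  simpa using this

theorem opp_sign {α : Fin 3 → ℝ} {p : Fin 3 → Fin 3 → ℝ} (hp : ∀ j k, j ≠ k → 0 < p k j)
    (h0 : α 1 * p 0 1 + α 2 * p 0 2 = 0) (h1 : α 0 * p 1 0 + α 2 * p 1 2 = 0)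
    (h2 : α 0 * p 2 0 + α 1 * p 2 1 = 0) : ∀ j, α j = 0 := by
  have two : ∀ {a b s t : ℝ}, 0 < s → 0 < t → a * s + b * t = 0 → (a = 0 ∧ b = 0) ∨ a * b < 0 := by
    intro a b s t hs ht h
    by_cases ha : a = 0
    · subst ha
      left
      have : b * t = 0 := by linarith
      exact ⟨rfl, (mul_eq_zero.1 this).resolve_right ht.ne'⟩
    · right
      have : b = -(a * s) / t := by field_simp; linarith
      rw [this]
      have e : a * (-(a * s) / t) = -(a ^ 2 * s / t) := by ring
      rw [e]
      have : 0 < a ^ 2 * s / t := by positivity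
      linarith
  have a := two (hp 1 0 (by decide)) (hp 2 0 (by decide)) h0
  have b := two (hp 0 1 (by decide)) (hp 2 1 (by decide)) h1
  have c := two (hp 0 2 (by decide)) (hp 1 2 (by decide)) h2
  have : α 0 = 0 ∧ α 1 = 0 ∧ α 2 = 0 := by
    rcases a with ⟨a1, a2⟩ | a
    · rcases b with ⟨b1, b2⟩ | b
      · exact ⟨b1, a1, a2⟩
      · rw [a2, mul_zero] at b; exact absurd b (lt_irrefl _)
    · exfalso
      have n1 : α 1 ≠ 0 := fun e => by rw [e, zero_mul] at a; exact lt_irrefl _ a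
      have n2 : α 2 ≠ 0 := fun e => by rw [e, mul_zero] at a; exact lt_irrefl _ a
      have b' := b.resolve_left fun h => n2 h.2
      have c' := c.resolve_left fun h => n1 h.2
      have h3 := mul_neg_of_pos_of_neg (mul_pos_of_neg_of_neg a b') c'
      nlinarith [sq_nonneg (α 0 * α 1 * α 2)]
  intro j
  fin_cases j
  exacts [this.1, this.2.1, this.2.2]

/-- the diamond property -/
theorem CFace.diamond {S T : Finset ι} (hS : CFace v S) (hT : CFace v T) (hST : S ⊂ T)
    (hr : crk v T = crk v S + 2) {U : Fin 3 → Finset ι} (hU : ∀ j, CFace v (U j) ∧ S ⊂ U j ∧ U j ⊂ T) :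
    ∃ j k, j ≠ k ∧ U j = U k := by
  by_contra hc
  push Not at hc
  have hrU : ∀ j, crk v (U j) = crk v S + 1 := by
    intro j
    have h1 := hS.crk_lt (hU j).2.1
    have h2 := (hU j).1.crk_lt (hU j).2.2
    omega
  have hint : ∀ j k, j ≠ k → U j ∩ U k = S := by
    intro j k hjk
    by_contra hne
    have h1 : S ⊂ U j ∩ U k := Finset.ssubset_iff_subset_ne.2
      ⟨Finset.subset_inter (hU j).2.1.subset (hU k).2.1.subset, fun e => hne e.symm⟩
    have h2 := hS.crk_lt h1
    have hI := (hU j).1.inter (hU k).1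
    have a1 : U j ∩ U k = U j := by
      by_contra h3
      have := hI.crk_lt (Finset.ssubset_iff_subset_ne.2 ⟨Finset.inter_subset_left, h3⟩)
      have := hrU j
      omega
    have a2 : U j ∩ U k = U k := by
      by_contra h3
      have := hI.crk_lt (Finset.ssubset_iff_subset_ne.2 ⟨Finset.inter_subset_right, h3⟩)
      have := hrU k
      omega
    exact hc j k hjk (a1.symm.trans a2)
  have hx : ∀ j, ∃ i, i ∈ U j ∧ i ∉ S := fun j => by
    obtain ⟨i, h1, h2⟩ := Finset.exists_of_ssubset (hU j).2.1
    exact ⟨i, h1, h2⟩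
  choose i hiU hiS using hx
  choose φ hφ using fun j => (hU j).1
  obtain ⟨α, ⟨j0, hj0⟩, hα⟩ := dep3 (csp_mono (v := v) hST.subset) (by unfold crk at hr; omega)
    (fun j => v (i j)) (fun j => csp_mem ((hU j).2.2.subset (hiU j)))
  have hk : ∀ k, ∑ j, α j * φ k (v (i j)) = 0 := by
    intro k
    have := csp_zero (φ := φ k) (fun i hi => ((hφ k i).2.2 ((hU k).2.1.subset hi))) hα
    simpa using this
  have hself : ∀ k, φ k (v (i k)) = 0 := fun k => (hφ k _).2.2 (hiU k)
  have hpos : ∀ j k, j ≠ k → 0 < φ k (v (i j)) := by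
    intro j k hjk
    refine lt_of_le_of_ne (hφ k _).1 fun e => hiS j ?_
    rw [← hint j k hjk]
    exact Finset.mem_inter.2 ⟨hiU j, (hφ k _).2.1 e.symm⟩
  refine hj0 (opp_sign (p := fun k j => φ k (v (i j))) hpos ?_ ?_ ?_ j0)
  · have := hk 0; rw [Fin.sum_univ_three, hself] at this; simpa using this
  · have := hk 1; rw [Fin.sum_univ_three, hself] at this; simpa using this
  · have := hk 2; rw [Fin.sum_univ_three, hself] at this; simpa using this

/-- exactly two faces in between -/
theorem CFace.two {S T : Finset ι} (hS : CFace v S) (hT : CFace v T) (hST : S ⊂ T)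
    (hr : crk v T = crk v S + 2) (D : Finset (Finset ι)) (hD : ∀ U, U ∈ D ↔ CFace v U ∧ S ⊂ U ∧ U ⊂ T) :
    D.card = 2 := by
  apply le_antisymm
  · by_contra hc
    obtain ⟨a, ha, b, hb, c, hc, hab, hac, hbc⟩ := Finset.two_lt_card.1 (not_le.1 hc)
    obtain ⟨j, k, hjk, e⟩ := hS.diamond hT hST hr (U := ![a, b, c]) (by
      intro j
      rw [← hD]
      fin_cases j
      exacts [ha, hb, hc])
    fin_cases j <;> fin_cases k <;> simp_all
  · obtain ⟨U, V, h1, h2, h3, h4, h5, h6, h7⟩ := hS.between hT hST hr.ge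
    exact Finset.one_lt_card.2 ⟨U, (hD U).2 ⟨h1, h3, h4⟩, V, (hD V).2 ⟨h2, h5, h6⟩, h7⟩

end Cone

/-! ## Vertex-edge-face combinatorics -/

section Lattice

variable {ι : Type} [Fintype ι] [DecidableEq ι] {W : Type} [AddCommGroup W] [Module ℝ W]
  [FiniteDimensional ℝ W] {v : ι → W}

structure PolyW (v : ι → W) : Prop where
  aff : ∃ h : W →ₗ[ℝ] ℝ, ∀ i, h (v i) = 1
  sing : ∀ i, CFace v {i}
  rk : crk v Finset.univ = 5

open Classical in
noncomputable def fc (v : ι → W) (k : ℕ) : Finset (Finset ι) :=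
  Finset.univ.filter fun S => CFace v S ∧ crk v S = k

theorem mem_fc {k : ℕ} {S : Finset ι} : S ∈ fc v k ↔ CFace v S ∧ crk v S = k := by
  simp [fc]

theorem ss {S T : Finset ι} (h : S ⊆ T) (hne : S ≠ T) : S ⊂ T := Finset.ssubset_iff_subset_ne.2 ⟨h, hne⟩

theorem fc_eq {k : ℕ} {S T : Finset ι} (hS : S ∈ fc v k) (hT : T ∈ fc v k) (h : S ⊆ T) : S = T := by
  by_contra hne
  rw [mem_fc] at hS hT
  have := hS.1.crk_lt (ss h hne)
  omega

theorem fc_two {k : ℕ} {S T : Finset ι} (hS : S ∈ fc v k) (hT : T ∈ fc v (k + 2)) (h : S ⊆ T) :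
    ((fc v (k + 1)).filter fun U => S ⊆ U ∧ U ⊆ T).card = 2 := by
  rw [mem_fc] at hS hT
  refine hS.1.two hT.1 (ss h fun e => ?_) (by omega) _ ?_
  · rw [e] at hS; omega
  intro U
  rw [Finset.mem_filter, mem_fc]
  constructor
  · rintro ⟨⟨h1, h2⟩, h3, h4⟩
    refine ⟨h1, ss h3 ?_, ss h4 ?_⟩
    · rintro rfl; omega
    · rintro rfl; omega
  · rintro ⟨h1, h3, h4⟩
    have := hS.1.crk_lt h3
    have := h1.crk_lt h4
    exact ⟨⟨h1, by omega⟩, h3.subset, h4.subset⟩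

theorem crk_empty : crk v ∅ = 0 := by
  have := crk_le_card (v := v) ∅
  simpa using this

theorem PolyW.empty (hP : PolyW v) : ∅ ∈ fc v 0 := by
  obtain ⟨h, hh⟩ := hP.aff
  exact mem_fc.2 ⟨⟨h, fun i => by rw [hh]; simp⟩, crk_empty⟩

theorem PolyW.univ (hP : PolyW v) : Finset.univ ∈ fc v 5 :=
  mem_fc.2 ⟨⟨0, fun i => by simp⟩, hP.rk⟩

theorem PolyW.single (hP : PolyW v) (i : ι) : {i} ∈ fc v 1 := by
  refine mem_fc.2 ⟨hP.sing i, ?_⟩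
  have h1 := crk_le_card (v := v) {i}
  have h2 := (mem_fc.1 hP.empty).1.crk_lt (T := {i}) (by simp)
  rw [crk_empty] at h2
  simp at h1
  omega

theorem PolyW.card1 (hP : PolyW v) {S : Finset ι} (hS : S ∈ fc v 1) : ∃ i, S = {i} := by
  obtain ⟨i, hi⟩ : S.Nonempty := by
    rw [Finset.nonempty_iff_ne_empty]
    rintro rfl
    have := (mem_fc.1 hS).2
    rw [crk_empty] at this
    omega
  exact ⟨i, (fc_eq (hP.single i) hS (by simpa using hi)).symm⟩

theorem PolyW.inj (hP : PolyW v) {i j : ι} (h : v i = v j) : i = j := by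
  obtain ⟨φ, hφ⟩ := hP.sing j
  have := (hφ i).2
  rw [h, (hφ j).2.2 (by simp)] at this
  simpa using this

theorem PolyW.card2 (hP : PolyW v) {S : Finset ι} (hS : S ∈ fc v 2) : S.card = 2 := by
  have h := fc_two hP.empty hS (by simp)
  have : ((fc v (0 + 1)).filter fun U => ∅ ⊆ U ∧ U ⊆ S) = S.image fun i => {i} := by
    ext U
    simp only [Finset.mem_filter, Finset.mem_image]
    constructor
    · rintro ⟨h1, -, h2⟩
      obtain ⟨i, rfl⟩ := hP.card1 h1
      exact ⟨i, by simpa using h2, rfl⟩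
    · rintro ⟨i, h1, rfl⟩
      exact ⟨hP.single i, by simp, by simpa using h1⟩
  rw [this, Finset.card_image_of_injective _ Finset.singleton_injective] at h
  exact h

theorem dcount {α β : Type} (A : Finset α) (B : Finset β) (r : α → β → Prop) [∀ a b, Decidable (r a b)] :
    ∑ a ∈ A, (B.filter fun b => r a b).card = ∑ b ∈ B, (A.filter fun a => r a b).card :=
  Finset.sum_card_bipartiteAbove_eq_sum_card_bipartiteBelow r

/-- faces of rank `k` inside `F` -/
noncomputable def sub (v : ι → W) (k : ℕ) (F : Finset ι) : Finset (Finset ι) := (fc v k).filter fun U => U ⊆ F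

theorem mem_sub {k : ℕ} {F U : Finset ι} : U ∈ sub v k F ↔ U ∈ fc v k ∧ U ⊆ F := by simp [sub]

theorem PolyW.at3 (hP : PolyW v) {G : Finset ι} (hG : G ∈ fc v 3) {i : ι} (hi : i ∈ G) :
    ((sub v 2 G).filter fun U => i ∈ U).card = 2 := by
  refine Eq.trans (congrArg Finset.card ?_) (fc_two (hP.single i) hG (by simpa using hi))
  rw [sub, Finset.filter_filter]
  ext U
  simp [and_comm]

theorem PolyW.edges3 (hP : PolyW v) {G : Finset ι} (hG : G ∈ fc v 3) : (sub v 2 G).card = G.card := by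
  have h := dcount G (sub v 2 G) fun i U => i ∈ U
  have h2 : ∀ U ∈ sub v 2 G, (G.filter fun i => i ∈ U).card = 2 := by
    intro U hU
    rw [mem_sub] at hU
    rw [Finset.filter_mem_eq_inter, Finset.inter_eq_right.2 hU.2, hP.card2 hU.1]
  rw [Finset.sum_congr rfl fun i hi => hP.at3 hG hi, Finset.sum_congr rfl h2] at h
  simp at h; omega

theorem card_ge {k : ℕ} {G : Finset ι} (hG : G ∈ fc v k) : k ≤ G.card :=
  (mem_fc.1 hG).2 ▸ crk_le_card G

theorem edge4 {F U : Finset ι} (hF : F ∈ fc v 4) (hU : U ∈ sub v 2 F) :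
    ((sub v 3 F).filter fun G => U ⊆ G).card = 2 := by
  rw [mem_sub] at hU
  rw [← fc_two hU.1 hF hU.2, sub, Finset.filter_filter]
  congr 1
  ext U
  simp [and_comm]

theorem PolyW.sum3 (hP : PolyW v) {F : Finset ι} (hF : F ∈ fc v 4) :
    ∑ G ∈ sub v 3 F, G.card = 2 * (sub v 2 F).card := by
  have h := dcount (sub v 3 F) (sub v 2 F) fun G U => U ⊆ G
  rw [Finset.sum_congr rfl fun U hU => edge4 hF hU] at h
  rw [Finset.sum_const, smul_eq_mul] at h
  rw [mul_comm, ← h]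
  refine Finset.sum_congr rfl fun G hG => ?_
  rw [mem_sub] at hG
  rw [← hP.edges3 hG.1]
  congr 1
  ext U
  simp only [Finset.mem_filter, mem_sub]
  exact ⟨fun h => ⟨⟨h.1, h.2.trans hG.2⟩, h.2⟩, fun h => ⟨h.1.1, h.2⟩⟩

theorem PolyW.tri2 (hP : PolyW v) {G : Finset ι} (hG : G ∈ fc v 3) :
    ((fc v 4).filter fun F => G ⊆ F).card = 2 := by
  rw [← fc_two hG hP.univ (by simp)]
  congr 1
  ext U
  simp

theorem PolyW.small (hP : PolyW v) {S : Finset ι} (hS : CFace v S) (h : crk v S ≤ 2) : S.card ≤ 2 := by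
  rcases lt_or_eq_of_le h with h | h
  · rcases Nat.lt_or_ge (crk v S) 1 with h1 | h1
    · have : S = ∅ := by
        by_contra hne
        have h2 := (mem_fc.1 hP.empty).1.crk_lt (T := S) (by
          rw [Finset.empty_ssubset]; exact Finset.nonempty_iff_ne_empty.2 hne)
        omega
      simp [this]
    · obtain ⟨i, rfl⟩ := hP.card1 (mem_fc.2 ⟨hS, by omega⟩)
      simp
  · exact (hP.card2 (mem_fc.2 ⟨hS, h⟩)).le

theorem fc_inter {k : ℕ} {S T : Finset ι} (hS : S ∈ fc v k) (hT : T ∈ fc v k) (hne : S ≠ T) :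
    CFace v (S ∩ T) ∧ crk v (S ∩ T) < k := by
  have hI := (mem_fc.1 hS).1.inter (mem_fc.1 hT).1
  refine ⟨hI, ?_⟩
  rw [← (mem_fc.1 hS).2]
  apply hI.crk_lt
  refine ss Finset.inter_subset_left fun e => hne ?_
  exact fc_eq hS hT (Finset.inter_eq_left.1 e)

theorem PolyW.inter3 (hP : PolyW v) {G G' : Finset ι} (hG : G ∈ fc v 3) (hG' : G' ∈ fc v 3) (hne : G ≠ G') :
    (G ∩ G').card ≤ 2 := by
  have h := fc_inter hG hG' hne
  exact hP.small h.1 (by omega)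

theorem edge_eq {U : Finset ι} (h : U.card = 2) {i : ι} (hi : i ∈ U) : ∃ j, j ≠ i ∧ U = {i, j} := by
  obtain ⟨a, b, hab, rfl⟩ := Finset.card_eq_two.1 h
  rw [Finset.mem_insert, Finset.mem_singleton] at hi
  rcases hi with rfl | rfl
  · exact ⟨b, hab.symm, rfl⟩
  · exact ⟨a, hab, Finset.pair_comm _ _⟩

/-- the two edges at a vertex of a 2-face -/
theorem PolyW.nb2 (hP : PolyW v) {G : Finset ι} (hG : G ∈ fc v 3) {x : ι} (hx : x ∈ G) :
    ∃ a b, a ≠ x ∧ b ≠ x ∧ a ≠ b ∧ {x, a} ∈ fc v 2 ∧ {x, b} ∈ fc v 2 ∧ a ∈ G ∧ b ∈ G ∧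
      (sub v 2 G).filter (fun U => x ∈ U) = {{x, a}, {x, b}} := by
  obtain ⟨A, B, hAB, e⟩ := Finset.card_eq_two.1 (hP.at3 hG hx)
  have hA : A ∈ (sub v 2 G).filter fun U => x ∈ U := by rw [e]; simp
  have hB : B ∈ (sub v 2 G).filter fun U => x ∈ U := by rw [e]; simp
  rw [Finset.mem_filter, mem_sub] at hA hB
  obtain ⟨a, ha, rfl⟩ := edge_eq (hP.card2 hA.1.1) hA.2
  obtain ⟨b, hb, rfl⟩ := edge_eq (hP.card2 hB.1.1) hB.2
  refine ⟨a, b, ha, hb, ?_, hA.1.1, hB.1.1, hA.1.2 (by simp), hB.1.2 (by simp), e⟩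
  rintro rfl; exact hAB rfl

/-- a vertex above both neighbours is the top of the 2-face -/
theorem PolyW.top3 (hP : PolyW v) {G : Finset ι} (hG : G ∈ fc v 3) {x a b : ι} (hx : x ∈ G) (ha : a ∈ G) (hb : b ∈ G)
    (hax : a ≠ x) (hbx : b ≠ x) (hab : a ≠ b) (ea : {x, a} ∈ fc v 2) (eb : {x, b} ∈ fc v 2) (c : W →ₗ[ℝ] ℝ)
    (ca : c (v a) < c (v x)) (cb : c (v b) < c (v x)) : ∀ i ∈ G, c (v i) ≤ c (v x) := by
  intro i hi
  obtain ⟨h, hh⟩ := hP.aff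
  rw [mem_fc] at ea eb
  have hb' : b ∉ ({x, a} : Finset ι) := by simp [hbx, hab.symm]
  have ha' : a ∉ ({x, b} : Finset ι) := by simp [hax, hab]
  have hr : crk v (insert b {x, a}) = 3 := by
    have h1 := ea.1.crk_lt (T := insert b {x, a}) (Finset.ssubset_insert hb')
    have h2 := crk_insert (v := v) {x, a} b
    omega
  have hle : insert b {x, a} ⊆ G := by
    intro j hj; simp at hj; rcases hj with rfl | rfl | rfl <;> assumption
  have hsp : csp v (insert b {x, a}) = csp v G := by
    apply Submodule.eq_of_le_of_finrank_eq (csp_mono hle)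
    have := (mem_fc.1 hG).2
    unfold crk at this hr
    omega
  have hm : v i ∈ csp v (insert b {x, a}) := hsp ▸ csp_mem hi
  unfold csp at hm
  rw [show v '' ((insert b {x, a} : Finset ι) : Set ι) = {v b, v x, v a} by simp [Set.image_insert_eq], Submodule.mem_span_triple] at hm
  obtain ⟨γ, α, β, e⟩ := hm
  obtain ⟨φ, hφ⟩ := ea.1
  obtain ⟨ψ, hψ⟩ := eb.1
  have h1 := congrArg h e
  have h2 := congrArg φ e
  have h3 := congrArg ψ e
  have h4 := congrArg c e
  simp only [map_add, map_smul, smul_eq_mul, hh, (hφ x).2.2 (by simp), (hφ a).2.2 (by simp),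
    (hψ x).2.2 (by simp), (hψ b).2.2 (by simp)] at h1 h2 h3 h4
  have pb : 0 < φ (v b) := lt_of_le_of_ne (hφ b).1 fun e => hb' ((hφ b).2.1 e.symm)
  have pa : 0 < ψ (v a) := lt_of_le_of_ne (hψ a).1 fun e => ha' ((hψ a).2.1 e.symm)
  have g1 : 0 ≤ γ := by
    have := (hφ i).1
    rw [← h2] at this
    by_contra hc
    nlinarith
  have g2 : 0 ≤ β := by
    have := (hψ i).1
    rw [← h3] at this
    by_contra hc
    nlinarith
  have : α = 1 - β - γ := by linarith
  subst this
  nlinarith [mul_nonneg g1 (sub_nonneg.2 cb.le), mul_nonneg g2 (sub_nonneg.2 ca.le)]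

/-- at most two 2-faces at `x` cross the level of `x` -/
theorem PolyW.cross (hP : PolyW v) {F : Finset ι} (hF : F ∈ fc v 4) (c : W →ₗ[ℝ] ℝ) (x : ι) (hx : x ∈ F)
    (G : Fin 3 → Finset ι) (hG : ∀ j, G j ∈ fc v 3 ∧ G j ⊆ F ∧ x ∈ G j ∧
      ∃ a ∈ G j, ∃ b ∈ G j, c (v a) < c (v x) ∧ c (v x) < c (v b)) : ∃ j k, j ≠ k ∧ G j = G k := by
  by_contra hc
  push Not at hc
  obtain ⟨h, hh⟩ := hP.aff
  choose hG3 hGF hGx a haG b hbG hca hcb using hG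
  choose φ hφ using fun j => (mem_fc.1 (hG3 j)).1
  let c' : W →ₗ[ℝ] ℝ := c - c (v x) • h
  have hc' : ∀ i, c' (v i) = c (v i) - c (v x) := fun i => by simp [c', hh]
  let w : Fin 3 → W := fun j => c' (v (b j)) • v (a j) - c' (v (a j)) • v (b j)
  let Q : Submodule ℝ W := csp v F ⊓ LinearMap.ker c'
  let P : Submodule ℝ W := csp v {x}
  have hPQ : P ≤ Q := by
    refine csp_le fun i hi => ?_
    rw [Finset.mem_singleton] at hi
    subst hi
    exact ⟨csp_mem hx, by simp [hc']⟩
  have hQ : Module.finrank ℝ Q < Module.finrank ℝ P + 3 := by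
    have h1 : Module.finrank ℝ P = 1 := (mem_fc.1 (hP.single x)).2
    have h2 : Module.finrank ℝ Q < 4 := by
      rw [← (mem_fc.1 hF).2]
      apply Submodule.finrank_lt_finrank_of_lt
      refine lt_of_le_of_ne inf_le_left fun e => ?_
      have h3 : v (a 0) ∈ Q := e ▸ csp_mem (hGF 0 (haG 0))
      have h4 : c' (v (a 0)) = 0 := h3.2
      rw [hc'] at h4
      linarith [hca 0]
    omega
  obtain ⟨α, ⟨j0, hj0⟩, hα⟩ := dep3 hPQ hQ w (fun j => by
    refine ⟨Submodule.sub_mem _ (Submodule.smul_mem _ _ (csp_mem (hGF j (haG j))))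
      (Submodule.smul_mem _ _ (csp_mem (hGF j (hbG j)))), ?_⟩
    change c' (w j) = 0
    simp only [w, map_sub, map_smul, smul_eq_mul]
    ring)
  have hk : ∀ k, ∑ j, α j * φ k (w j) = 0 := by
    intro k
    have := csp_zero (φ := φ k) (fun i hi => by
      rw [Finset.mem_singleton] at hi; subst hi; exact (hφ k _).2.2 (hGx k)) hα
    simpa using this
  have hself : ∀ k, φ k (w k) = 0 := fun k => by
    simp [w, (hφ k _).2.2 (haG k), (hφ k _).2.2 (hbG k)]
  have hpos : ∀ j k, j ≠ k → 0 < φ k (w j) := by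
    intro j k hjk
    have ew : φ k (w j) = (c (v (b j)) - c (v x)) * φ k (v (a j)) + (c (v x) - c (v (a j))) * φ k (v (b j)) := by
      simp only [w, map_sub, map_smul, smul_eq_mul, hc']
      ring
    rw [ew]
    have p1 := sub_pos.2 (hcb j)
    have p2 := sub_pos.2 (hca j)
    have q1 := (hφ k (a j)).1
    have q2 := (hφ k (b j)).1
    by_contra hn
    have z1 := mul_nonneg p1.le q1
    have z2 := mul_nonneg p2.le q2
    have e1 : φ k (v (a j)) = 0 := (mul_eq_zero.1 (by linarith : (c (v (b j)) - c (v x)) * φ k (v (a j)) = 0)).resolve_left p1.ne'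
    have e2 : φ k (v (b j)) = 0 := (mul_eq_zero.1 (by linarith : (c (v x) - c (v (a j))) * φ k (v (b j)) = 0)).resolve_left p2.ne'
    have m1 := (hφ k _).2.1 e1
    have m2 := (hφ k _).2.1 e2
    have n1 : x ≠ a j := fun e => by have := hca j; rw [← e] at this; exact lt_irrefl _ this
    have n2 : x ≠ b j := fun e => by have := hcb j; rw [← e] at this; exact lt_irrefl _ this
    have n3 : a j ≠ b j := fun e => by have h1 := hca j; have h2 := hcb j; rw [e] at h1; linarith
    have h3 : ({x, a j, b j} : Finset ι) ⊆ G j ∩ G k := by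
      intro i hi
      simp only [Finset.mem_insert, Finset.mem_singleton] at hi
      rcases hi with rfl | rfl | rfl
      · exact Finset.mem_inter.2 ⟨hGx j, hGx k⟩
      · exact Finset.mem_inter.2 ⟨haG j, m1⟩
      · exact Finset.mem_inter.2 ⟨hbG j, m2⟩
    have h4 := Finset.card_le_card h3
    rw [Finset.card_eq_three.2 ⟨_, _, _, n1, n2, n3, rfl⟩] at h4
    have := hP.inter3 (hG3 j) (hG3 k) (hc j k hjk)
    omega
  refine hj0 (opp_sign (p := fun k j => φ k (w j)) hpos ?_ ?_ ?_ j0)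
  · have := hk 0; rw [Fin.sum_univ_three, hself] at this; simpa using this
  · have := hk 1; rw [Fin.sum_univ_three, hself] at this; simpa using this
  · have := hk 2; rw [Fin.sum_univ_three, hself] at this; simpa using this

end Lattice

section Euler

variable {ι : Type} [Fintype ι] [DecidableEq ι] {W : Type} [AddCommGroup W] [Module ℝ W]
  [FiniteDimensional ℝ W] {v : ι → W}

theorem PolyW.generic (hP : PolyW v) : ∃ c : W →ₗ[ℝ] ℝ, ∀ i j, c (v i) = c (v j) → i = j := by
  obtain ⟨f, hf⟩ := Module.exists_dual_forall_apply_ne_zero (K := ℝ)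
    (fun p : {p : ι × ι // p.1 ≠ p.2} => v p.1.1 - v p.1.2)
    (fun p h => p.2 (hP.inj (sub_eq_zero.1 h)))
  refine ⟨f, fun i j h => ?_⟩
  by_contra hne
  apply hf ⟨(i, j), hne⟩
  simp only [map_sub]
  rw [h, sub_self]

open Classical in
theorem PolyW.card_le3 (hP : PolyW v) (c : W →ₗ[ℝ] ℝ) (hc : ∀ i j, c (v i) = c (v j) → i = j)
    {G : Finset ι} (hG : G ∈ fc v 3) : G.card ≤ 2 +
      (G.filter fun x => ∃ a ∈ G, ∃ b ∈ G, c (v a) < c (v x) ∧ c (v x) < c (v b)).card := by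
  have h1 := dcount G (sub v 2 G) fun x U => x ∈ U ∧ ∀ i ∈ U, c (v i) ≤ c (v x)
  have h2 : ∀ U ∈ sub v 2 G, (G.filter fun x => x ∈ U ∧ ∀ i ∈ U, c (v i) ≤ c (v x)).card = 1 := by
    intro U hU
    rw [mem_sub] at hU
    obtain ⟨t, ht, htop⟩ := Finset.exists_max_image U (fun i => c (v i))
      (Finset.card_pos.1 (by rw [hP.card2 hU.1]; norm_num))
    rw [Finset.card_eq_one]
    refine ⟨t, ?_⟩
    ext x
    rw [Finset.mem_filter, Finset.mem_singleton]
    constructor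
    · rintro ⟨_, hx, hx'⟩
      exact hc _ _ (le_antisymm (htop x hx) (hx' t ht))
    · rintro rfl
      exact ⟨hU.2 ht, ht, htop⟩
  rw [Finset.sum_congr rfl h2, Finset.sum_const, smul_eq_mul, mul_one, hP.edges3 hG] at h1
  have h3 : ∀ x ∈ G, ((sub v 2 G).filter fun U => x ∈ U ∧ ∀ i ∈ U, c (v i) ≤ c (v x)).card ≤
      (if ∀ i ∈ G, c (v i) ≤ c (v x) then 2 else 0) +
      (if ∃ a ∈ G, ∃ b ∈ G, c (v a) < c (v x) ∧ c (v x) < c (v b) then 1 else 0) := by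
    intro x hx
    obtain ⟨a, b, hax, hbx, hab, ea, eb, ha, hb, e⟩ := hP.nb2 hG hx
    rw [← Finset.filter_filter, e]
    have hle : (Finset.filter (fun U => ∀ i ∈ U, c (v i) ≤ c (v x)) ({{x, a}, {x, b}} : Finset (Finset ι))).card ≤ 2 :=
      (Finset.card_filter_le _ _).trans Finset.card_le_two
    have na : c (v a) ≠ c (v x) := fun e => hax (hc _ _ e)
    have nb : c (v b) ≠ c (v x) := fun e => hbx (hc _ _ e)
    have one : ∀ a b : ι, c (v x) < c (v b) → (Finset.filter (fun U => ∀ i ∈ U, c (v i) ≤ c (v x))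
        ({{x, a}, {x, b}} : Finset (Finset ι))) ⊆ {{x, a}} := by
      intro a b hb U hU
      simp only [Finset.mem_filter, Finset.mem_insert, Finset.mem_singleton] at hU ⊢
      rcases hU.1 with h | h
      · exact h
      · exact absurd (hU.2 b (by simp [h])) (not_le.2 hb)
    rcases lt_or_gt_of_ne na with la | la <;> rcases lt_or_gt_of_ne nb with lb | lb
    · rw [if_pos (hP.top3 hG hx ha hb hax hbx hab ea eb c la lb)]
      omega
    · rw [if_pos (⟨a, ha, b, hb, la, lb⟩ : ∃ a ∈ G, ∃ b ∈ G, c (v a) < c (v x) ∧ c (v x) < c (v b))]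
      have := Finset.card_le_card (one a b lb)
      simp only [Finset.card_singleton] at this
      omega
    · rw [if_pos (⟨b, hb, a, ha, lb, la⟩ : ∃ a ∈ G, ∃ b ∈ G, c (v a) < c (v x) ∧ c (v x) < c (v b))]
      rw [Finset.pair_comm]
      have := Finset.card_le_card (one b a la)
      simp only [Finset.card_singleton] at this
      omega
    · have : (Finset.filter (fun U => ∀ i ∈ U, c (v i) ≤ c (v x)) ({{x, a}, {x, b}} : Finset (Finset ι))) = ∅ := by
        rw [Finset.filter_eq_empty_iff]
        intro U hU h
        simp only [Finset.mem_insert, Finset.mem_singleton] at hU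
        rcases hU with h' | h'
        · exact absurd (h a (by simp [h'])) (not_le.2 la)
        · exact absurd (h b (by simp [h'])) (not_le.2 lb)
      rw [this]
      simp
  have h4 := Finset.sum_le_sum h3
  rw [h1, Finset.sum_add_distrib, ← Finset.card_filter, ← Finset.sum_filter, Finset.sum_const, smul_eq_mul] at h4
  have h5 : (G.filter fun x => ∀ i ∈ G, c (v i) ≤ c (v x)).card ≤ 1 := by
    rw [Finset.card_le_one]
    intro x hx y hy
    rw [Finset.mem_filter] at hx hy
    exact hc _ _ (le_antisymm (hy.2 x hx.1) (hx.2 y hy.1))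
  omega

open Classical in
theorem PolyW.euler (hP : PolyW v) {F : Finset ι} (hF : F ∈ fc v 4) :
    (sub v 2 F).card + 2 ≤ (sub v 3 F).card + F.card := by
  obtain ⟨c, hc⟩ := hP.generic
  have h4 := card_ge hF
  have h1 : ∑ G ∈ sub v 3 F, G.card ≤ ∑ G ∈ sub v 3 F, (2 +
      (F.filter fun x => x ∈ G ∧ ∃ a ∈ G, ∃ b ∈ G, c (v a) < c (v x) ∧ c (v x) < c (v b)).card) := by
    refine Finset.sum_le_sum fun G hG => ?_
    rw [mem_sub] at hG
    refine (hP.card_le3 c hc hG.1).trans (Nat.add_le_add_left (Finset.card_le_card ?_) _)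
    intro x hx
    rw [Finset.mem_filter] at hx ⊢
    exact ⟨hG.2 hx.1, hx⟩
  rw [hP.sum3 hF, Finset.sum_add_distrib, ← dcount F (sub v 3 F)] at h1
  have hne : F.Nonempty := Finset.card_pos.1 (by omega)
  obtain ⟨t, ht, htop⟩ := Finset.exists_max_image F (fun i => c (v i)) hne
  obtain ⟨b, hb, hbot⟩ := Finset.exists_min_image F (fun i => c (v i)) hne
  have htb : t ≠ b := by
    rintro rfl
    have : F ⊆ {t} := fun i hi => Finset.mem_singleton.2 (hc _ _ (le_antisymm (htop i hi) (hbot i hi)))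
    have := Finset.card_le_card this
    simp at this
    omega
  have h2 : ∀ x ∈ F, ((sub v 3 F).filter fun G => x ∈ G ∧ ∃ a ∈ G, ∃ b ∈ G, c (v a) < c (v x) ∧ c (v x) < c (v b)).card ≤
      if x ∈ F \ {t, b} then 2 else 0 := by
    intro x hx
    split_ifs with hxt
    · by_contra hlt
      obtain ⟨A, hA, B, hB, C, hC, hAB, hAC, hBC⟩ := Finset.two_lt_card.1 (not_le.1 hlt)
      rw [Finset.mem_filter, mem_sub] at hA hB hC
      obtain ⟨j, k, hjk, e⟩ := hP.cross hF c x hx ![A, B, C] (by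
        intro j
        fin_cases j
        exacts [⟨hA.1.1, hA.1.2, hA.2⟩, ⟨hB.1.1, hB.1.2, hB.2⟩, ⟨hC.1.1, hC.1.2, hC.2⟩])
      fin_cases j <;> fin_cases k <;> simp_all
    · simp only [Finset.mem_sdiff, hx, true_and, not_not, Finset.mem_insert, Finset.mem_singleton] at hxt
      rw [Nat.le_zero, Finset.card_eq_zero, Finset.filter_eq_empty_iff]
      rintro G hG ⟨-, p, hp, q, hq, h3, h4⟩
      rw [mem_sub] at hG
      rcases hxt with rfl | rfl
      · exact absurd (htop q (hG.2 hq)) (not_le.2 h4)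
      · exact absurd (hbot p (hG.2 hp)) (not_le.2 h3)
  have h3 := Finset.sum_le_sum h2
  rw [← Finset.sum_filter, Finset.sum_const, Finset.filter_mem_eq_inter, Finset.inter_eq_right.2 Finset.sdiff_subset,
    Finset.card_sdiff_of_subset (by intro i hi; simp at hi; rcases hi with rfl | rfl <;> assumption),
    Finset.card_pair htb] at h3
  simp only [Finset.sum_const, smul_eq_mul] at h1 h3
  omega

end Euler

/-! ## Counting -/

section Counting

variable {ι : Type} [Fintype ι] [DecidableEq ι] {W : Type} [AddCommGroup W] [Module ℝ W]
  [FiniteDimensional ℝ W] {v : ι → W}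

structure Cnt (v : ι → W) : Prop extends PolyW v where
  c1 : Fintype.card ι = 10
  c2 : (fc v 2).card = 33
  c3 : (fc v 3).card = 35
  c4 : (fc v 4).card = 12

theorem PolyW.wsum (hP : PolyW v) (w : Finset ι → ℕ) :
    ∑ F ∈ fc v 4, ∑ G ∈ sub v 3 F, w G = 2 * ∑ G ∈ fc v 3, w G := by
  simp only [sub, Finset.sum_filter]
  rw [Finset.sum_comm, Finset.mul_sum]
  refine Finset.sum_congr rfl fun G hG => ?_
  rw [← Finset.sum_filter, Finset.sum_const, hP.tri2 hG, smul_eq_mul]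

/-- the non-edges -/
noncomputable def NE (v : ι → W) : Finset (Finset ι) := (Finset.univ.powersetCard 2).filter fun p => p ∉ fc v 2

theorem mem_NE {p : Finset ι} : p ∈ NE v ↔ p.card = 2 ∧ p ∉ fc v 2 := by
  simp [NE, Finset.mem_powersetCard]

noncomputable def ne (v : ι → W) (F : Finset ι) : ℕ := ((NE v).filter fun p => p ⊆ F).card

theorem PolyW.choose2 (hP : PolyW v) (F : Finset ι) : F.card.choose 2 = (sub v 2 F).card + ne v F := by
  rw [← Finset.card_powersetCard, ne, sub, ← Finset.card_union_of_disjoint]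
  · congr 1
    ext p
    simp only [Finset.mem_powersetCard, Finset.mem_union, Finset.mem_filter, mem_NE]
    have := fun h => hP.card2 (S := p) h
    tauto
  · rw [Finset.disjoint_left]
    intro p h1 h2
    rw [Finset.mem_filter] at h1 h2
    exact (mem_NE.1 h2.1).2 h1.1

theorem Cnt.NE_card (hC : Cnt v) : (NE v).card = 12 := by
  have h := hC.choose2 Finset.univ
  have h1 : sub v 2 Finset.univ = fc v 2 := by ext; simp [mem_sub]
  have h2 : ne v Finset.univ = (NE v).card := by simp [ne]
  rw [h1, h2, hC.c2, Finset.card_univ, hC.c1] at h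
  simp [Nat.choose] at h
  omega

theorem PolyW.big (hP : PolyW v) {S p : Finset ι} (hS : CFace v S) (hp : p ∈ NE v) (h : p ⊆ S) : 3 ≤ crk v S := by
  by_contra hc
  rw [mem_NE] at hp
  have h1 := Finset.card_le_card h
  have h2 := hP.small hS (by omega)
  have e : p = S := Finset.eq_of_subset_of_card_le h (by omega)
  subst e
  apply hp.2
  rw [mem_fc]
  refine ⟨hS, ?_⟩
  have := crk_le_card (v := v) p
  rcases Nat.lt_or_ge (crk v p) 1 with h3 | h3
  · obtain ⟨i, hi⟩ := Finset.card_pos.1 (by omega : 0 < p.card)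
    have := crk_mono (v := v) (Finset.singleton_subset_iff.2 hi)
    rw [(mem_fc.1 (hP.single i)).2] at this
    omega
  · by_contra h4
    obtain ⟨i, hi⟩ := hP.card1 (mem_fc.2 ⟨hS, by omega⟩)
    rw [hi] at hp
    simp at hp

theorem PolyW.Gp (hP : PolyW v) {p G G' : Finset ι} (hp : p ∈ NE v) (hG : G ∈ fc v 3) (hG' : G' ∈ fc v 3)
    (h : p ⊆ G) (h' : p ⊆ G') : G = G' := by
  by_contra hne
  have h1 := fc_inter hG hG' hne
  have := hP.big h1.1 hp (Finset.subset_inter h h')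
  omega

theorem PolyW.FF (hP : PolyW v) {p F F' : Finset ι} (hp : p ∈ NE v) (hF : F ∈ fc v 4) (hF' : F' ∈ fc v 4)
    (h : p ⊆ F) (h' : p ⊆ F') (hne : F ≠ F') : F ∩ F' ∈ fc v 3 := by
  have h1 := fc_inter hF hF' hne
  have := hP.big h1.1 hp (Finset.subset_inter h h')
  exact mem_fc.2 ⟨h1.1, by omega⟩

theorem PolyW.Fp (hP : PolyW v) {p : Finset ι} (hp : p ∈ NE v) :
    ((fc v 4).filter fun F => p ⊆ F).card ≤ ((fc v 3).filter fun G => p ⊆ G).card + 1 := by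
  by_cases h : ((fc v 4).filter fun F => p ⊆ F).card ≤ 1
  · omega
  obtain ⟨A, hA, B, hB, hAB⟩ := Finset.one_lt_card.1 (not_le.1 h)
  rw [Finset.mem_filter] at hA hB
  have hG := hP.FF hp hA.1 hB.1 hA.2 hB.2 hAB
  have h1 : 0 < ((fc v 3).filter fun G => p ⊆ G).card :=
    Finset.card_pos.2 ⟨A ∩ B, Finset.mem_filter.2 ⟨hG, Finset.subset_inter hA.2 hB.2⟩⟩
  have h2 : ((fc v 4).filter fun F => p ⊆ F) ⊆ ((fc v 4).filter fun F => A ∩ B ⊆ F) := by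
    intro F hF
    rw [Finset.mem_filter] at hF ⊢
    refine ⟨hF.1, ?_⟩
    by_cases e : F = A
    · rw [e]; exact Finset.inter_subset_left
    · have hG' := hP.FF hp hF.1 hA.1 hF.2 hA.2 e
      rw [hP.Gp hp hG hG' (Finset.subset_inter hA.2 hB.2) (Finset.subset_inter hF.2 hA.2)]
      exact Finset.inter_subset_left
  have h3 := Finset.card_le_card h2
  rw [hP.tri2 hG] at h3
  omega

theorem Cnt.sumN (hC : Cnt v) : ∑ F ∈ fc v 4, ne v F ≤ ∑ G ∈ fc v 3, ne v G + 12 := by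
  have h1 := dcount (fc v 4) (NE v) fun F p => p ⊆ F
  have h2 := dcount (fc v 3) (NE v) fun F p => p ⊆ F
  unfold ne
  rw [h1, h2, ← hC.NE_card, Finset.card_eq_sum_ones, ← Finset.sum_add_distrib]
  exact Finset.sum_le_sum fun p hp => hC.Fp hp

theorem PolyW.sumsub (hP : PolyW v) {F : Finset ι} : ∑ G ∈ sub v 3 F, ne v G ≤ ne v F := by
  have h1 := dcount (sub v 3 F) (NE v) fun F p => p ⊆ F
  unfold ne
  rw [h1, Finset.card_filter]
  refine Finset.sum_le_sum fun p hp => ?_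
  split_ifs with h
  · rw [Finset.card_le_one]
    intro A hA B hB
    rw [Finset.mem_filter, mem_sub] at hA hB
    exact hP.Gp hp hA.1.1 hB.1.1 hA.2 hB.2
  · rw [Nat.le_zero, Finset.card_eq_zero, Finset.filter_eq_empty_iff]
    intro G hG h'
    rw [mem_sub] at hG
    exact h (h'.trans hG.2)

/-- excess of a facet -/
noncomputable def sg (v : ι → W) (F : Finset ι) : ℕ := ∑ G ∈ sub v 3 F, (G.card - 3)

theorem PolyW.sg_eq (hP : PolyW v) {F : Finset ι} (hF : F ∈ fc v 4) :
    sg v F + 3 * (sub v 3 F).card = 2 * (sub v 2 F).card := by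
  rw [← hP.sum3 hF, sg, Finset.card_eq_sum_ones, Finset.mul_sum, ← Finset.sum_add_distrib]
  refine Finset.sum_congr rfl fun G hG => ?_
  have := card_ge (mem_sub.1 hG).1
  omega

theorem PolyW.e_le (hP : PolyW v) {F : Finset ι} (hF : F ∈ fc v 4) :
    (sub v 2 F).card + 6 + sg v F ≤ 3 * F.card := by
  have h1 := hP.sg_eq hF
  have h2 := hP.euler hF
  omega

theorem PolyW.ne_tri (hP : PolyW v) {G : Finset ι} (hG : G ∈ fc v 3) (h : G.card = 3) : ne v G = 0 := by
  have h1 := hP.choose2 G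
  rw [hP.edges3 hG, h] at h1
  simp [Nat.choose] at h1
  omega

theorem PolyW.sg_zero (hP : PolyW v) {F : Finset ι} (h : sg v F = 0) : ∑ G ∈ sub v 3 F, ne v G = 0 := by
  rw [sg, Finset.sum_eq_zero_iff] at h
  rw [Finset.sum_eq_zero_iff]
  intro G hG
  have h1 := h G hG
  have h2 := card_ge (mem_sub.1 hG).1
  exact hP.ne_tri (mem_sub.1 hG).1 (by omega)

theorem Cnt.n_le (hC : Cnt v) (F : Finset ι) : F.card ≤ 10 := hC.c1 ▸ Finset.card_le_univ F

theorem Cnt.two_ne (hC : Cnt v) {F : Finset ι} (hF : F ∈ fc v 4) :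
    ∑ G ∈ sub v 3 F, ne v G + 2 * F.card ≤ 2 * ne v F + 8 := by
  have h1 := hC.choose2 F
  have h2 := hC.e_le hF
  have h3 := hC.sumsub (F := F)
  have h4 := card_ge hF
  have h5 := hC.n_le F
  have h6 := hC.sg_zero (F := F)
  generalize F.card = n at *
  interval_cases n <;> simp [Nat.choose] at h1
  · omega
  · by_cases h : sg v F = 0
    · rw [h6 h]; omega
    · omega
  · by_cases h : sg v F = 0
    · rw [h6 h]; omega
    · omega
  all_goals omega

theorem Cnt.f03 (hC : Cnt v) : ∑ F ∈ fc v 4, F.card ≤ 60 := by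
  have h1 := Finset.sum_le_sum fun F hF => hC.two_ne (F := F) hF
  have h2 := hC.sumN
  rw [Finset.sum_add_distrib, Finset.sum_add_distrib, hC.wsum, ← Finset.mul_sum, ← Finset.mul_sum,
    Finset.sum_const, hC.c4] at h1
  simp at h1
  omega

theorem Cnt.sum_e (hC : Cnt v) : ∑ F ∈ fc v 4, (sub v 2 F).card = 105 + ∑ G ∈ fc v 3, (G.card - 3) := by
  have h1 := Finset.sum_congr rfl fun F hF => hC.sg_eq (F := F) hF
  have h2 := hC.wsum (fun _ => 1)
  rw [Finset.sum_add_distrib, ← Finset.mul_sum, ← Finset.mul_sum] at h1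
  unfold sg at h1
  rw [hC.wsum] at h1
  simp only [Finset.sum_const, smul_eq_mul, mul_one, hC.c3] at h2
  omega

theorem Cnt.sum_sg (hC : Cnt v) : ∑ F ∈ fc v 4, sg v F = 2 * ∑ G ∈ fc v 3, (G.card - 3) := hC.wsum _

theorem Cnt.s_le (hC : Cnt v) : 59 + ∑ G ∈ fc v 3, (G.card - 3) ≤ ∑ F ∈ fc v 4, F.card := by
  have h1 := Finset.sum_le_sum fun F hF => hC.e_le (F := F) hF
  rw [Finset.sum_add_distrib, Finset.sum_add_distrib, hC.sum_sg, hC.sum_e, ← Finset.mul_sum, Finset.sum_const, hC.c4] at h1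
  simp at h1
  omega

theorem eq_of_sum {α : Type} {A : Finset α} {f g : α → ℕ} (h : ∀ a ∈ A, f a ≤ g a) (hs : ∑ a ∈ A, g a ≤ ∑ a ∈ A, f a) :
    ∀ a ∈ A, f a = g a :=
  (Finset.sum_eq_sum_iff_of_le h).1 (le_antisymm (Finset.sum_le_sum h) hs)

theorem Cnt.sumC (hC : Cnt v) : ∑ F ∈ fc v 4, F.card.choose 2 = ∑ F ∈ fc v 4, (sub v 2 F).card + ∑ F ∈ fc v 4, ne v F := by
  rw [← Finset.sum_add_distrib]
  exact Finset.sum_congr rfl fun F _ => hC.choose2 F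

theorem Cnt.ch (hC : Cnt v) {F : Finset ι} : 4 * F.card ≤ F.card.choose 2 + 10 := by
  have h5 := hC.n_le F
  generalize F.card = n at *
  interval_cases n <;> simp [Nat.choose]

theorem Cnt.cases (hC : Cnt v) :
    ((∀ G ∈ fc v 3, G.card = 3) ∧ (∀ F ∈ fc v 4, (sub v 2 F).card + 6 = 3 * F.card) ∧
      ((∃ F0 ∈ fc v 4, F0.card = 4 ∧ ∀ F ∈ fc v 4, F ≠ F0 → F.card = 5) ∨
       (∃ F0 ∈ fc v 4, F0.card = 6 ∧ (∀ F ∈ fc v 4, F ≠ F0 → F.card = 4 ∨ F.card = 5) ∧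
        ((fc v 4).filter fun F => F.card = 4).card = 2))) ∨
    (∃ G0 ∈ fc v 3, G0.card = 4 ∧ (∀ G ∈ fc v 3, G ≠ G0 → G.card = 3) ∧ (∀ F ∈ fc v 4, F.card = 5) ∧
      ∀ F ∈ fc v 4, (sub v 2 F).card + (if G0 ⊆ F then 1 else 0) = 9) := by
  have hf := hC.f03
  have hs := hC.s_le
  have he := hC.sum_e
  have hsg := hC.sum_sg
  have hN := hC.sumN
  have hcc := hC.sumC
  have h3 : ∀ G ∈ fc v 3, 3 ≤ G.card := fun G hG => card_ge hG
  have h4 : ∀ F ∈ fc v 4, 4 ≤ F.card := fun G hG => card_ge hG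
  have hch := Finset.sum_le_sum fun F (_ : F ∈ fc v 4) => hC.ch (F := F)
  rw [Finset.sum_add_distrib, ← Finset.mul_sum, Finset.sum_const, hC.c4] at hch
  simp only [smul_eq_mul] at hch
  by_cases hs0 : ∑ G ∈ fc v 3, (G.card - 3) = 0
  · left
    have hG3 : ∀ G ∈ fc v 3, G.card = 3 := by
      intro G hG
      have := Finset.sum_eq_zero_iff.1 hs0 G hG
      have := h3 G hG
      omega
    have hz : ∑ G ∈ fc v 3, ne v G = 0 := Finset.sum_eq_zero fun G hG => hC.ne_tri hG (hG3 G hG)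
    have hfe : ∑ F ∈ fc v 4, F.card = 59 := by omega
    have hee : ∀ F ∈ fc v 4, (sub v 2 F).card + 6 = 3 * F.card := by
      refine eq_of_sum (fun F hF => ?_) ?_
      · have := hC.e_le hF; omega
      · rw [← Finset.mul_sum, Finset.sum_add_distrib, hfe, he, Finset.sum_const, hC.c4]; simp
    refine ⟨hG3, hee, ?_⟩
    -- at most one facet with six vertices
    have hx : ∀ F ∈ fc v 4, F.card - 4 + (if F.card = 4 ∨ F.card = 5 then 0 else 1) + (if F.card ≤ 6 then 0 else 1) ≤ ne v F := by
      intro F hF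
      have h1 := hC.choose2 F
      have h2 := hee F hF
      have h5 := hC.n_le F
      have h6 := h4 F hF
      generalize F.card = n at *
      interval_cases n <;> simp [Nat.choose] at h1 ⊢ <;> omega
    have hx1 := Finset.sum_le_sum hx
    have hx2 : ∑ F ∈ fc v 4, (F.card - 4) = 11 := by
      have : ∑ F ∈ fc v 4, (F.card - 4) + ∑ F ∈ fc v 4, 4 = ∑ F ∈ fc v 4, F.card := by
        rw [← Finset.sum_add_distrib]
        refine Finset.sum_congr rfl fun F hF => ?_
        have := h4 F hF
        omega
      rw [Finset.sum_const, hC.c4, hfe] at this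
      simp at this
      omega
    rw [Finset.sum_add_distrib, Finset.sum_add_distrib, hx2] at hx1
    by_cases hall : ∀ F ∈ fc v 4, F.card = 4 ∨ F.card = 5
    · left
      have e1 : ∑ F ∈ fc v 4, (F.card - 4) + ∑ F ∈ fc v 4, (if F.card = 4 then 1 else 0) = ∑ F ∈ fc v 4, 1 := by
        rw [← Finset.sum_add_distrib]
        refine Finset.sum_congr rfl fun F hF => ?_
        rcases hall F hF with h | h <;> simp [h]
      rw [hx2, ← Finset.card_filter, Finset.sum_const, hC.c4] at e1
      obtain ⟨F0, hF0⟩ := Finset.card_eq_one.1 (by simp at e1; omega : ((fc v 4).filter fun F => F.card = 4).card = 1)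
      have m0 : F0 ∈ (fc v 4).filter fun F => F.card = 4 := by rw [hF0]; simp
      rw [Finset.mem_filter] at m0
      refine ⟨F0, m0.1, m0.2, fun F hF hne => ?_⟩
      rcases hall F hF with h | h
      · exfalso
        have : F ∈ (fc v 4).filter fun F => F.card = 4 := Finset.mem_filter.2 ⟨hF, h⟩
        rw [hF0] at this
        exact hne (by simpa using this)
      · exact h
    · right
      push Not at hall
      obtain ⟨F0, hF0, hne4, hne5⟩ := hall
      have l1 : ∀ F ∈ fc v 4, F ≠ F0 → F.card = 4 ∨ F.card = 5 := by
        intro F hF hne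
        by_contra hc
        have : ∑ F ∈ {F, F0}, (if F.card = 4 ∨ F.card = 5 then 0 else 1) ≤ ∑ F ∈ fc v 4, (if F.card = 4 ∨ F.card = 5 then 0 else 1) := by
          apply Finset.sum_le_sum_of_subset
          intro A hA
          simp at hA
          rcases hA with rfl | rfl <;> assumption
        rw [Finset.sum_pair hne, if_neg hc, if_neg (by tauto)] at this
        omega
      have l2 : F0.card ≤ 6 := by
        by_contra hc
        have a1 := Finset.single_le_sum (f := fun F => if F.card = 4 ∨ F.card = 5 then 0 else 1) (fun _ _ => Nat.zero_le _) hF0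
        have a2 := Finset.single_le_sum (f := fun F : Finset ι => if F.card ≤ 6 then 0 else 1) (fun _ _ => Nat.zero_le _) hF0
        simp only [if_neg hc] at a2
        rw [if_neg (by tauto)] at a1
        omega
      have l3 : F0.card = 6 := by have := h4 F0 hF0; omega
      refine ⟨F0, hF0, l3, l1, ?_⟩
      have e1 : ∑ F ∈ fc v 4, (F.card - 4) + ∑ F ∈ fc v 4, (if F.card = 4 then 1 else 0) =
          ∑ F ∈ fc v 4, (1 + if F = F0 then 1 else 0) := by
        rw [← Finset.sum_add_distrib]
        refine Finset.sum_congr rfl fun F hF => ?_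
        by_cases e : F = F0
        · subst e; simp [l3]
        · rcases l1 F hF e with h | h <;> simp [h, e]
      rw [hx2, ← Finset.card_filter, Finset.sum_add_distrib, Finset.sum_const, hC.c4, Finset.sum_ite_eq', if_pos hF0] at e1
      simp at e1
      omega
  · right
    have hs1 : ∑ G ∈ fc v 3, (G.card - 3) = 1 := by omega
    obtain ⟨G0, hG0, hG0'⟩ : ∃ G0 ∈ fc v 3, G0.card - 3 ≠ 0 := by
      by_contra hc
      push Not at hc
      exact hs0 (Finset.sum_eq_zero hc)
    have hsplit := Finset.add_sum_erase (fc v 3) (fun G => G.card - 3) hG0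
    simp only [hs1] at hsplit
    have hG4 : G0.card = 4 := by omega
    have hG3 : ∀ G ∈ fc v 3, G ≠ G0 → G.card = 3 := by
      intro G hG hne
      have h0 : ∑ G ∈ (fc v 3).erase G0, (G.card - 3) = 0 := by omega
      have := Finset.sum_eq_zero_iff.1 h0 G (Finset.mem_erase.2 ⟨hne, hG⟩)
      have := h3 G hG
      omega
    have hz : ∑ G ∈ fc v 3, ne v G = 2 := by
      rw [← Finset.add_sum_erase (fc v 3) _ hG0, Finset.sum_eq_zero]
      · have h1 := hC.choose2 G0
        rw [hC.edges3 hG0, hG4] at h1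
        simp [Nat.choose] at h1
        omega
      · intro G hG
        rw [Finset.mem_erase] at hG
        exact hC.ne_tri hG.2 (hG3 G hG.2 hG.1)
    have hfe : ∑ F ∈ fc v 4, F.card = 60 := by omega
    have h45 : ∀ F ∈ fc v 4, 4 * F.card = F.card.choose 2 + 10 := by
      refine eq_of_sum (fun F hF => hC.ch) ?_
      rw [Finset.sum_add_distrib, ← Finset.mul_sum, Finset.sum_const, hC.c4]
      simp only [smul_eq_mul]
      omega
    have h5 : ∀ F ∈ fc v 4, F.card ≤ 5 := by
      intro F hF
      have h1 := h45 F hF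
      have h5 := hC.n_le F
      generalize F.card = n at *
      interval_cases n <;> simp [Nat.choose] at h1 ⊢
    have h5' : ∀ F ∈ fc v 4, F.card = 5 := by
      refine eq_of_sum h5 ?_
      rw [hfe, Finset.sum_const, hC.c4]; simp
    refine ⟨G0, hG0, hG4, hG3, h5', ?_⟩
    have hee : ∀ F ∈ fc v 4, (sub v 2 F).card + 6 + sg v F = 3 * F.card := by
      refine eq_of_sum (fun F hF => hC.e_le hF) ?_
      rw [← Finset.mul_sum, Finset.sum_add_distrib, Finset.sum_add_distrib, hfe, he, hsg, hs1, Finset.sum_const, hC.c4]; simp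
    intro F hF
    have h1 := hee F hF
    rw [h5' F hF] at h1
    have h2 : sg v F = if G0 ⊆ F then 1 else 0 := by
      have h0 : ∀ G ∈ sub v 3 F, G.card - 3 = if G = G0 then 1 else 0 := by
        intro G hG
        split_ifs with e
        · rw [e, hG4]
        · rw [hG3 G (mem_sub.1 hG).1 e]
      rw [sg, Finset.sum_congr rfl h0, Finset.sum_ite_eq']
      simp [mem_sub, hG0]
    rw [h2] at h1
    omega

end Counting

/-! ## Shapes of the facets -/

section Shapes

variable {ι : Type} [Fintype ι] [DecidableEq ι] {W : Type} [AddCommGroup W] [Module ℝ W]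
  [FiniteDimensional ℝ W] {v : ι → W}

def AllTri (v : ι → W) (F : Finset ι) : Prop := F ∈ fc v 4 ∧ ∀ G ∈ fc v 3, G ⊆ F → G.card = 3

theorem not_edge {x y : ι} (hxy : x ≠ y) : {x, y} ∉ fc v 2 ↔ {x, y} ∈ NE v := by
  rw [mem_NE, Finset.card_pair hxy]; simp

theorem PolyW.tri_edge (hP : PolyW v) {T p : Finset ι} (hT : T ∈ fc v 3) (h3 : T.card = 3) (hp : p ⊆ T)
    (h2 : p.card = 2) : p ∈ fc v 2 := by
  by_contra h
  have h1 := hP.ne_tri hT h3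
  rw [ne, Finset.card_eq_zero, Finset.filter_eq_empty_iff] at h1
  exact h1 (mem_NE.2 ⟨h2, h⟩) hp

theorem PolyW.tri_xyz (hP : PolyW v) {x y z : ι} (hT : {x, y, z} ∈ fc v 3) :
    x ≠ y ∧ x ≠ z ∧ y ≠ z ∧ {x, y} ∈ fc v 2 ∧ {x, z} ∈ fc v 2 ∧ {y, z} ∈ fc v 2 := by
  have h3 := card_ge hT
  have h3' : ({x, y, z} : Finset ι).card = 3 := le_antisymm Finset.card_le_three h3
  have hxy : x ≠ y := by
    rintro rfl; rw [Finset.insert_eq_of_mem (by simp)] at h3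
    have := Finset.card_le_two (a := x) (b := z); omega
  have hxz : x ≠ z := by
    rintro rfl; rw [Finset.insert_eq_of_mem (by simp)] at h3
    have := Finset.card_le_two (a := y) (b := x); omega
  have hyz : y ≠ z := by
    rintro rfl; rw [Finset.pair_eq_singleton] at h3
    have := Finset.card_le_two (a := x) (b := y); omega
  refine ⟨hxy, hxz, hyz, hP.tri_edge hT h3' ?_ (Finset.card_pair hxy), hP.tri_edge hT h3' ?_ (Finset.card_pair hxz),
    hP.tri_edge hT h3' ?_ (Finset.card_pair hyz)⟩ <;> intro i hi <;> simp at hi ⊢ <;> tauto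

/-- the link of an edge inside a facet -/
theorem AllTri.link (hP : PolyW v) {F : Finset ι} (hF : AllTri v F) {x y : ι} (hE : {x, y} ∈ fc v 2)
    (hx : x ∈ F) (hy : y ∈ F) : (F.filter fun z => {x, y, z} ∈ fc v 3).card = 2 := by
  have hxy : x ≠ y := by
    rintro rfl; have := hP.card2 hE; simp at this
  have h := edge4 hF.1 (mem_sub.2 ⟨hE, by intro i hi; simp at hi; rcases hi with rfl | rfl <;> assumption⟩)
  rw [← h]
  have : ((sub v 3 F).filter fun G => {x, y} ⊆ G) = (F.filter fun z => {x, y, z} ∈ fc v 3).image fun z => {x, y, z} := by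
    ext G
    simp only [Finset.mem_filter, mem_sub, Finset.mem_image]
    constructor
    · rintro ⟨⟨h1, h2⟩, h3⟩
      have h4 := hF.2 G h1 h2
      obtain ⟨z, hz⟩ : ∃ z, G \ {x, y} = {z} := by
        rw [← Finset.card_eq_one, Finset.card_sdiff_of_subset h3, h4, Finset.card_pair hxy]
      have e : {x, y, z} = G := by
        rw [← Finset.union_sdiff_of_subset h3, hz]
        ext i; simp
      have hzG : z ∈ G := by rw [← e]; simp
      exact ⟨z, ⟨h2 hzG, by rw [e]; exact h1⟩, e⟩
    · rintro ⟨z, ⟨hz, hT⟩, rfl⟩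
      refine ⟨⟨hT, ?_⟩, ?_⟩
      · intro i hi; simp at hi; rcases hi with rfl | rfl | rfl <;> assumption
      · intro i hi; simp at hi ⊢; tauto
  rw [this, Finset.card_image_of_injOn]
  intro z hz w hw e
  simp only [Finset.coe_filter, Set.mem_ofPred_eq] at hz hw
  have h1 := hP.tri_xyz hz.2
  have h2 : z ∈ ({x, y, w} : Finset ι) := by
    have : ({x, y, z} : Finset ι) = {x, y, w} := e
    rw [← this]; simp
  simp only [Finset.mem_insert, Finset.mem_singleton] at h2
  rcases h2 with h2 | h2 | h2
  · exact absurd h2.symm h1.2.1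
  · exact absurd h2.symm h1.2.2.1
  · exact h2

theorem AllTri.lk2 (hP : PolyW v) {F : Finset ι} (hF : AllTri v F) {x y : ι} (hE : {x, y} ∈ fc v 2)
    (hx : x ∈ F) (hy : y ∈ F) (s t : ι)
    (H : ∀ z ∈ F, z ≠ x → z ≠ y → {x, z} ∈ fc v 2 → {y, z} ∈ fc v 2 → z = s ∨ z = t) :
    {x, y, s} ∈ fc v 3 ∧ {x, y, t} ∈ fc v 3 ∧ s ≠ t := by
  have h := hF.link hP hE hx hy
  have hsub : (F.filter fun z => {x, y, z} ∈ fc v 3) ⊆ {s, t} := by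
    intro z hz
    rw [Finset.mem_filter] at hz
    obtain ⟨_, h2, h3, _, h5, h6⟩ := hP.tri_xyz hz.2
    have := H z hz.1 h2.symm h3.symm h5 h6
    simpa using this
  have hc : ({s, t} : Finset ι).card ≤ 2 := Finset.card_le_two
  have e := Finset.eq_of_subset_of_card_le hsub (by omega)
  have hst : s ≠ t := by
    rintro rfl
    rw [e] at h; simp at h
  have m1 : s ∈ (F.filter fun z => {x, y, z} ∈ fc v 3) := by rw [e]; simp
  have m2 : t ∈ (F.filter fun z => {x, y, z} ∈ fc v 3) := by rw [e]; simp
  rw [Finset.mem_filter] at m1 m2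
  exact ⟨m1.2, m2.2, hst⟩

theorem AllTri.lk3 (hP : PolyW v) {F : Finset ι} (hF : AllTri v F) {x y a b c : ι}
    (hx : x ∈ F) (hy : y ∈ F) (ha : a ∈ F) (hb : b ∈ F) (hc : c ∈ F) (ta : {x, y, a} ∈ fc v 3)
    (tb : {x, y, b} ∈ fc v 3) (tc : {x, y, c} ∈ fc v 3) (hab : a ≠ b) (hac : a ≠ c) (hbc : b ≠ c) : False := by
  have h := hF.link hP (hP.tri_xyz ta).2.2.2.1 hx hy
  have : ({a, b, c} : Finset ι) ⊆ (F.filter fun z => {x, y, z} ∈ fc v 3) := by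
    intro i hi
    rw [Finset.mem_filter]
    simp only [Finset.mem_insert, Finset.mem_singleton] at hi
    rcases hi with rfl | rfl | rfl
    exacts [⟨ha, ta⟩, ⟨hb, tb⟩, ⟨hc, tc⟩]
  have h2 := Finset.card_le_card this
  rw [Finset.card_eq_three.2 ⟨_, _, _, hab, hac, hbc, rfl⟩] at h2
  omega

theorem AllTri.apex (hP : PolyW v) {F : Finset ι} (hF : AllTri v F) {s p q r : ι}
    (hs : s ∈ F) (hp : p ∈ F) (hq : q ∈ F) (ep : {s, p} ∈ fc v 2) (eq : {s, q} ∈ fc v 2)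
    (cov : ∀ z ∈ F, z ≠ s → {s, z} ∈ fc v 2 → z = p ∨ z = q ∨ z = r) :
    {s, p, q} ∈ fc v 3 ∧ {s, p, r} ∈ fc v 3 ∧ {s, q, r} ∈ fc v 3 := by
  have h1 := hF.lk2 hP ep hs hp q r fun z hz h1 h2 h3 _ => (cov z hz h1 h3).resolve_left h2
  have h2 := hF.lk2 hP eq hs hq p r fun z hz h1 h2 h3 _ => (cov z hz h1 h3).elim Or.inl
    fun h => Or.inr (h.resolve_left h2)
  exact ⟨h1.1, h1.2.1, h2.2.1⟩

def TriP (v : ι → W) (T : Finset ι) : Prop := T ∈ fc v 3 ∧ T.card = 3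

theorem AllTri.ne_clause (hP : PolyW v) {F : Finset ι} (hF : AllTri v F) {f : Finset ι} (hf : f ∈ NE v) (h : f ⊆ F) :
    (∀ G, G ∈ fc v 4 → f ⊆ G → G = F) ∧ ∀ T, TriP v T → T ⊆ F → ¬ f ⊆ T := by
  have key : ∀ T ∈ fc v 3, T ⊆ F → ¬ f ⊆ T := fun T hT hTF hfT =>
    (mem_NE.1 hf).2 (hP.tri_edge hT (hF.2 T hT hTF) hfT (mem_NE.1 hf).1)
  refine ⟨fun G hG hfG => ?_, fun T hT hTF => key T hT.1 hTF⟩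
  by_contra hne
  exact key _ (hP.FF hf hF.1 hG h hfG (Ne.symm hne)) Finset.inter_subset_left (Finset.subset_inter h hfG)

theorem PolyW.FF3 (hP : PolyW v) {f F G : Finset ι} (hF : F ∈ fc v 4) (hG : G ∈ fc v 4) (hne : F ≠ G) (h3 : 3 ≤ f.card)
    (h : f ⊆ F) (h' : f ⊆ G) : F ∩ G ∈ fc v 3 := by
  have h1 := fc_inter hF hG hne
  refine mem_fc.2 ⟨h1.1, ?_⟩
  by_contra hc
  have h2 := hP.small h1.1 (by omega)
  have := Finset.card_le_card (Finset.subset_inter h h')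
  omega

theorem AllTri.tri_clause (hP : PolyW v) {F : Finset ι} (hF : AllTri v F) {f : Finset ι} (hf : f ∉ fc v 3) (h3 : f.card = 3)
    (h : f ⊆ F) : (∀ G, G ∈ fc v 4 → f ⊆ G → G = F) ∧ ∀ T, TriP v T → T ⊆ F → ¬ f ⊆ T := by
  have key : ∀ T ∈ fc v 3, T ⊆ F → ¬ f ⊆ T := fun T hT hTF hfT => by
    have := Finset.eq_of_subset_of_card_le hfT (by rw [hF.2 T hT hTF, h3])
    exact hf (this ▸ hT)
  refine ⟨fun G hG hfG => ?_, fun T hT hTF => key T hT.1 hTF⟩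
  by_contra hne
  exact key _ (hP.FF3 hF.1 hG (Ne.symm hne) h3.ge h hfG) Finset.inter_subset_left (Finset.subset_inter h hfG)

theorem triple4 {T : Finset ι} {a b c d : ι} (h : T ⊆ {a, b, c, d}) (h3 : T.card = 3) :
    T = {a, b, c} ∨ T = {a, b, d} ∨ T = {a, c, d} ∨ T = {b, c, d} := by
  have key : ∀ x y z : ι, T ⊆ {x, y, z} → T = {x, y, z} := fun x y z hs =>
    Finset.eq_of_subset_of_card_le hs (by rw [h3]; exact Finset.card_le_three)
  have hx : ∀ i ∈ T, i = a ∨ i = b ∨ i = c ∨ i = d := fun i hi => by simpa using h hi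
  by_cases ha : a ∈ T
  · by_cases hb : b ∈ T
    · by_cases hc : c ∈ T
      · by_cases hd : d ∈ T
        · have e : T = {a, b, c, d} := le_antisymm h (by
            intro i hi; simp at hi; rcases hi with rfl | rfl | rfl | rfl <;> assumption)
          by_cases hab : a = b
          · right; right; left; rw [e, hab]; simp
          · by_cases hac : a = c
            · right; left; rw [e, hac]; ext; simp; tauto
            · by_cases hbc : b = c
              · right; left; rw [e, hbc]; simp
              · left
                have : ({a, b, c} : Finset ι) ⊆ T := by
                  intro i hi; simp at hi; rcases hi with rfl | rfl | rfl <;> assumption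
                refine (Finset.eq_of_subset_of_card_le this ?_).symm
                rw [h3, Finset.card_eq_three.2 ⟨_, _, _, hab, hac, hbc, rfl⟩]
        · left; apply key; intro i hi
          rcases hx i hi with rfl | rfl | rfl | rfl <;> simp_all
      · right; left; apply key; intro i hi
        rcases hx i hi with rfl | rfl | rfl | rfl <;> simp_all
    · right; right; left; apply key; intro i hi
      rcases hx i hi with rfl | rfl | rfl | rfl <;> simp_all
  · right; right; right; apply key; intro i hi
    rcases hx i hi with rfl | rfl | rfl | rfl <;> simp_all

theorem good_of (Spec : Finset ι → Prop) {F : Finset ι} (hF : F ∈ fc v 4) {fs : List (Finset ι)}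
    (h1 : ∀ f ∈ fs, f ⊆ F ∧ (∀ G, G ∈ fc v 4 → f ⊆ G → G = F) ∧ ∀ T, TriP v T → T ⊆ F → ¬ f ⊆ T)
    (h2 : ∀ T, T ⊆ F → T.card = 3 → (∀ f ∈ fs, ¬ f ⊆ T) → T ∈ fc v 3) :
    Good (fun S => S ∈ fc v 4) (TriP v) Spec F fs :=
  ⟨hF, fun f hf => ⟨(h1 f hf).1, fun G hG hfG => Or.inl ((h1 f hf).2.1 G hG hfG), (h1 f hf).2.2⟩,
    fun T hT h3 h => ⟨h2 T hT h3 h, h3⟩⟩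

/-- tetrahedra -/
theorem AllTri.tet (hP : PolyW v) (Spec : Finset ι → Prop) {F : Finset ι} (hF : AllTri v F) (h4 : F.card = 4)
    (he : (sub v 2 F).card = 6) : Good (fun S => S ∈ fc v 4) (TriP v) Spec F [F] := by
  have hc := hP.choose2 F
  rw [h4, he] at hc
  simp [Nat.choose] at hc
  have hE : ∀ p, p.card = 2 → p ⊆ F → p ∈ fc v 2 := by
    intro p hp hpF
    by_contra h
    rw [ne, Finset.card_eq_zero, Finset.filter_eq_empty_iff] at hc
    exact hc (mem_NE.2 ⟨hp, h⟩) hpF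
  refine good_of _ hF.1 ?_ ?_
  · intro f hf
    rw [List.mem_singleton] at hf
    subst hf
    refine ⟨subset_rfl, fun G hG h => (fc_eq hF.1 hG h).symm, fun T hT _ h => ?_⟩
    have := Finset.card_le_card h
    have := hT.2
    omega
  · intro T hT h3 _
    obtain ⟨x, y, z, hxy, hxz, hyz, rfl⟩ := Finset.card_eq_three.1 h3
    obtain ⟨w, hw⟩ : ∃ w, F \ {x, y, z} = {w} := by
      rw [← Finset.card_eq_one, Finset.card_sdiff_of_subset hT, h3, h4]
    have hx : x ∈ F := hT (by simp)
    have hy : y ∈ F := hT (by simp)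
    refine (hF.lk2 hP (hE {x, y} (Finset.card_pair hxy) ?_) hx hy z w ?_).1
    · intro i hi; simp at hi; rcases hi with rfl | rfl <;> assumption
    · intro u hu h1 h2 _ _
      by_cases h : u = z
      · exact Or.inl h
      · right
        have : u ∈ F \ {x, y, z} := by simp [hu, h1, h2, h]
        rw [hw] at this
        simpa using this

/-- bipyramids -/
theorem AllTri.bip (hP : PolyW v) (Spec : Finset ι → Prop) {F : Finset ι} (hF : AllTri v F) (h5 : F.card = 5)
    (he : (sub v 2 F).card = 9) : ∃ a x p q y, [a, x, p, q, y].Nodup ∧ F = {a, x, p, q, y} ∧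
      Good (fun S => S ∈ fc v 4) (TriP v) Spec F [{a, x}, {p, q, y}] := by
  have hc := hP.choose2 F
  rw [h5, he] at hc
  simp [Nat.choose] at hc
  obtain ⟨n, hn⟩ := Finset.card_eq_one.1 (show ((NE v).filter fun p => p ⊆ F).card = 1 by unfold ne at hc; omega)
  have hn' : n ∈ (NE v).filter fun p => p ⊆ F := by rw [hn]; simp
  rw [Finset.mem_filter] at hn'
  obtain ⟨a, b, hab, rfl⟩ := Finset.card_eq_two.1 (mem_NE.1 hn'.1).1
  obtain ⟨p, q, r, hpq, hpr, hqr, hw⟩ := Finset.card_eq_three.1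
    (show (F \ {a, b}).card = 3 by rw [Finset.card_sdiff_of_subset hn'.2, Finset.card_pair hab, h5])
  have hFe : F = {a, b, p, q, r} := by
    rw [← Finset.union_sdiff_of_subset hn'.2, hw]; ext i; simp; tauto
  have hE : ∀ x y, x ≠ y → x ∈ F → y ∈ F → ¬ (x = a ∧ y = b) → ¬ (x = b ∧ y = a) → {x, y} ∈ fc v 2 := by
    intro x y hxy hx hy h1 h2
    by_contra h
    have : {x, y} ∈ (NE v).filter fun p => p ⊆ F := Finset.mem_filter.2 ⟨((not_edge hxy)).1 h, by
      intro i hi; simp at hi; rcases hi with rfl | rfl <;> assumption⟩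
    rw [hn, Finset.mem_singleton] at this
    have m1 : x ∈ ({a, b} : Finset ι) := by rw [← this]; simp
    have m2 : y ∈ ({a, b} : Finset ι) := by rw [← this]; simp
    rw [Finset.mem_insert, Finset.mem_singleton] at m1 m2
    rcases m1 with m1 | m1 <;> rcases m2 with m2 | m2
    · exact hxy (m1.trans m2.symm)
    · exact h1 ⟨m1, m2⟩
    · exact h2 ⟨m1, m2⟩
    · exact hxy (m1.trans m2.symm)
  have hout : ∀ i ∈ ({p, q, r} : Finset ι), i ∈ F ∧ i ≠ a ∧ i ≠ b := by
    intro i hi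
    rw [← hw] at hi
    simpa using hi
  obtain ⟨hpF, hpa, hpb⟩ := hout p (by simp)
  obtain ⟨hqF, hqa, hqb⟩ := hout q (by simp)
  obtain ⟨hrF, hra, hrb⟩ := hout r (by simp)
  have haF : a ∈ F := hn'.2 (by simp)
  have hbF : b ∈ F := hn'.2 (by simp)
  have hnab : {a, b} ∉ fc v 2 := (mem_NE.1 hn'.1).2
  have hnba : {b, a} ∉ fc v 2 := by rw [Finset.pair_comm]; exact hnab
  have cov : ∀ z ∈ F, z = a ∨ z = b ∨ z = p ∨ z = q ∨ z = r := fun z hz => by rw [hFe] at hz; simpa using hz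
  -- triangles at an apex
  have hap : ∀ i, i = p ∨ i = q ∨ i = r → {a, i} ∈ fc v 2 ∧ {b, i} ∈ fc v 2 := by
    intro i hi
    obtain ⟨h1, h2, h3⟩ := hout i (by simpa using hi)
    exact ⟨hE a i h2.symm haF h1 (fun h => h3 h.2) (fun h => hab h.1),
      hE b i h3.symm hbF h1 (fun h => hab h.1.symm) (fun h => h2 h.2)⟩
  obtain ⟨a1, a2, a3⟩ := hF.apex hP haF hpF hqF (hap p (by simp)).1 (hap q (by simp)).1 (r := r) (by
    intro z hz h1 h2
    rcases cov z hz with h | h | h | h | h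
    · exact absurd h h1
    · rw [h] at h2; exact absurd h2 hnab
    · exact Or.inl h
    · exact Or.inr (Or.inl h)
    · exact Or.inr (Or.inr h))
  obtain ⟨b1, b2, b3⟩ := hF.apex hP hbF hpF hqF (hap p (by simp)).2 (hap q (by simp)).2 (r := r) (by
    intro z hz h1 h2
    rcases cov z hz with h | h | h | h | h
    · rw [h] at h2; exact absurd h2 hnba
    · exact absurd h h1
    · exact Or.inl h
    · exact Or.inr (Or.inl h)
    · exact Or.inr (Or.inr h))
  have rot : ∀ x y z : ι, ({x, y, z} : Finset ι) = {y, z, x} := by intro x y z; ext; simp; tauto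
  have hno : {p, q, r} ∉ fc v 3 := by
    intro h
    refine hF.lk3 hP (x := p) (y := q) hpF hqF haF hbF hrF ?_ ?_ h hab hra.symm hrb.symm
    · rw [← rot]; exact a1
    · rw [← rot]; exact b1
  refine ⟨a, b, p, q, r, ?_, hFe, good_of _ hF.1 ?_ ?_⟩
  · simp [hab, hpa.symm, hqa.symm, hra.symm, hpb.symm, hqb.symm, hrb.symm, hpq, hpr, hqr]
  · intro f hf
    simp only [List.mem_cons, List.not_mem_nil, or_false] at hf
    rcases hf with rfl | rfl
    · exact ⟨hn'.2, hF.ne_clause hP hn'.1 hn'.2⟩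
    · have hs : ({p, q, r} : Finset ι) ⊆ F := fun i hi => (hout i hi).1
      exact ⟨hs, hF.tri_clause hP hno (Finset.card_eq_three.2 ⟨_, _, _, hpq, hpr, hqr, rfl⟩) hs⟩
  · intro T hT h3 hf
    have f1 := hf {a, b} (by simp)
    have f2 := hf {p, q, r} (by simp)
    rw [Finset.insert_subset_iff, Finset.singleton_subset_iff] at f1
    by_cases ha : a ∈ T
    · have hs : T ⊆ {a, p, q, r} := by
        intro i hi
        rcases cov i (hT hi) with rfl | rfl | rfl | rfl | rfl
        · simp
        · exact absurd ⟨ha, hi⟩ f1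
        all_goals simp
      rcases triple4 hs h3 with rfl | rfl | rfl | rfl
      · exact a1
      · exact a2
      · exact a3
      · exact absurd subset_rfl f2
    · have hs : T ⊆ {b, p, q, r} := by
        intro i hi
        rcases cov i (hT hi) with rfl | rfl | rfl | rfl | rfl
        · exact absurd hi ha
        all_goals simp
      rcases triple4 hs h3 with rfl | rfl | rfl | rfl
      · exact b1
      · exact b2
      · exact b3
      · exact absurd subset_rfl f2

end Shapes

section Six

variable {ι : Type} [Fintype ι] [DecidableEq ι] {W : Type} [AddCommGroup W] [Module ℝ W]
  [FiniteDimensional ℝ W] {v : ι → W}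

/-- masks -/
def mask (n m : ℕ) : Finset (Fin n) := Finset.univ.filter fun i => m.testBit i = true

def MM {n : ℕ} (x : Fin n → ι) (m : ℕ) : Finset ι := (mask n m).image x

structure Lab (v : ι → W) (F : Finset ι) (x : Fin 6 → ι) (B : Finset (Finset (Fin 6))) : Prop where
  inj : Function.Injective x
  cov : Finset.univ.image x = F
  nef : (NE v).filter (fun p => p ⊆ F) = B.image fun s => s.image x

theorem img2 {α : Type} [DecidableEq α] (x : α → ι) (i j : α) : ({i, j} : Finset α).image x = {x i, x j} := by
  simp [Finset.image_insert]

theorem img3 {α : Type} [DecidableEq α] (x : α → ι) (i j k : α) : ({i, j, k} : Finset α).image x = {x i, x j, x k} := by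
  simp [Finset.image_insert]

theorem Lab.mem {F : Finset ι} {x : Fin 6 → ι} {B : Finset (Finset (Fin 6))} (h : Lab v F x B) (i : Fin 6) : x i ∈ F := by
  rw [← h.cov]; exact Finset.mem_image_of_mem _ (Finset.mem_univ _)

theorem Lab.sub {F : Finset ι} {x : Fin 6 → ι} {B : Finset (Finset (Fin 6))} (h : Lab v F x B) (s : Finset (Fin 6)) :
    s.image x ⊆ F := by
  rw [← h.cov]; exact Finset.image_subset_image (Finset.subset_univ _)

theorem Lab.edge {F : Finset ι} {x : Fin 6 → ι} {B : Finset (Finset (Fin 6))} (h : Lab v F x B) {i j : Fin 6} (hij : i ≠ j) :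
    {x i, x j} ∈ fc v 2 ↔ {i, j} ∉ B := by
  have h1 : {x i, x j} ∈ (NE v).filter (fun p => p ⊆ F) ↔ {i, j} ∈ B := by
    rw [h.nef, ← img2, Finset.mem_image]
    constructor
    · rintro ⟨s, hs, e⟩
      rwa [← Finset.image_injective h.inj e]
    · intro hb; exact ⟨_, hb, rfl⟩
  rw [← h1, Finset.mem_filter, ← not_edge (h.inj.ne hij), ← img2]
  have := h.sub {i, j}
  tauto

theorem Lab.lk {F : Finset ι} {x : Fin 6 → ι} {B : Finset (Finset (Fin 6))} (h : Lab v F x B) (hP : PolyW v) (hF : AllTri v F)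
    (i j s t : Fin 6) (hij : i ≠ j ∧ {i, j} ∉ B ∧ ∀ z, z ≠ i → z ≠ j → {i, z} ∉ B → {j, z} ∉ B → z = s ∨ z = t) :
    {x i, x j, x s} ∈ fc v 3 ∧ {x i, x j, x t} ∈ fc v 3 ∧ s ≠ t := by
  have := hF.lk2 hP ((h.edge hij.1).2 hij.2.1) (h.mem i) (h.mem j) (x s) (x t) (by
    intro z hz h1 h2 h3 h4
    rw [← h.cov, Finset.mem_image] at hz
    obtain ⟨k, _, rfl⟩ := hz
    have hki : k ≠ i := fun e => h1 (e ▸ rfl)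
    have hkj : k ≠ j := fun e => h2 (e ▸ rfl)
    rcases hij.2.2 k hki hkj ((h.edge hki.symm).1 h3) ((h.edge hkj.symm).1 h4) with rfl | rfl
    · exact Or.inl rfl
    · exact Or.inr rfl)
  exact ⟨this.1, this.2.1, fun e => this.2.2 (e ▸ rfl)⟩

theorem AllTri.lk2' (hP : PolyW v) {F : Finset ι} (hF : AllTri v F) {x y : ι} (hE : {x, y} ∈ fc v 2)
    (hx : x ∈ F) (hy : y ∈ F) (s t : ι)
    (H : ∀ z ∈ F, {x, y, z} ∈ fc v 3 → z = s ∨ z = t) :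
    {x, y, s} ∈ fc v 3 ∧ {x, y, t} ∈ fc v 3 ∧ s ≠ t := by
  have h := hF.link hP hE hx hy
  have hsub : (F.filter fun z => {x, y, z} ∈ fc v 3) ⊆ {s, t} := by
    intro z hz
    rw [Finset.mem_filter] at hz
    have := H z hz.1 hz.2
    simpa using this
  have hc : ({s, t} : Finset ι).card ≤ 2 := Finset.card_le_two
  have e := Finset.eq_of_subset_of_card_le hsub (by omega)
  have hst : s ≠ t := by
    rintro rfl
    rw [e] at h; simp at h
  have m1 : s ∈ (F.filter fun z => {x, y, z} ∈ fc v 3) := by rw [e]; simp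
  have m2 : t ∈ (F.filter fun z => {x, y, z} ∈ fc v 3) := by rw [e]; simp
  rw [Finset.mem_filter] at m1 m2
  exact ⟨m1.2, m2.2, hst⟩

theorem Lab.tri {F : Finset ι} {x : Fin 6 → ι} {B : Finset (Finset (Fin 6))} (h : Lab v F x B) {T : Finset ι} (hT : T ⊆ F)
    (h3 : T.card = 3) : ∃ s : Finset (Fin 6), s.card = 3 ∧ T = s.image x := by
  rw [← h.cov] at hT
  obtain ⟨s, _, e⟩ := Finset.subset_image_iff.1 hT
  refine ⟨s, ?_, e.symm⟩
  rw [← e, Finset.card_image_of_injective _ h.inj] at h3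
  exact h3

theorem Lab.good {F : Finset ι} {x : Fin 6 → ι} {B : Finset (Finset (Fin 6))} (h : Lab v F x B) (hP : PolyW v)
    (hF : AllTri v F) (Spec : Finset ι → Prop) (ms : List ℕ)
    (h1 : ∀ m ∈ ms, mask 6 m ∈ B ∨ ((mask 6 m).card = 3 ∧ (mask 6 m).image x ∉ fc v 3))
    (h2 : ∀ s : Finset (Fin 6), s.card = 3 → (∀ m ∈ ms, ¬ mask 6 m ⊆ s) → s.image x ∈ fc v 3) :
    Good (fun S => S ∈ fc v 4) (TriP v) Spec F (ms.map (MM x)) := by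
  refine good_of _ hF.1 ?_ ?_
  · intro f hf
    obtain ⟨m, hm, rfl⟩ := List.mem_map.1 hf
    refine ⟨h.sub _, ?_⟩
    rcases h1 m hm with hb | ⟨hb, hb'⟩
    · have : (mask 6 m).image x ∈ (NE v).filter (fun p => p ⊆ F) := by
        rw [h.nef]; exact Finset.mem_image_of_mem _ hb
      rw [Finset.mem_filter] at this
      exact hF.ne_clause hP this.1 this.2
    · exact hF.tri_clause hP hb' (by rw [MM, Finset.card_image_of_injective _ h.inj, hb]) (h.sub _)
  · intro T hT h3 hf
    obtain ⟨s, hs, rfl⟩ := h.tri hT h3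
    refine h2 s hs fun m hm hms => hf _ (List.mem_map.2 ⟨m, hm, rfl⟩) ?_
    exact Finset.image_subset_image hms

theorem Lab.octa {F : Finset ι} {x : Fin 6 → ι} (h : Lab v F x {{0, 1}, {2, 3}, {4, 5}}) (hP : PolyW v)
    (hF : AllTri v F) (Spec : Finset ι → Prop) :
    Good (fun S => S ∈ fc v 4) (TriP v) Spec F ([3, 12, 48].map (MM x)) := by
  refine h.good hP hF Spec _ ?_ ?_
  · intro m hm
    left
    revert m hm
    decide
  · intro s hs hm
    have key : ∀ s : Finset (Fin 6), s.card = 3 → (∀ m ∈ [3, 12, 48], ¬ mask 6 m ⊆ s) →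
      s = {0, 2, 4} ∨ s = {0, 2, 5} ∨ s = {0, 3, 4} ∨ s = {0, 3, 5} ∨ s = {1, 2, 4} ∨ s = {1, 2, 5} ∨ s = {1, 3, 4} ∨ s = {1, 3, 5} := by
      decide
    obtain ⟨a1, a2, _⟩ := h.lk hP hF 0 2 4 5 (by decide)
    obtain ⟨a3, a4, _⟩ := h.lk hP hF 0 3 4 5 (by decide)
    obtain ⟨a5, a6, _⟩ := h.lk hP hF 1 2 4 5 (by decide)
    obtain ⟨a7, a8, _⟩ := h.lk hP hF 1 3 4 5 (by decide)
    rcases key s hs hm with rfl | rfl | rfl | rfl | rfl | rfl | rfl | rfl <;> rw [img3] <;> assumption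

theorem Lab.stack {F : Finset ι} {x : Fin 6 → ι} (h : Lab v F x {{0, 4}, {0, 5}, {1, 5}}) (hP : PolyW v)
    (hF : AllTri v F) (Spec : Finset ι → Prop) :
    Good (fun S => S ∈ fc v 4) (TriP v) Spec F ([17, 34, 33, 14, 28].map (MM x)) := by
  have rot : ∀ a b c : ι, ({a, b, c} : Finset ι) = {b, c, a} := by intro x y z; ext; simp; tauto
  have swp : ∀ a b c : ι, ({a, b, c} : Finset ι) = {a, c, b} := by intro x y z; ext; simp; tauto
  obtain ⟨a1, a2, _⟩ := h.lk hP hF 0 1 2 3 (by decide)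
  obtain ⟨-, a3, _⟩ := h.lk hP hF 0 2 1 3 (by decide)
  obtain ⟨b1, b2, _⟩ := h.lk hP hF 5 2 3 4 (by decide)
  obtain ⟨-, b3, _⟩ := h.lk hP hF 5 3 2 4 (by decide)
  have n1 : {x 1, x 2, x 3} ∉ fc v 3 := by
    intro hc
    rw [rot] at hc a3 b1
    exact hF.lk3 hP (h.mem 2) (h.mem 3) (h.mem 0) (h.mem 5) (h.mem 1) a3 b1 hc (h.inj.ne (by decide)) (h.inj.ne (by decide)) (h.inj.ne (by decide))
  have n2 : {x 2, x 3, x 4} ∉ fc v 3 := by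
    intro hc
    rw [rot] at a3 b1
    exact hF.lk3 hP (h.mem 2) (h.mem 3) (h.mem 0) (h.mem 5) (h.mem 4) a3 b1 hc (h.inj.ne (by decide)) (h.inj.ne (by decide)) (h.inj.ne (by decide))
  have key : ∀ s : Finset (Fin 6), s.card = 3 → (∀ m ∈ [17, 34, 33, 14, 28], ¬ mask 6 m ⊆ s) →
      s = {0, 1, 2} ∨ s = {0, 1, 3} ∨ s = {0, 2, 3} ∨ s = {5, 2, 3} ∨ s = {5, 2, 4} ∨ s = {5, 3, 4} ∨ s = {1, 2, 4} ∨ s = {1, 3, 4} := by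
    decide
  have lk' : ∀ i j : Fin 6, i ≠ j ∧ {i, j} ∉ ({{0, 4}, {0, 5}, {1, 5}} : Finset (Finset (Fin 6))) →
      (∀ k : Fin 6, {x i, x j, x k} ∈ fc v 3 → k = 0 ∨ k = 4) → {x i, x j, x 4} ∈ fc v 3 := by
    intro i j hij hk
    exact (hF.lk2' hP ((h.edge hij.1).2 hij.2) (h.mem i) (h.mem j) (x 0) (x 4) (by
      intro z hz h1
      rw [← h.cov, Finset.mem_image] at hz
      obtain ⟨k, _, rfl⟩ := hz
      rcases hk k h1 with rfl | rfl
      · exact Or.inl rfl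
      · exact Or.inr rfl)).2.1
  have all6 : ∀ k : Fin 6, k = 0 ∨ k = 1 ∨ k = 2 ∨ k = 3 ∨ k = 4 ∨ k = 5 := by decide
  have n15 : ¬ {x 1, x 5} ∈ fc v 2 := by rw [h.edge (by decide)]; decide
  have c1 : {x 1, x 2, x 4} ∈ fc v 3 := by
    refine lk' 1 2 (by decide) fun k hk => ?_
    have hne := hP.tri_xyz hk
    rcases all6 k with rfl | rfl | rfl | rfl | rfl | rfl
    · exact Or.inl rfl
    · exact absurd rfl hne.2.1
    · exact absurd rfl hne.2.2.1
    · exact absurd hk n1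
    · exact Or.inr rfl
    · exact absurd hne.2.2.2.2.1 n15
  have c2 : {x 1, x 3, x 4} ∈ fc v 3 := by
    refine lk' 1 3 (by decide) fun k hk => ?_
    have hne := hP.tri_xyz hk
    rcases all6 k with rfl | rfl | rfl | rfl | rfl | rfl
    · exact Or.inl rfl
    · exact absurd rfl hne.2.1
    · rw [swp] at hk; exact absurd hk n1
    · exact absurd rfl hne.2.2.1
    · exact Or.inr rfl
    · exact absurd hne.2.2.2.2.1 n15
  refine h.good hP hF Spec _ ?_ ?_
  · have e1 : mask 6 14 = {1, 2, 3} := by decide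
    have e2 : mask 6 28 = {2, 3, 4} := by decide
    intro m hm
    simp only [List.mem_cons, List.not_mem_nil, or_false] at hm
    rcases hm with rfl | rfl | rfl | rfl | rfl
    · left; decide
    · left; decide
    · left; decide
    · right; rw [e1, img3]; exact ⟨rfl, n1⟩
    · right; rw [e2, img3]; exact ⟨rfl, n2⟩
  · intro s hs hm
    rcases key s hs hm with rfl | rfl | rfl | rfl | rfl | rfl | rfl | rfl <;> rw [img3] <;> assumption

theorem im6 (a b c d e f : ι) : Finset.univ.image ![a, b, c, d, e, f] = {a, b, c, d, e, f} := by
  ext i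
  simp [Fin.exists_fin_succ, eq_comm]

theorem per1 (b d e f c a : ι) : ({b, d, e, f, c, a} : Finset ι) = {b, a, c, d, e, f} := by
  ext i; simp only [Finset.mem_insert, Finset.mem_singleton]; tauto

theorem per2 (b d e f c a : ι) : ({b, d, e, f, a, c} : Finset ι) = {b, a, c, d, e, f} := by
  ext i; simp only [Finset.mem_insert, Finset.mem_singleton]; tauto

theorem per3 (a b d e f g : ι) : ({a, b, d, e, f, g} : Finset ι) = {a, b, d} ∪ {e, f, g} := by
  ext i; simp only [Finset.mem_union, Finset.mem_insert, Finset.mem_singleton]; tauto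

theorem per4 (b d e f c a : ι) : ({b, a, c, d} ∪ {e, f} : Finset ι) = {b, a, c, d, e, f} := by
  ext i; simp only [Finset.mem_union, Finset.mem_insert, Finset.mem_singleton]; tauto

theorem Lab.of {F : Finset ι} (h6 : F.card = 6) {x : Fin 6 → ι} {B : Finset (Finset (Fin 6))}
    (cov : Finset.univ.image x = F) (nef : (NE v).filter (fun p => p ⊆ F) = B.image fun s => s.image x) : Lab v F x B := by
  refine ⟨?_, cov, nef⟩
  have : (Finset.univ.image x).card = (Finset.univ : Finset (Fin 6)).card := by rw [cov, h6]; rfl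
  have := Finset.card_image_iff.1 this
  simpa using this

theorem AllTri.six_aux (hP : PolyW v) {F : Finset ι} (hF : AllTri v F) (h6 : F.card = 6) {a b c : ι} {r : Finset ι}
    (hab : a ≠ b) (hcb : c ≠ b) (hac : a ≠ c) (hn : (NE v).filter (fun p => p ⊆ F) = {{b, a}, {b, c}, r})
    (hr1 : r ≠ {b, a}) (hr2 : r ≠ {b, c}) :
    ∃ x, Lab v F x {{0, 4}, {0, 5}, {1, 5}} := by
  have hm : ∀ p ∈ ({{b, a}, {b, c}, r} : Finset (Finset ι)), p.card = 2 ∧ p ⊆ F := by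
    intro p hp
    rw [← hn, Finset.mem_filter, mem_NE] at hp
    exact ⟨hp.1.1, hp.2⟩
  have ha : a ∈ F := (hm {b, a} (by simp)).2 (by simp)
  have hb : b ∈ F := (hm {b, a} (by simp)).2 (by simp)
  have hc : c ∈ F := (hm {b, c} (by simp)).2 (by simp)
  obtain ⟨hrc, hrF⟩ := hm r (by simp)
  have two : ∀ s ∈ r, ∃ t ∈ F, t ≠ s ∧ r = {s, t} := by
    intro s hs
    obtain ⟨t, ht⟩ := Finset.card_eq_one.1 (show (r.erase s).card = 1 by rw [Finset.card_erase_of_mem hs, hrc])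
    have hm : t ∈ r.erase s := by rw [ht]; simp
    rw [Finset.mem_erase] at hm
    exact ⟨t, hrF hm.2, hm.1, by rw [← ht, Finset.insert_erase hs]⟩
  have rest : ∀ d ∈ F, d ≠ a → d ≠ b → d ≠ c → ∃ e f, e ∈ F ∧ F = {b, a, c, d, e, f} := by
    intro d hd h1 h2 h3
    have h4 : ({b, a, c, d} : Finset ι).card = 4 := by
      rw [Finset.card_insert_of_notMem, Finset.card_insert_of_notMem, Finset.card_pair h3.symm]
      · simp [hac, h1.symm]
      · simp [hab.symm, hcb.symm, h2.symm]
    have hs : ({b, a, c, d} : Finset ι) ⊆ F := by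
      intro i hi; simp at hi; rcases hi with rfl | rfl | rfl | rfl <;> assumption
    obtain ⟨e, f, _, hef⟩ := Finset.card_eq_two.1 (show (F \ {b, a, c, d}).card = 2 by
      rw [Finset.card_sdiff_of_subset hs, h4, h6])
    refine ⟨e, f, ?_, ?_⟩
    · have : e ∈ F \ {b, a, c, d} := by rw [hef]; simp
      exact (Finset.mem_sdiff.1 this).1
    · rw [← Finset.union_sdiff_of_subset hs, hef, per4]
  by_cases hbr : b ∈ r
  · obtain ⟨d, hd, hdb, rfl⟩ := two b hbr
    obtain ⟨e, f, _, hFe⟩ := rest d hd (by rintro rfl; exact hr1 rfl) hdb (by rintro rfl; exact hr2 rfl)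
    have L : Lab v F ![b, a, c, d, e, f] {{0, 1}, {0, 2}, {0, 3}} := Lab.of h6 (by rw [im6, hFe]) (by
      rw [hn]; simp [Finset.image_insert])
    exact absurd rfl (L.lk hP hF 0 4 5 5 (by decide)).2.2
  · by_cases har : a ∈ r
    · obtain ⟨d, hd, hda, rfl⟩ := two a har
      by_cases hdc : d = c
      · subst hdc
        obtain ⟨e, f, g, _, _, _, hw⟩ := Finset.card_eq_three.1 (show (F \ {a, b, d}).card = 3 by
          rw [Finset.card_sdiff_of_subset, h6, Finset.card_eq_three.2 ⟨_, _, _, hab, hac, hcb.symm, rfl⟩]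
          intro i hi; simp at hi; rcases hi with rfl | rfl | rfl <;> assumption)
        have L : Lab v F ![a, b, d, e, f, g] {{1, 0}, {1, 2}, {0, 2}} := Lab.of h6 (by
          rw [im6, ← Finset.union_sdiff_of_subset (show {a, b, d} ⊆ F by
            intro i hi; simp at hi; rcases hi with rfl | rfl | rfl <;> assumption), hw, per3]) (by
          rw [hn]; simp [Finset.image_insert])
        have rot : ∀ a b c : ι, ({a, b, c} : Finset ι) = {b, c, a} := by intro x y z; ext; simp; tauto
        obtain ⟨l1, _, _⟩ := L.lk hP hF 0 3 4 5 (by decide)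
        obtain ⟨l2, _, _⟩ := L.lk hP hF 1 3 4 5 (by decide)
        obtain ⟨l3, _, _⟩ := L.lk hP hF 2 3 4 5 (by decide)
        rw [rot] at l1 l2 l3
        exact (hF.lk3 hP (L.mem 3) (L.mem 4) (L.mem 0) (L.mem 1) (L.mem 2) l1 l2 l3 (L.inj.ne (by decide))
          (L.inj.ne (by decide)) (L.inj.ne (by decide))).elim
      · obtain ⟨e, f, _, hFe⟩ := rest d hd hda (by rintro rfl; simp at hbr) hdc
        refine ⟨![b, d, e, f, c, a], Lab.of h6 ?_ ?_⟩
        · rw [im6, hFe, per1]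
        · rw [hn]; simp [Finset.image_insert]
          rw [Finset.pair_comm a d, Finset.insert_comm]
    · by_cases hcr : c ∈ r
      · obtain ⟨d, hd, hdc, rfl⟩ := two c hcr
        obtain ⟨e, f, _, hFe⟩ := rest d hd (by rintro rfl; simp at har) (by rintro rfl; simp at hbr) hdc
        refine ⟨![b, d, e, f, a, c], Lab.of h6 ?_ ?_⟩
        · rw [im6, hFe, per2]
        · rw [hn]; simp [Finset.image_insert]
          rw [Finset.pair_comm c d]
      · obtain ⟨d, e, hde, rfl⟩ := Finset.card_eq_two.1 hrc
        have hd : d ∈ F := hrF (by simp)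
        have he : e ∈ F := hrF (by simp)
        simp only [Finset.mem_insert, Finset.mem_singleton, not_or] at har hbr hcr
        obtain ⟨f, g, _, hFe⟩ := rest d hd (Ne.symm har.1) (Ne.symm hbr.1) (Ne.symm hcr.1)
        have he2 := he
        rw [hFe] at he2
        simp only [Finset.mem_insert, Finset.mem_singleton] at he2
        have : ∃ g, F = {b, a, c, d, e, g} := by
          rcases he2 with h | h | h | h | h | h
          · exact absurd h.symm hbr.2
          · exact absurd h.symm har.2
          · exact absurd h.symm hcr.2
          · exact absurd h.symm hde
          · exact ⟨g, by rw [hFe, h]⟩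
          · exact ⟨f, by rw [hFe, h, Finset.pair_comm]⟩
        obtain ⟨g, hFe⟩ := this
        have L : Lab v F ![b, a, c, d, e, g] {{0, 1}, {0, 2}, {3, 4}} := Lab.of h6 (by rw [im6, hFe]) (by
          rw [hn]; simp [Finset.image_insert])
        exact absurd rfl (L.lk hP hF 0 3 5 5 (by decide)).2.2

theorem AllTri.six (hP : PolyW v) {F : Finset ι} (hF : AllTri v F) (h6 : F.card = 6) (he : (sub v 2 F).card = 12) :
    (∃ x, Lab v F x {{0, 1}, {2, 3}, {4, 5}}) ∨ ∃ x, Lab v F x {{0, 4}, {0, 5}, {1, 5}} := by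
  have hc := hP.choose2 F
  rw [h6, he] at hc
  simp [Nat.choose] at hc
  obtain ⟨p, q, r, hpq, hpr, hqr, hn⟩ := Finset.card_eq_three.1
    (show ((NE v).filter fun p => p ⊆ F).card = 3 by unfold ne at hc; omega)
  have meet : ∀ p q r : Finset ι, p ≠ q → p ≠ r → q ≠ r → (NE v).filter (fun p => p ⊆ F) = {p, q, r} → ¬ Disjoint p q →
      ∃ x, Lab v F x {{0, 4}, {0, 5}, {1, 5}} := by
    intro p q r hpq hpr hqr hn hd
    obtain ⟨b, hbp, hbq⟩ := Finset.not_disjoint_iff.1 hd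
    have two : ∀ s ∈ ({p, q, r} : Finset (Finset ι)), b ∈ s → ∃ t, t ≠ b ∧ s = {b, t} := by
      intro s hs hb
      rw [← hn, Finset.mem_filter, mem_NE] at hs
      obtain ⟨t, ht⟩ := Finset.card_eq_one.1 (show (s.erase b).card = 1 by rw [Finset.card_erase_of_mem hb, hs.1.1])
      have hm : t ∈ s.erase b := by rw [ht]; simp
      rw [Finset.mem_erase] at hm
      exact ⟨t, hm.1, by rw [← ht, Finset.insert_erase hb]⟩
    obtain ⟨a, hab, rfl⟩ := two p (by simp) hbp
    obtain ⟨c, hcb, rfl⟩ := two q (by simp) hbq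
    exact hF.six_aux hP h6 hab hcb (by rintro rfl; exact hpq rfl) hn hpr.symm hqr.symm
  by_cases d1 : Disjoint p q
  · by_cases d2 : Disjoint p r
    · by_cases d3 : Disjoint q r
      · left
        have hm : ∀ s ∈ ({p, q, r} : Finset (Finset ι)), s.card = 2 ∧ s ⊆ F := by
          intro s hs
          rw [← hn, Finset.mem_filter, mem_NE] at hs
          exact ⟨hs.1.1, hs.2⟩
        obtain ⟨c1, s1⟩ := hm p (by simp)
        obtain ⟨c2, s2⟩ := hm q (by simp)
        obtain ⟨c3, s3⟩ := hm r (by simp)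
        have hU : p ∪ (q ∪ r) = F := by
          refine Finset.eq_of_subset_of_card_le (Finset.union_subset s1 (Finset.union_subset s2 s3)) ?_
          rw [Finset.card_union_of_disjoint (Finset.disjoint_union_right.2 ⟨d1, d2⟩), Finset.card_union_of_disjoint d3]
          omega
        obtain ⟨a, b, _, rfl⟩ := Finset.card_eq_two.1 c1
        obtain ⟨c, d, _, rfl⟩ := Finset.card_eq_two.1 c2
        obtain ⟨e, f, _, rfl⟩ := Finset.card_eq_two.1 c3
        refine ⟨![a, b, c, d, e, f], Lab.of h6 ?_ ?_⟩
        · rw [im6, ← hU]; ext i; simp; tauto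
        · rw [hn]; simp [Finset.image_insert]
      · exact Or.inr (meet q r p hqr hpq.symm hpr.symm (by rw [hn]; ext i; simp; tauto) d3)
    · exact Or.inr (meet p r q hpr hpq hqr.symm (by rw [hn]; ext i; simp; tauto) d2)
  · exact Or.inr (meet p q r hpq hpr hqr hn d1)

end Six

section Pyr

variable {ι : Type} [Fintype ι] [DecidableEq ι] {W : Type} [AddCommGroup W] [Module ℝ W]
  [FiniteDimensional ℝ W] {v : ι → W}

theorem PolyW.square (hP : PolyW v) {G : Finset ι} (hG : G ∈ fc v 3) (h4 : G.card = 4) :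
    ∃ a b c d, [a, b, c, d].Nodup ∧ G = {a, b, c, d} ∧ {a, b} ∈ fc v 2 ∧ {b, c} ∈ fc v 2 ∧ {c, d} ∈ fc v 2 ∧
      {a, d} ∈ fc v 2 ∧ {a, c} ∈ NE v ∧ {b, d} ∈ NE v := by
  have deg : ∀ x ∈ G, ∀ a ∈ G, ∀ b ∈ G, ∀ c ∈ G, a ≠ x → b ≠ x → c ≠ x → a ≠ b → a ≠ c → b ≠ c → {x, a} ∈ fc v 2 →
      {x, b} ∈ fc v 2 → {x, c} ∉ fc v 2 := by
    intro x hx a ha b hb c hc hax hbx hcx hab hac hbc h1 h2 h3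
    have h := hP.at3 hG hx
    have hinj : ∀ s t : ι, s ≠ x → ({x, s} : Finset ι) = {x, t} → s = t := by
      intro s t hs e
      have : s ∈ ({x, t} : Finset ι) := by rw [← e]; simp
      simp only [Finset.mem_insert, Finset.mem_singleton] at this
      exact this.resolve_left hs
    have hs : ({{x, a}, {x, b}, {x, c}} : Finset (Finset ι)) ⊆ (sub v 2 G).filter fun U => x ∈ U := by
      intro U hU
      simp only [Finset.mem_insert, Finset.mem_singleton] at hU
      rw [Finset.mem_filter, mem_sub]
      rcases hU with rfl | rfl | rfl
      · exact ⟨⟨h1, by intro i hi; simp at hi; rcases hi with rfl | rfl <;> assumption⟩, by simp⟩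
      · exact ⟨⟨h2, by intro i hi; simp at hi; rcases hi with rfl | rfl <;> assumption⟩, by simp⟩
      · exact ⟨⟨h3, by intro i hi; simp at hi; rcases hi with rfl | rfl <;> assumption⟩, by simp⟩
    have := Finset.card_le_card hs
    rw [Finset.card_eq_three.2 ⟨_, _, _, fun e => hab (hinj _ _ hax e), fun e => hac (hinj _ _ hax e),
      fun e => hbc (hinj _ _ hbx e), rfl⟩] at this
    omega
  obtain ⟨x, hx⟩ : G.Nonempty := by rw [← Finset.card_pos]; omega
  obtain ⟨a, b, hax, hbx, hab, ea, eb, ha, hb, _⟩ := hP.nb2 hG hx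
  obtain ⟨y, hy⟩ := Finset.card_eq_one.1 (show (G \ {x, a, b}).card = 1 by
    rw [Finset.card_sdiff_of_subset, h4, Finset.card_eq_three.2 ⟨_, _, _, hax.symm, hbx.symm, hab, rfl⟩]
    intro i hi; simp at hi; rcases hi with rfl | rfl | rfl <;> assumption)
  have hy' : y ∈ G \ {x, a, b} := by rw [hy]; simp
  simp only [Finset.mem_sdiff, Finset.mem_insert, Finset.mem_singleton, not_or] at hy'
  obtain ⟨hyG, hyx, hya, hyb⟩ := hy'
  have hGe : G = {x, a, y, b} := by
    rw [← Finset.union_sdiff_of_subset (show {x, a, b} ⊆ G by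
      intro i hi; simp at hi; rcases hi with rfl | rfl | rfl <;> assumption), hy]
    ext i; simp only [Finset.mem_union, Finset.mem_insert, Finset.mem_singleton]; tauto
  have hxy : {x, y} ∉ fc v 2 := deg x hx a ha b hb y hyG hax hbx hyx hab (Ne.symm hya) (Ne.symm hyb) ea eb
  obtain ⟨s, t, hs, ht, hst, es, et, hsG, htG, _⟩ := hP.nb2 hG hyG
  have cov : ∀ s ∈ G, s ≠ y → {y, s} ∈ fc v 2 → s = a ∨ s = b := by
    intro s hs hsy e
    rw [hGe] at hs
    simp only [Finset.mem_insert, Finset.mem_singleton] at hs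
    rcases hs with rfl | rfl | rfl | rfl
    · rw [Finset.pair_comm] at e; exact absurd e hxy
    · exact Or.inl rfl
    · exact absurd rfl hsy
    · exact Or.inr rfl
  have hy2 : {y, a} ∈ fc v 2 ∧ {y, b} ∈ fc v 2 := by
    rcases cov s hsG hs es with rfl | rfl <;> rcases cov t htG ht et with rfl | rfl
    · exact absurd rfl hst
    · exact ⟨es, et⟩
    · exact ⟨et, es⟩
    · exact absurd rfl hst
  have hab' : {a, b} ∉ fc v 2 := deg a ha x hx y hyG b hb hax.symm hya hab.symm (Ne.symm hyx) hbx.symm hyb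
    (by rw [Finset.pair_comm]; exact ea) (by rw [Finset.pair_comm]; exact hy2.1)
  refine ⟨x, a, y, b, ?_, hGe, ea, ?_, hy2.2, eb, (not_edge (Ne.symm hyx)).1 hxy, (not_edge hab).1 hab'⟩
  · simp [hax.symm, hbx.symm, hab, Ne.symm hyx, Ne.symm hya, hyb]
  · rw [Finset.pair_comm]; exact hy2.1

theorem PolyW.pyr (hP : PolyW v) {a b c d p : ι} {F : Finset ι} (hG : {a, b, c, d} ∈ fc v 3)
    (hoth : ∀ G ∈ fc v 3, G ≠ {a, b, c, d} → G.card = 3) (hn : [a, b, c, d].Nodup) (e1 : {a, b} ∈ fc v 2)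
    (e2 : {b, c} ∈ fc v 2) (e3 : {c, d} ∈ fc v 2) (e4 : {a, d} ∈ fc v 2) (n1 : {a, c} ∈ NE v) (n2 : {b, d} ∈ NE v)
    (hF : F ∈ fc v 4) (hFe : F = {p, a, b, c, d}) :
    Good (fun S => S ∈ fc v 4) (TriP v) (fun G => G ∈ fc v 4 ∧ {a, b, c, d} ⊆ G) F [{a, c}, {b, d}] := by
  have hGF : {a, b, c, d} ⊆ F := by rw [hFe]; exact Finset.subset_insert _ _
  have hs1 : ({a, c} : Finset ι) ⊆ {a, b, c, d} := by intro i hi; simp at hi ⊢; tauto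
  have hs2 : ({b, d} : Finset ι) ⊆ {a, b, c, d} := by intro i hi; simp at hi ⊢; tauto
  have side : ∀ x y, x ∈ ({a, b, c, d} : Finset ι) → y ∈ ({a, b, c, d} : Finset ι) → {x, y} ∈ fc v 2 → {x, y, p} ∈ fc v 3 := by
    intro x y hx hy he
    have hsx : {x, y} ⊆ ({a, b, c, d} : Finset ι) := by
      intro i hi
      rw [Finset.mem_insert, Finset.mem_singleton] at hi
      rcases hi with rfl | rfl <;> assumption
    have h2 := edge4 hF (mem_sub.2 ⟨he, hsx.trans hGF⟩)
    obtain ⟨T, hT, hne⟩ := Finset.exists_mem_ne (by omega) ({a, b, c, d} : Finset ι) (s := (sub v 3 F).filter fun G => {x, y} ⊆ G)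
    rw [Finset.mem_filter, mem_sub] at hT
    have h3 := hoth T hT.1.1 hne
    obtain ⟨z, hz⟩ : ∃ z, T \ {x, y} = {z} := by
      rw [← Finset.card_eq_one, Finset.card_sdiff_of_subset hT.2, h3, hP.card2 he]
    have e : {x, y, z} = T := by
      rw [← Finset.union_sdiff_of_subset hT.2, hz]
      ext i; simp
    have hzF : z ∈ F := hT.1.2 (by rw [← e]; simp)
    rw [hFe, Finset.mem_insert] at hzF
    rcases hzF with rfl | hzG
    · rw [e]; exact hT.1.1
    · exfalso
      refine hne (fc_eq hT.1.1 hG ?_)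
      rw [← e]
      intro i hi
      rw [Finset.mem_insert, Finset.mem_insert, Finset.mem_singleton] at hi
      rcases hi with rfl | rfl | rfl <;> assumption
  have nc : ∀ f ∈ NE v, f ⊆ {a, b, c, d} → f ⊆ F ∧ (∀ G, G ∈ fc v 4 → f ⊆ G →
      G = F ∨ ((F ∈ fc v 4 ∧ {a, b, c, d} ⊆ F) ∧ (G ∈ fc v 4 ∧ {a, b, c, d} ⊆ G))) ∧ ∀ T, TriP v T → T ⊆ F → ¬ f ⊆ T := by
    intro f hf hfG
    refine ⟨hfG.trans hGF, fun G hG' h => ?_, fun T hT _ h => ?_⟩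
    · by_cases e : G = F
      · exact Or.inl e
      · right
        have h1 := hP.FF hf hF hG' (hfG.trans hGF) h (Ne.symm e)
        have h2 := hP.Gp hf h1 hG (Finset.subset_inter (hfG.trans hGF) h) hfG
        refine ⟨⟨hF, hGF⟩, hG', ?_⟩
        rw [← h2]
        exact Finset.inter_subset_right
    · exact (mem_NE.1 hf).2 (hP.tri_edge hT.1 hT.2 h (mem_NE.1 hf).1)
  refine ⟨hF, ?_, ?_⟩
  · intro f hf
    simp only [List.mem_cons, List.not_mem_nil, or_false] at hf
    rcases hf with rfl | rfl
    · exact nc _ n1 hs1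
    · exact nc _ n2 hs2
  · intro T hT h3 hf
    refine ⟨?_, h3⟩
    have f1 := hf {a, c} (by simp)
    have f2 := hf {b, d} (by simp)
    have cov : ∀ i ∈ T, i = a ∨ i = b ∨ i = c ∨ i = d ∨ i = p := fun i hi => by
      have := hT hi
      rw [hFe] at this
      simp only [Finset.mem_insert, Finset.mem_singleton] at this
      rcases this with h | h | h | h | h <;> simp [h]
    by_cases ha : a ∈ T
    · have hs : T ⊆ {a, b, d, p} := by
        intro i hi
        rcases cov i hi with rfl | rfl | rfl | rfl | rfl
        · simp
        · simp
        · exact (f1 (by intro j hj; simp at hj; rcases hj with rfl | rfl <;> assumption)).elim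
        · simp
        · simp
      rcases triple4 hs h3 with rfl | rfl | rfl | rfl
      · exact (f2 (by intro j hj; simp at hj ⊢; tauto)).elim
      · exact side _ _ (by simp) (by simp) e1
      · exact side _ _ (by simp) (by simp) e4
      · exact (f2 (by intro j hj; simp at hj ⊢; tauto)).elim
    · have hs : T ⊆ {b, c, d, p} := by
        intro i hi
        rcases cov i hi with rfl | rfl | rfl | rfl | rfl
        · exact absurd hi ha
        all_goals simp
      rcases triple4 hs h3 with rfl | rfl | rfl | rfl
      · exact (f2 (by intro j hj; simp at hj ⊢; tauto)).elim
      · exact side _ _ (by simp) (by simp) e2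
      · exact (f2 (by intro j hj; simp at hj ⊢; tauto)).elim
      · exact side _ _ (by simp) (by simp) e3

end Pyr

section Model

variable {ι : Type} [Fintype ι] [DecidableEq ι] {W : Type} [AddCommGroup W] [Module ℝ W]
  [FiniteDimensional ℝ W] {v : ι → W}

theorem PolyW.nbr (hP : PolyW v) (T H : Finset ι) (hT : TriP v T) :
    ∃ G, G ∈ fc v 4 ∧ G ≠ H ∧ T ⊆ G := by
  have h := hP.tri2 hT.1
  obtain ⟨G, hG, hne⟩ := Finset.exists_mem_ne (by omega) H (s := (fc v 4).filter fun F => T ⊆ F)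
  rw [Finset.mem_filter] at hG
  exact ⟨G, hG.1, hne, hG.2⟩

theorem Cnt.closed (hC : Cnt v) (h4 : ∀ F ∈ fc v 4, 4 ≤ ((sub v 3 F).filter fun T => T.card = 3).card)
    (A : Finset (Finset ι)) (hA : ∀ F ∈ A, F ∈ fc v 4) (h8 : 8 ≤ A.card) (h11 : A.card ≤ 11) :
    ∃ H ∈ A, ∃ T, TriP v T ∧ T ⊆ H ∧ ∀ G ∈ A, T ⊆ G → G = H := by
  by_contra hcon
  push Not at hcon
  have hP := hC.toPolyW
  have hAs : A ⊆ fc v 4 := hA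
  have hB : (fc v 4 \ A).card + A.card = 12 := by rw [Finset.card_sdiff_add_card_eq_card hAs, hC.c4]
  obtain ⟨F, hF⟩ : (fc v 4 \ A).Nonempty := by rw [← Finset.card_pos]; omega
  have hF' := Finset.mem_sdiff.1 hF
  have ex : ∀ T, ∃ G, T ∈ (sub v 3 F).filter (fun T => T.card = 3) → G ∈ (fc v 4 \ A).erase F ∧ F ∩ G = T := by
    intro T
    by_cases hT : T ∈ (sub v 3 F).filter (fun T => T.card = 3)
    · have hT' := hT
      rw [Finset.mem_filter, mem_sub] at hT'
      obtain ⟨G, hG, hne, hTG⟩ := hP.nbr T F ⟨hT'.1.1, hT'.2⟩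
      refine ⟨G, fun _ => ⟨?_, ?_⟩⟩
      · refine Finset.mem_erase.2 ⟨hne, Finset.mem_sdiff.2 ⟨hG, fun hGA => ?_⟩⟩
        obtain ⟨G', hG'A, hTG', hne'⟩ := hcon G hGA T ⟨hT'.1.1, hT'.2⟩ hTG
        have h2 := hP.tri2 hT'.1.1
        have hs : ({F, G, G'} : Finset (Finset ι)) ⊆ (fc v 4).filter fun F => T ⊆ F := by
          intro U hU
          simp only [Finset.mem_insert, Finset.mem_singleton] at hU
          rw [Finset.mem_filter]
          rcases hU with rfl | rfl | rfl
          exacts [⟨hF'.1, hT'.1.2⟩, ⟨hG, hTG⟩, ⟨hA _ hG'A, hTG'⟩]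
        have h3 := Finset.card_le_card hs
        rw [Finset.card_eq_three.2 ⟨_, _, _, hne.symm, fun e => hF'.2 (e ▸ hG'A), hne'.symm, rfl⟩] at h3
        omega
      · exact (fc_eq hT'.1.1 (hP.FF3 hF'.1 hG hne.symm hT'.2.ge hT'.1.2 hTG) (Finset.subset_inter hT'.1.2 hTG)).symm
    · exact ⟨∅, fun h => absurd h hT⟩
  choose g hg using ex
  have := Finset.card_le_card_of_injOn g (s := (sub v 3 F).filter fun T => T.card = 3) (t := (fc v 4 \ A).erase F)
    (fun T hT => (hg T hT).1) (fun T hT T' hT' e => by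
      rw [← (hg T hT).2, ← (hg T' hT').2, e])
  rw [Finset.card_erase_of_mem hF] at this
  have := h4 F hF'.1
  omega

theorem opp {s t a b : ℝ} (hs : 0 < s) (ht : 0 < t) (h : a * s + b * t = 0) : (0 < a → b < 0) ∧ (a < 0 → 0 < b) ∧ (a = 0 → b = 0) := by
  refine ⟨fun ha => ?_, fun ha => ?_, fun ha => ?_⟩
  · by_contra hb; nlinarith [mul_pos ha hs, mul_nonneg (not_lt.1 hb) ht.le]
  · by_contra hb; nlinarith [mul_pos (neg_pos.2 ha) hs, mul_nonneg (neg_nonneg.2 (not_lt.1 hb)) ht.le]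
  · subst ha; simp at h; exact h.resolve_right ht.ne'

theorem bip_rel {Spec : Finset ι → Prop} {a x p q y : ι} (hn : [a, x, p, q, y].Nodup)
    (h : Good (fun S => S ∈ fc v 4) (TriP v) Spec {a, x, p, q, y} [{a, x}, {p, q, y}]) :
    ∃ α β γ δ ε : ℝ, 0 < α ∧ 0 < β ∧ 0 < γ ∧ 0 < δ ∧ 0 < ε ∧ α • v a + β • v x = γ • v p + δ • v q + ε • v y := by
  simp only [List.nodup_cons, List.mem_cons, List.not_mem_nil, or_false, not_or, not_false_iff, List.nodup_nil, and_true] at hn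
  obtain ⟨⟨ax, ap, aq, ay⟩, ⟨xp, xq, xy⟩, ⟨pq, py⟩, qy⟩ := hn
  -- the relation
  obtain ⟨c, hc, hc0⟩ : ∃ c : Fin 5 → ℝ, ∑ j, c j • v (![a, x, p, q, y] j) = 0 ∧ ∃ j, c j ≠ 0 := by
    have hnl : ¬ LinearIndependent ℝ fun j : Fin 5 => v (![a, x, p, q, y] j) := by
      intro hli
      have h1 := finrank_span_eq_card hli
      have h2 : Submodule.span ℝ (Set.range fun j : Fin 5 => v (![a, x, p, q, y] j)) ≤ csp v {a, x, p, q, y} := by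
        rw [Submodule.span_le]
        rintro _ ⟨j, rfl⟩
        refine csp_mem ?_
        fin_cases j <;> simp
      have h3 := Submodule.finrank_mono h2
      have h4 := (mem_fc.1 h.1).2
      rw [crk] at h4
      rw [h1] at h3
      simp at h3
      omega
    rw [Fintype.linearIndependent_iff] at hnl
    push Not at hnl
    exact hnl
  simp only [Fin.sum_univ_five, Matrix.cons_val] at hc
  have T : ∀ s t u w z : ι, s ≠ t → s ≠ u → t ≠ u → w ∉ ({s, t, u} : Finset ι) → z ∉ ({s, t, u} : Finset ι) →
      ({s, t, u} : Finset ι) ⊆ {a, x, p, q, y} → (a ∉ ({s, t, u} : Finset ι) ∨ x ∉ ({s, t, u} : Finset ι)) →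
      (p ∉ ({s, t, u} : Finset ι) ∨ q ∉ ({s, t, u} : Finset ι) ∨ y ∉ ({s, t, u} : Finset ι)) →
      ∃ φ : W →ₗ[ℝ] ℝ, φ (v s) = 0 ∧ φ (v t) = 0 ∧ φ (v u) = 0 ∧ 0 < φ (v w) ∧ 0 < φ (v z) := by
    intro s t u w z st su tu hw hz hsub h1 h2
    have hT := h.2.2 {s, t, u} hsub (Finset.card_eq_three.2 ⟨_, _, _, st, su, tu, rfl⟩) (by
      intro f hf hfT
      simp only [List.mem_cons, List.not_mem_nil, or_false] at hf
      rcases hf with rfl | rfl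
      · rcases h1 with h1 | h1 <;> exact h1 (hfT (by simp))
      · rcases h2 with h2 | h2 | h2 <;> exact h2 (hfT (by simp)))
    obtain ⟨φ, hφ⟩ := (mem_fc.1 hT.1).1
    refine ⟨φ, (hφ s).2.2 (by simp), (hφ t).2.2 (by simp), (hφ u).2.2 (by simp), ?_, ?_⟩
    · exact lt_of_le_of_ne (hφ w).1 fun e => hw ((hφ w).2.1 e.symm)
    · exact lt_of_le_of_ne (hφ z).1 fun e => hz ((hφ z).2.1 e.symm)
  have sb : ∀ s t u : ι, (s ∈ ({a, x, p, q, y} : Finset ι)) → (t ∈ ({a, x, p, q, y} : Finset ι)) →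
      (u ∈ ({a, x, p, q, y} : Finset ι)) → ({s, t, u} : Finset ι) ⊆ {a, x, p, q, y} := by
    intro s t u h1 h2 h3 i hi
    rw [Finset.mem_insert, Finset.mem_insert, Finset.mem_singleton] at hi
    rcases hi with rfl | rfl | rfl <;> assumption
  have nn : ∀ s t u w : ι, w ≠ s → w ≠ t → w ≠ u → w ∉ ({s, t, u} : Finset ι) := by
    intro s t u w h1 h2 h3; simp [h1, h2, h3]
  obtain ⟨f1, r1, r2, r3, r4, r5⟩ := T a p q x y ap aq pq (nn _ _ _ _ (Ne.symm ax) xp xq) (nn _ _ _ _ (Ne.symm ay) (Ne.symm py) (Ne.symm qy))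
    (sb _ _ _ (by simp) (by simp) (by simp)) (Or.inr (nn _ _ _ _ (Ne.symm ax) xp xq))
    (Or.inr (Or.inr (nn _ _ _ _ (Ne.symm ay) (Ne.symm py) (Ne.symm qy))))
  obtain ⟨f2, s1, s2, s3, s4, s5⟩ := T a p y x q ap ay py (nn _ _ _ _ (Ne.symm ax) xp xy) (nn _ _ _ _ (Ne.symm aq) (Ne.symm pq) qy)
    (sb _ _ _ (by simp) (by simp) (by simp)) (Or.inr (nn _ _ _ _ (Ne.symm ax) xp xy))
    (Or.inr (Or.inl (nn _ _ _ _ (Ne.symm aq) (Ne.symm pq) qy)))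
  obtain ⟨f3, t1, t2, t3, t4, t5⟩ := T a q y x p aq ay qy (nn _ _ _ _ (Ne.symm ax) xq xy) (nn _ _ _ _ (Ne.symm ap) pq py)
    (sb _ _ _ (by simp) (by simp) (by simp)) (Or.inr (nn _ _ _ _ (Ne.symm ax) xq xy))
    (Or.inl (nn _ _ _ _ (Ne.symm ap) pq py))
  obtain ⟨f4, u1, u2, u3, u4, u5⟩ := T x p q y a xp xq pq (nn _ _ _ _ (Ne.symm xy) (Ne.symm py) (Ne.symm qy)) (nn _ _ _ _ ax ap aq)
    (sb _ _ _ (by simp) (by simp) (by simp)) (Or.inl (nn _ _ _ _ ax ap aq))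
    (Or.inr (Or.inr (nn _ _ _ _ (Ne.symm xy) (Ne.symm py) (Ne.symm qy))))
  have g1 : c 1 * f1 (v x) + c 4 * f1 (v y) = 0 := by
    have := congrArg f1 hc; simp [r1, r2, r3] at this; linarith
  have g2 : c 1 * f2 (v x) + c 3 * f2 (v q) = 0 := by
    have := congrArg f2 hc; simp [s1, s2, s3] at this; linarith
  have g3 : c 1 * f3 (v x) + c 2 * f3 (v p) = 0 := by
    have := congrArg f3 hc; simp [t1, t2, t3] at this; linarith
  have g4 : c 4 * f4 (v y) + c 0 * f4 (v a) = 0 := by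
    have := congrArg f4 hc; simp [u1, u2, u3] at this; linarith
  have o1 := opp r4 r5 g1
  have o2 := opp s4 s5 g2
  have o3 := opp t4 t5 g3
  have o4 := opp u4 u5 g4
  rcases lt_trichotomy (c 1) 0 with hl | he | hg
  · have k4 := o1.2.1 hl
    refine ⟨-c 0, -c 1, c 2, c 3, c 4, neg_pos.2 (o4.1 k4), neg_pos.2 hl, o3.2.1 hl, o2.2.1 hl, k4, ?_⟩
    linear_combination (norm := module) (-1 : ℝ) • hc
  · exfalso
    obtain ⟨j, hj⟩ := hc0
    have k4 := o1.2.2 he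
    fin_cases j
    exacts [hj (o4.2.2 k4), hj he, hj (o3.2.2 he), hj (o2.2.2 he), hj k4]
  · have k4 := o1.1 hg
    refine ⟨c 0, c 1, -c 2, -c 3, -c 4, o4.2.1 k4, hg, neg_pos.2 (o3.1 hg), neg_pos.2 (o2.1 hg), neg_pos.2 k4, ?_⟩
    linear_combination (norm := module) (1 : ℝ) • hc

theorem pat_rel {Spec : Finset ι → Prop} {H : Finset ι} {c d u r s x y : ι} (hH : H ∈ fc v 4) (hc : c ∈ H) (hd : d ∈ H)
    (hu : u ∈ H) (hr : r ∈ H) (hs : s ∈ H) (hx : x ∉ H) (hy : y ∉ H) (hxy : x ≠ y) (hcu : c ≠ u) (hcr : c ≠ r) (hur : u ≠ r)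
    (hdu : d ≠ u) (hds : d ≠ s) (hus : u ≠ s)
    (h1 : Good (fun S => S ∈ fc v 4) (TriP v) Spec {c, x, u, r, y} [{c, x}, {u, r, y}])
    (h2 : Good (fun S => S ∈ fc v 4) (TriP v) Spec {d, y, u, s, x} [{d, y}, {u, s, x}]) :
    ∃ a1 a2 a3 a4 a5 : ℝ, 0 < a1 ∧ 0 < a2 ∧ 0 < a3 ∧ a1 • v c + a2 • v d = a3 • v u + a4 • v r + a5 • v s := by
  have out : ∀ i ∈ H, ∀ j, j ∉ H → i ≠ j := fun i hi j hj e => hj (e ▸ hi)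
  obtain ⟨α, β, γ, δ, ε, pα, pβ, pγ, pδ, pε, e1⟩ := bip_rel (by
    simp [hcu, hcr, hur, out c hc x hx, out c hc y hy, (out u hu x hx).symm, (out r hr x hx).symm, hxy, out u hu y hy, out r hr y hy]) h1
  obtain ⟨α', β', γ', δ', ε', pα', pβ', pγ', pδ', pε', e2⟩ := bip_rel (by
    simp [hdu, hds, hus, out d hd x hx, out d hd y hy, (out u hu y hy).symm, (out s hs y hy).symm, hxy.symm, out u hu x hx, out s hs x hx]) h2
  obtain ⟨φ, hφ⟩ := (mem_fc.1 hH).1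
  have z : ∀ i ∈ H, φ (v i) = 0 := fun i hi => (hφ i).2.2 hi
  have px : 0 < φ (v x) := lt_of_le_of_ne (hφ x).1 fun e => hx ((hφ x).2.1 e.symm)
  have py : 0 < φ (v y) := lt_of_le_of_ne (hφ y).1 fun e => hy ((hφ y).2.1 e.symm)
  have i1 : β * φ (v x) = ε * φ (v y) := by
    have := congrArg φ e1; simp [z c hc, z u hu, z r hr] at this; linarith
  have i2 : β' * φ (v y) = ε' * φ (v x) := by
    have := congrArg φ e2; simp [z d hd, z u hu, z s hs] at this; linarith
  have i3 : β * β' = ε * ε' := by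
    have : (β * β') * (φ (v x) * φ (v y)) = (ε * ε') * (φ (v x) * φ (v y)) := by
      linear_combination β' * φ (v y) * i1 + ε * φ (v y) * i2
    exact mul_right_cancel₀ (mul_pos px py).ne' this
  refine ⟨β' * α, ε * α', β' * γ + ε * γ', β' * δ, ε * δ', mul_pos pβ' pα, mul_pos pε pα', add_pos (mul_pos pβ' pγ) (mul_pos pε pγ'), ?_⟩
  have i4 : (β * β') • v x = (ε * ε') • v x := by rw [i3]
  linear_combination (norm := module) β' • e1 + ε • e2 - i4

theorem pattern (Spec : Finset ι → Prop) (H : Finset ι) (c d u w r s x y z o k l : ι) (hH : H ∈ fc v 4) (h6 : H.card = 6)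
    (hn : [c, d, u, w, r, s].Nodup) (hi : ∀ i ∈ [c, d, u, w, r, s], i ∈ H) (ho : ∀ i ∈ [x, y, z, o, k, l], i ∉ H)
    (hxy : x ≠ y) (hzo : z ≠ o) (hkl : k ≠ l)
    (h1 : Good (fun S => S ∈ fc v 4) (TriP v) Spec {c, x, u, r, y} [{c, x}, {u, r, y}])
    (h2 : Good (fun S => S ∈ fc v 4) (TriP v) Spec {d, y, u, s, x} [{d, y}, {u, s, x}])
    (h3 : Good (fun S => S ∈ fc v 4) (TriP v) Spec {c, z, w, s, o} [{c, z}, {w, s, o}])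
    (h4 : Good (fun S => S ∈ fc v 4) (TriP v) Spec {d, o, w, r, z} [{d, o}, {w, r, z}])
    (h5 : Good (fun S => S ∈ fc v 4) (TriP v) Spec {u, k, d, r, l} [{u, k}, {d, r, l}])
    (h6' : Good (fun S => S ∈ fc v 4) (TriP v) Spec {w, l, d, s, k} [{w, l}, {d, s, k}]) : False := by
  have hHe : H = [c, d, u, w, r, s].toFinset := by
    refine (Finset.eq_of_subset_of_card_le (fun i h => hi i (List.mem_toFinset.1 h)) ?_).symm
    rw [h6, List.toFinset_card_of_nodup hn]; rfl
  simp only [List.mem_cons, List.not_mem_nil, or_false, forall_eq_or_imp, forall_eq] at hi ho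
  obtain ⟨hc, hd, hu, hw, hr, hs⟩ := hi
  obtain ⟨hx, hy, hz, ho, hk, hl⟩ := ho
  simp only [List.nodup_cons, List.mem_cons, List.not_mem_nil, or_false, not_or, not_false_iff, List.nodup_nil, and_true] at hn
  obtain ⟨⟨cd, cu, cw, cr, cs⟩, ⟨du, dw, dr, ds⟩, ⟨uw, ur, us⟩, ⟨wr, ws⟩, rs⟩ := hn
  obtain ⟨A1, A2, A3, A4, A5, pA1, pA2, pA3, eA⟩ := pat_rel hH hc hd hu hr hs hx hy hxy cu cr ur du ds us h1 h2
  obtain ⟨B1, B2, B3, B4, B5, pB1, pB2, pB3, eB⟩ := pat_rel hH hc hd hw hs hr hz ho hzo cw cs ws dw dr wr h3 h4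
  obtain ⟨C1, C2, C3, C4, C5, pC1, pC2, pC3, eC⟩ := pat_rel hH hu hw hd hr hs hk hl hkl (Ne.symm du) ur dr (Ne.symm dw) ws ds h5 h6'
  have md : v d ∈ csp v {d, r, s} := csp_mem (by simp)
  have mr : v r ∈ csp v {d, r, s} := csp_mem (by simp)
  have ms : v s ∈ csp v {d, r, s} := csp_mem (by simp)
  have solve : ∀ (t : ℝ) (a : W), t ≠ 0 → t • a ∈ csp v {d, r, s} → a ∈ csp v {d, r, s} := by
    intro t a ht h
    have := Submodule.smul_mem _ t⁻¹ h
    rwa [inv_smul_smul₀ ht] at this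
  have mc : v c ∈ csp v {d, r, s} := by
    refine solve (C1 * B3 * A1 + C2 * A3 * B1) _ (add_pos (mul_pos (mul_pos pC1 pB3) pA1) (mul_pos (mul_pos pC2 pA3) pB1)).ne' ?_
    have : (C1 * B3 * A1 + C2 * A3 * B1) • v c = (A3 * B3 * C3 - C1 * B3 * A2 - C2 * A3 * B2) • v d +
        (A3 * B3 * C4 + C1 * B3 * A4 + C2 * A3 * B5) • v r + (A3 * B3 * C5 + C1 * B3 * A5 + C2 * A3 * B4) • v s := by
      linear_combination (norm := module) (C1 * B3) • eA + (C2 * A3) • eB + (A3 * B3) • eC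
    rw [this]
    exact Submodule.add_mem _ (Submodule.add_mem _ (Submodule.smul_mem _ _ md) (Submodule.smul_mem _ _ mr)) (Submodule.smul_mem _ _ ms)
  have mu : v u ∈ csp v {d, r, s} := by
    refine solve A3 _ pA3.ne' ?_
    have : A3 • v u = A1 • v c + A2 • v d + (-A4) • v r + (-A5) • v s := by linear_combination (norm := module) (-1 : ℝ) • eA
    rw [this]
    exact Submodule.add_mem _ (Submodule.add_mem _ (Submodule.add_mem _ (Submodule.smul_mem _ _ mc) (Submodule.smul_mem _ _ md))
      (Submodule.smul_mem _ _ mr)) (Submodule.smul_mem _ _ ms)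
  have mw : v w ∈ csp v {d, r, s} := by
    refine solve B3 _ pB3.ne' ?_
    have : B3 • v w = B1 • v c + B2 • v d + (-B4) • v s + (-B5) • v r := by linear_combination (norm := module) (-1 : ℝ) • eB
    rw [this]
    exact Submodule.add_mem _ (Submodule.add_mem _ (Submodule.add_mem _ (Submodule.smul_mem _ _ mc) (Submodule.smul_mem _ _ md))
      (Submodule.smul_mem _ _ ms)) (Submodule.smul_mem _ _ mr)
  have hle : csp v H ≤ csp v {d, r, s} := by
    refine csp_le fun i hi => ?_
    rw [hHe] at hi
    simp only [List.mem_toFinset, List.mem_cons, List.not_mem_nil, or_false] at hi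
    rcases hi with rfl | rfl | rfl | rfl | rfl | rfl <;> assumption
  have e1 := Submodule.finrank_mono hle
  have e2 := (mem_fc.1 hH).2
  have e3 := crk_le_card (v := v) {d, r, s}
  have e4 : ({d, r, s} : Finset ι).card ≤ 3 := Finset.card_le_three
  unfold crk at e2 e3
  omega

end Model

section Final

variable {ι : Type} [Fintype ι] [DecidableEq ι] {W : Type} [AddCommGroup W] [Module ℝ W]
  [FiniteDimensional ℝ W] {v : ι → W}

theorem MM_mem {k : ℕ} {x : Fin k → ι} {m : ℕ} {a : ι} : a ∈ MM x m ↔ ∃ i : Fin k, m.testBit i = true ∧ x i = a := by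
  simp [MM, mask]

theorem fin_run {Fac Tri Spec : Finset ι → Prop} {tb : ℕ} (hc : Fintype.card ι = 10) (M : IsModel Fac Tri Spec tb)
    {k : ℕ} (k0 : 0 < k) (x : Fin k → ι) (hx : Function.Injective x) (L : List Fct) (hints : List ℕ)
    (lt : ∀ h ∈ L, h.1 < 2 ^ k ∧ ∀ f ∈ h.2, f < 2 ^ k)
    (good : ∀ h ∈ L, Good Fac Tri Spec (MM x h.1) (h.2.map (MM x)))
    (spec : ∀ G, Spec G → ∃ h ∈ L, G = MM x h.1)
    (hrun : withTabs (fun t => run t L k tb hints) = true) : False := by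
  have hk : k ≤ 10 := by
    have := Fintype.card_le_of_injective x hx
    rw [hc] at this; simpa using this
  have e : ∀ m, m < 2 ^ k → RR (fun n => if h : n < k then x ⟨n, h⟩ else x ⟨0, k0⟩) m = MM x m := by
    intro m hm
    ext a
    rw [RR_mem hk hm, MM_mem]
    constructor
    · rintro ⟨i, hi, h⟩
      rw [dif_pos (lt10 hm hi)] at h
      exact ⟨⟨i, lt10 hm hi⟩, hi, h⟩
    · rintro ⟨i, hi, h⟩
      exact ⟨i, hi, by rw [dif_pos i.2]; exact h⟩
  refine run_sound check_all hc M L k hints (fun n => if h : n < k then x ⟨n, h⟩ else x ⟨0, k0⟩) ?_ lt ?_ ?_ hrun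
  · intro a ha b hb h
    have ha' : a < k := ha
    have hb' : b < k := hb
    simp only [dif_pos ha', dif_pos hb'] at h
    have := hx h
    simpa using this
  · intro h hh
    rw [e _ (lt h hh).1, List.map_congr_left fun f hf => e f ((lt h hh).2 f hf)]
    exact good h hh
  · intro G hG
    obtain ⟨h, hh, rfl⟩ := spec G hG
    exact ⟨h, hh, (e _ (lt h hh).1).symm⟩

theorem Cnt.model (hC : Cnt v) (h4 : ∀ F ∈ fc v 4, 4 ≤ ((sub v 3 F).filter fun T => T.card = 3).card)
    (Spec : Finset ι → Prop) (tb : ℕ)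
    (tri : ∀ F ∈ fc v 4, Spec F ∨ (AllTri v F ∧ ((F.card = 4 ∧ (sub v 2 F).card = 6) ∨ (F.card = 5 ∧ (sub v 2 F).card = 9))))
    (tets : ∀ A : Finset (Finset ι), (∀ F ∈ A, F ∈ fc v 4 ∧ ¬ Spec F ∧ F.card = 4) → A.card ≤ tb) :
    IsModel (fun S => S ∈ fc v 4) (TriP v) Spec tb where
  tri3 := fun T hT => hT.2
  nbr := fun T H hT _ _ => hC.toPolyW.nbr T H hT
  cls := by
    intro G hG
    rcases tri G hG with h | ⟨hT, ⟨h4, h6⟩ | ⟨h5, h9⟩⟩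
    · exact Or.inl h
    · exact Or.inr (Or.inl ⟨h4, hT.tet hC.toPolyW Spec h4 h6⟩)
    · exact Or.inr (Or.inr (hT.bip hC.toPolyW Spec h5 h9))
  closed := hC.closed h4
  tets := tets
  pattern := pattern Spec

theorem Cnt.caseTri (hC : Cnt v) (h3 : ∀ G ∈ fc v 3, G.card = 3) (F : Finset ι) (hF : F ∈ fc v 4)
    (he : (sub v 2 F).card + 6 = 3 * F.card) : AllTri v F ∧ 4 ≤ ((sub v 3 F).filter fun T => T.card = 3).card := by
  refine ⟨⟨hF, fun G hG _ => h3 G hG⟩, ?_⟩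
  have h := hC.toPolyW.sum3 hF
  have hs : ∀ G ∈ sub v 3 F, G.card = 3 := fun G hG => h3 G (mem_sub.1 hG).1
  rw [Finset.sum_congr rfl hs, Finset.sum_const, smul_eq_mul] at h
  rw [Finset.filter_true_of_mem hs]
  have := card_ge hF
  omega

theorem Cnt.caseA (hC : Cnt v) (h3 : ∀ G ∈ fc v 3, G.card = 3) (he : ∀ F ∈ fc v 4, (sub v 2 F).card + 6 = 3 * F.card)
    (F0 : Finset ι) (hF0 : F0 ∈ fc v 4) (c0 : F0.card = 4) (hot : ∀ F ∈ fc v 4, F ≠ F0 → F.card = 5) : False := by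
  have M := hC.model (fun F hF => (hC.caseTri h3 F hF (he F hF)).2) (fun F => F = F0) 0 (fun F hF => by
    by_cases e : F = F0
    · exact Or.inl e
    · right
      have := he F hF
      have := hot F hF e
      exact ⟨(hC.caseTri h3 F hF (he F hF)).1, by omega⟩) (fun A hA => by
    rw [Nat.le_zero, Finset.card_eq_zero, Finset.eq_empty_iff_forall_notMem]
    intro F hF
    obtain ⟨a, b, c⟩ := hA F hF
    have := hot F a b
    omega)
  let ε := F0.equivFinOfCardEq c0
  have cov : MM (fun i => (ε.symm i : ι)) 15 = F0 := by
    rw [MM, show mask 4 15 = Finset.univ by decide]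
    ext a
    simp only [Finset.mem_image, Finset.mem_univ, true_and]
    constructor
    · rintro ⟨i, rfl⟩; exact (ε.symm i).2
    · intro ha; exact ⟨ε ⟨a, ha⟩, by simp⟩
  refine fin_run hC.c1 M (by norm_num) (fun i => (ε.symm i : ι)) (Subtype.val_injective.comp ε.symm.injective) _ _ (by decide) ?_ ?_ run0
  · intro h hh
    rw [List.mem_singleton] at hh
    subst hh
    have := he F0 hF0
    simp only [List.map_cons, List.map_nil, cov]
    exact (hC.caseTri h3 F0 hF0 this).1.tet hC.toPolyW _ c0 (by omega)
  · rintro G rfl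
    exact ⟨_, List.mem_singleton.2 rfl, cov.symm⟩

theorem Cnt.caseB (hC : Cnt v) (h3 : ∀ G ∈ fc v 3, G.card = 3) (he : ∀ F ∈ fc v 4, (sub v 2 F).card + 6 = 3 * F.card)
    (F0 : Finset ι) (hF0 : F0 ∈ fc v 4) (c0 : F0.card = 6) (hot : ∀ F ∈ fc v 4, F ≠ F0 → F.card = 4 ∨ F.card = 5)
    (htet : ((fc v 4).filter fun F => F.card = 4).card = 2) : False := by
  have M := hC.model (fun F hF => (hC.caseTri h3 F hF (he F hF)).2) (fun F => F = F0) 2 (fun F hF => by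
    by_cases e : F = F0
    · exact Or.inl e
    · right
      have := he F hF
      have := hot F hF e
      exact ⟨(hC.caseTri h3 F hF (he F hF)).1, by omega⟩) (fun A hA => by
    rw [← htet]
    refine Finset.card_le_card fun F hF => ?_
    obtain ⟨a, b, c⟩ := hA F hF
    exact Finset.mem_filter.2 ⟨a, c⟩)
  have e0 := he F0 hF0
  have T := (hC.caseTri h3 F0 hF0 e0).1
  have cov : ∀ x : Fin 6 → ι, Finset.univ.image x = F0 → MM x 63 = F0 := by
    intro x hx
    rw [MM, show mask 6 63 = Finset.univ by decide, hx]
  rcases T.six hC.toPolyW c0 (by omega) with ⟨x, L⟩ | ⟨x, L⟩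
  · refine fin_run hC.c1 M (by norm_num) x L.inj _ _ (by decide) ?_ ?_ run1
    · intro h hh
      rw [List.mem_singleton] at hh
      subst hh
      have := L.octa hC.toPolyW T (fun F => F = F0)
      dsimp only
      rw [cov x L.cov]
      exact this
    · rintro G rfl
      exact ⟨_, List.mem_singleton.2 rfl, (cov x L.cov).symm⟩
  · refine fin_run hC.c1 M (by norm_num) x L.inj _ _ (by decide) ?_ ?_ run2
    · intro h hh
      rw [List.mem_singleton] at hh
      subst hh
      have := L.stack hC.toPolyW T (fun F => F = F0)
      dsimp only
      rw [cov x L.cov]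
      exact this
    · rintro G rfl
      exact ⟨_, List.mem_singleton.2 rfl, (cov x L.cov).symm⟩

theorem Cnt.caseC (hC : Cnt v) (G0 : Finset ι) (hG0 : G0 ∈ fc v 3) (c0 : G0.card = 4) (h3 : ∀ G ∈ fc v 3, G ≠ G0 → G.card = 3)
    (h5 : ∀ F ∈ fc v 4, F.card = 5) (he : ∀ F ∈ fc v 4, (sub v 2 F).card + (if G0 ⊆ F then 1 else 0) = 9) : False := by
  have hP := hC.toPolyW
  have at_ : ∀ F ∈ fc v 4, ¬ G0 ⊆ F → AllTri v F := fun F hF hn => ⟨hF, fun G hG hGF => h3 G hG (by rintro rfl; exact hn hGF)⟩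
  have h4 : ∀ F ∈ fc v 4, 4 ≤ ((sub v 3 F).filter fun T => T.card = 3).card := by
    intro F hF
    have h := hP.sum3 hF
    have h9 := he F hF
    by_cases hG : G0 ⊆ F
    · rw [if_pos hG] at h9
      have hm : G0 ∈ sub v 3 F := mem_sub.2 ⟨hG0, hG⟩
      rw [← Finset.add_sum_erase _ _ hm, c0] at h
      have hs : ∀ G ∈ (sub v 3 F).erase G0, G.card = 3 := fun G hG =>
        h3 G (mem_sub.1 (Finset.mem_erase.1 hG).2).1 (Finset.mem_erase.1 hG).1
      rw [Finset.sum_congr rfl hs, Finset.sum_const, smul_eq_mul] at h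
      have : (sub v 3 F).erase G0 ⊆ (sub v 3 F).filter fun T => T.card = 3 := fun G hG =>
        Finset.mem_filter.2 ⟨(Finset.mem_erase.1 hG).2, hs G hG⟩
      have := Finset.card_le_card this
      omega
    · rw [if_neg hG] at h9
      have hs : ∀ G ∈ sub v 3 F, G.card = 3 := fun G hG' => (at_ F hF hG).2 G (mem_sub.1 hG').1 (mem_sub.1 hG').2
      rw [Finset.sum_congr rfl hs, Finset.sum_const, smul_eq_mul] at h
      rw [Finset.filter_true_of_mem hs]
      omega
  have M := hC.model h4 (fun F => F ∈ fc v 4 ∧ G0 ⊆ F) 0 (fun F hF => by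
    by_cases e : G0 ⊆ F
    · exact Or.inl ⟨hF, e⟩
    · right
      have := he F hF
      rw [if_neg e] at this
      exact ⟨at_ F hF e, Or.inr ⟨h5 F hF, this⟩⟩) (fun A hA => by
    rw [Nat.le_zero, Finset.card_eq_zero, Finset.eq_empty_iff_forall_notMem]
    intro F hF
    obtain ⟨a, b, c⟩ := hA F hF
    have := h5 F a
    omega)
  obtain ⟨F1, F2, hne, h12⟩ := Finset.card_eq_two.1 (hP.tri2 hG0)
  have hF1 : F1 ∈ fc v 4 ∧ G0 ⊆ F1 := by
    have : F1 ∈ (fc v 4).filter fun F => G0 ⊆ F := by rw [h12]; simp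
    simpa using this
  have hF2 : F2 ∈ fc v 4 ∧ G0 ⊆ F2 := by
    have : F2 ∈ (fc v 4).filter fun F => G0 ⊆ F := by rw [h12]; simp
    simpa using this
  obtain ⟨a, b, c, d, hn, rfl, e1, e2, e3, e4, n1, n2⟩ := hP.square hG0 c0
  have app : ∀ F ∈ fc v 4, {a, b, c, d} ⊆ F → ∃ p, p ∉ ({a, b, c, d} : Finset ι) ∧ F = {p, a, b, c, d} := by
    intro F hF hs
    obtain ⟨p, hp⟩ := Finset.card_eq_one.1 (show (F \ {a, b, c, d}).card = 1 by rw [Finset.card_sdiff_of_subset hs, h5 F hF, c0])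
    refine ⟨p, ?_, ?_⟩
    · have : p ∈ F \ {a, b, c, d} := by rw [hp]; simp
      exact (Finset.mem_sdiff.1 this).2
    · rw [← Finset.sdiff_union_of_subset hs, hp]; rfl
  obtain ⟨p, hp, eF1⟩ := app F1 hF1.1 hF1.2
  obtain ⟨q, hq, eF2⟩ := app F2 hF2.1 hF2.2
  have hpq : p ≠ q := by rintro rfl; exact hne (eF1.trans eF2.symm)
  have m1 : MM ![p, q, a, b, c, d] 61 = F1 := by
    rw [MM, show mask 6 61 = {0, 2, 3, 4, 5} by decide, eF1]; simp [Finset.image_insert]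
  have m2 : MM ![p, q, a, b, c, d] 62 = F2 := by
    rw [MM, show mask 6 62 = {1, 2, 3, 4, 5} by decide, eF2]; simp [Finset.image_insert]
  have m3 : MM ![p, q, a, b, c, d] 20 = {a, c} := by
    rw [MM, show mask 6 20 = {2, 4} by decide]; simp [Finset.image_insert]
  have m4 : MM ![p, q, a, b, c, d] 40 = {b, d} := by
    rw [MM, show mask 6 40 = {3, 5} by decide]; simp [Finset.image_insert]
  have hinj : Function.Injective ![p, q, a, b, c, d] := by
    have h6 : ({p, q, a, b, c, d} : Finset ι).card = 6 := by
      rw [Finset.card_insert_of_notMem, Finset.card_insert_of_notMem hq, c0]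
      rw [Finset.mem_insert, not_or]; exact ⟨hpq, hp⟩
    have : (Finset.univ.image ![p, q, a, b, c, d]).card = (Finset.univ : Finset (Fin 6)).card := by rw [im6, h6]; rfl
    have := Finset.card_image_iff.1 this
    simpa using this
  have P1 := hP.pyr hG0 h3 hn e1 e2 e3 e4 n1 n2 hF1.1 eF1
  have P2 := hP.pyr hG0 h3 hn e1 e2 e3 e4 n1 n2 hF2.1 eF2
  refine fin_run hC.c1 M (by norm_num) _ hinj _ _ (by decide) ?_ ?_ run3
  · intro h hh
    simp only [List.mem_cons, List.not_mem_nil, or_false] at hh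
    rcases hh with rfl | rfl
    · simp only [List.map_cons, List.map_nil, m1, m3, m4]; exact P1
    · simp only [List.map_cons, List.map_nil, m2, m3, m4]; exact P2
  · intro G hG
    have : G ∈ (fc v 4).filter fun F => {a, b, c, d} ⊆ F := by rw [Finset.mem_filter]; exact hG
    rw [h12, Finset.mem_insert, Finset.mem_singleton] at this
    rcases this with rfl | rfl
    · exact ⟨(61, [20, 40]), by simp, m1.symm⟩
    · exact ⟨(62, [20, 40]), by simp, m2.symm⟩

theorem Cnt.false (hC : Cnt v) : False := by
  rcases hC.cases with ⟨h3, he, ⟨F0, h0, c0, hot⟩ | ⟨F0, h0, c0, hot, ht⟩⟩ | ⟨G0, h0, c0, h3, h5, he⟩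
  · exact hC.caseA h3 he F0 h0 c0 hot
  · exact hC.caseB h3 he F0 h0 c0 hot ht
  · exact hC.caseC G0 h0 c0 h3 h5 he

end Final

section Bridge

variable {ι : Type} [Fintype ι] [DecidableEq ι] {E : Type} [NormedAddCommGroup E] [NormedSpace ℝ E]
  [FiniteDimensional ℝ E]

def lft (p : ι → E) (i : ι) : E × ℝ := (p i, 1)

def hul (p : ι → E) (S : Finset ι) : Set E := convexHull ℝ (p '' (S : Set ι))

variable {p : ι → E}

theorem hul_wt {x : E} (hx : x ∈ hul p Finset.univ) :
    ∃ w : ι → ℝ, (∀ i, 0 ≤ w i) ∧ ∑ i, w i = 1 ∧ ∑ i, w i • p i = x := by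
  have key : hul p Finset.univ ⊆
      {x | ∃ w : ι → ℝ, (∀ i, 0 ≤ w i) ∧ ∑ i, w i = 1 ∧ ∑ i, w i • p i = x} := by
    apply convexHull_min
    · rintro _ ⟨i, -, rfl⟩
      refine ⟨fun j => if j = i then 1 else 0, fun j => ?_, ?_, ?_⟩
      · dsimp only
        split_ifs <;> norm_num
      · simp
      · simp
    · rintro x ⟨w, w0, w1, wx⟩ y ⟨u, u0, u1, uy⟩ a b ha hb hab
      refine ⟨fun i => a * w i + b * u i, fun i => ?_, ?_, ?_⟩
      · exact add_nonneg (mul_nonneg ha (w0 i)) (mul_nonneg hb (u0 i))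
      · rw [Finset.sum_add_distrib, ← Finset.mul_sum, ← Finset.mul_sum, w1, u1]
        linarith
      · simp only [add_smul, mul_smul]
        rw [Finset.sum_add_distrib, ← Finset.smul_sum, ← Finset.smul_sum, wx, uy]
  exact key hx

theorem hul_mono {S T : Finset ι} (h : S ⊆ T) : hul p S ⊆ hul p T :=
  convexHull_mono (Set.image_mono h)

theorem hul_mem {S : Finset ι} {i : ι} (h : i ∈ S) : p i ∈ hul p S :=
  subset_convexHull ℝ _ ⟨i, h, rfl⟩

theorem lft_sum {w : ι → ℝ} {x : E} (h1 : ∑ i, w i = 1) (hx : ∑ i, w i • p i = x) :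
    ∑ i, w i • lft p i = (x, 1) := by
  ext1
  · rw [Prod.fst_sum]
    simpa [lft] using hx
  · rw [Prod.snd_sum]
    simpa [lft] using h1

theorem hul_nonneg {φ : E × ℝ →ₗ[ℝ] ℝ} (h : ∀ i, 0 ≤ φ (lft p i)) {x : E} (hx : x ∈ hul p Finset.univ) :
    0 ≤ φ (x, 1) := by
  obtain ⟨w, w0, w1, wx⟩ := hul_wt hx
  rw [← lft_sum w1 wx, map_sum]
  refine Finset.sum_nonneg fun i _ => ?_
  rw [map_smul]
  exact mul_nonneg (w0 i) (h i)

theorem hul_zero {φ : E × ℝ →ₗ[ℝ] ℝ} {S : Finset ι}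
    (h : ∀ i, 0 ≤ φ (lft p i) ∧ (φ (lft p i) = 0 ↔ i ∈ S)) :
    hul p S = {x ∈ hul p Finset.univ | φ (x, 1) = 0} := by
  apply Set.Subset.antisymm
  · have hh : hul p S ⊆ {x | φ (x, 1) = 0} := by
      apply convexHull_min
      · rintro _ ⟨i, hi, rfl⟩
        exact (h i).2.2 hi
      · intro x hx y hy a b ha hb hab
        have : ((a • x + b • y, 1) : E × ℝ) = a • (x, 1) + b • (y, 1) := by
          ext1 <;> simp [hab]
        change φ (a • x + b • y, 1) = 0
        rw [this, map_add, map_smul, map_smul, hx, hy]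
        simp
    exact fun x hx => ⟨hul_mono (Finset.subset_univ S) hx, hh hx⟩
  · rintro x ⟨hx, h0⟩
    obtain ⟨w, w0, w1, wx⟩ := hul_wt hx
    rw [← lft_sum w1 wx, map_sum] at h0
    simp only [map_smul, smul_eq_mul] at h0
    rw [Finset.sum_eq_zero_iff_of_nonneg fun i _ => mul_nonneg (w0 i) (h i).1] at h0
    have hz : ∀ i, i ∉ S → w i = 0 := by
      intro i hi
      rcases mul_eq_zero.1 (h0 i (Finset.mem_univ i)) with h' | h'
      · exact h'
      · exact absurd ((h i).2.1 h') hi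
    have e1 : ∑ i ∈ S, w i = 1 := by
      rw [← w1]
      exact Finset.sum_subset (Finset.subset_univ S) fun i _ hi => hz i hi
    have e2 : ∑ i ∈ S, w i • p i = x := by
      rw [← wx]
      exact Finset.sum_subset (Finset.subset_univ S) fun i _ hi => by rw [hz i hi, zero_smul]
    rw [← e2]
    exact (convex_convexHull ℝ _).sum_mem (fun i _ => w0 i) e1 fun i hi => hul_mem hi

theorem hul_inj {S T : Finset ι} (hS : CFace (lft p) S) (hT : CFace (lft p) T) (h : hul p S = hul p T) :
    S = T := by
  have key : ∀ {S T : Finset ι}, CFace (lft p) T → hul p S = hul p T → S ⊆ T := by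
    rintro S T ⟨φ, hφ⟩ h i hi
    have : p i ∈ hul p T := h ▸ hul_mem hi
    rw [hul_zero hφ] at this
    exact (hφ i).2.1 this.2
  exact (key hT h).antisymm (key hS h.symm)

theorem hul_exposed {S : Finset ι} (hS : CFace (lft p) S) (hne : S.Nonempty) :
    IsExposed ℝ (hul p Finset.univ) (hul p S) := by
  intro _
  obtain ⟨φ, hφ⟩ := hS
  obtain ⟨i, hi⟩ := hne
  refine ⟨-LinearMap.toContinuousLinearMap (φ ∘ₗ LinearMap.inl ℝ E ℝ), ?_⟩
  have dec : ∀ x : E, φ (x, 1) = φ (x, 0) + φ (0, 1) := by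
    intro x
    rw [← map_add]
    simp
  rw [hul_zero hφ]
  have hn : ∀ x ∈ hul p Finset.univ, 0 ≤ φ (x, 1) := fun x hx => hul_nonneg (fun i => (hφ i).1) hx
  ext x
  simp only [Set.mem_setOf_eq, ContinuousLinearMap.neg_apply, LinearMap.coe_toContinuousLinearMap',
    LinearMap.comp_apply, LinearMap.inl_apply, neg_le_neg_iff]
  refine and_congr_right fun hx => ⟨fun h y hy => ?_, fun h => ?_⟩
  · have := hn y hy
    rw [dec] at this h
    linarith
  · have h1 := h (p i) (hul_mem (Finset.mem_univ i))
    have h2 : φ (p i, 1) = 0 := (hφ i).2.2 hi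
    have h3 := hn x hx
    rw [dec] at h2 h3 ⊢
    linarith

theorem exposed_hul {B : Set E} (hB : IsExposed ℝ (hul p Finset.univ) B) (hne : B ≠ ∅) :
    ∃ S : Finset ι, CFace (lft p) S ∧ hul p S = B := by
  obtain ⟨b, hb⟩ := Set.nonempty_iff_ne_empty.2 hne
  obtain ⟨l, hl⟩ := hB ⟨b, hb⟩
  have hb' := hb
  rw [hl] at hb'
  let φ : E × ℝ →ₗ[ℝ] ℝ := l b • LinearMap.snd ℝ E ℝ - (l : E →ₗ[ℝ] ℝ) ∘ₗ LinearMap.fst ℝ E ℝ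
  have hφ : ∀ x : E, φ (x, 1) = l b - l x := by
    intro x
    simp [φ]
  let S : Finset ι := Finset.univ.filter fun i => φ (lft p i) = 0
  have hS : ∀ i, 0 ≤ φ (lft p i) ∧ (φ (lft p i) = 0 ↔ i ∈ S) := by
    intro i
    refine ⟨?_, by simp [S]⟩
    have := hb'.2 (p i) (hul_mem (Finset.mem_univ i))
    rw [lft, hφ]
    linarith
  refine ⟨S, ⟨φ, hS⟩, ?_⟩
  rw [hul_zero hS, hl]
  ext x
  simp only [Set.mem_setOf_eq]
  refine and_congr_right fun hx => ⟨fun h y hy => ?_, fun h => ?_⟩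
  · rw [hφ] at h
    have := hb'.2 y hy
    linarith
  · rw [hφ]
    have h1 := hb'.2 x hx
    have h2 := h b hb'.1
    linarith

theorem hul_empty_iff {S : Finset ι} : hul p S = ∅ ↔ S = ∅ := by
  simp [hul]

theorem crk_hul {S : Finset ι} (hS : S.Nonempty) :
    crk (lft p) S = Module.finrank ℝ (vectorSpan ℝ (hul p S)) + 1 := by
  obtain ⟨i, hi⟩ := hS
  have h1 : vectorSpan ℝ (hul p S) = vectorSpan ℝ (p '' (S : Set ι)) := by
    rw [← direction_affineSpan, hul, affineSpan_convexHull, direction_affineSpan]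
  have h2 : csp (lft p) S = (vectorSpan ℝ (p '' (S : Set ι))).map (LinearMap.inl ℝ E ℝ) ⊔
      Submodule.span ℝ {lft p i} := by
    apply le_antisymm
    · apply csp_le
      intro j hj
      have : lft p j = LinearMap.inl ℝ E ℝ (p j - p i) + lft p i := by
        simp [lft]
      rw [this]
      refine Submodule.add_mem_sup (Submodule.mem_map_of_mem ?_) (Submodule.mem_span_singleton_self _)
      exact vsub_mem_vectorSpan ℝ ⟨j, hj, rfl⟩ ⟨i, hi, rfl⟩
    · rw [sup_le_iff, Submodule.map_le_iff_le_comap, Submodule.span_singleton_le_iff_mem]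
      refine ⟨?_, csp_mem hi⟩
      rw [vectorSpan_eq_span_vsub_set_right ℝ (Set.mem_image_of_mem p (Finset.mem_coe.2 hi)), Submodule.span_le]
      rintro _ ⟨_, ⟨j, hj, rfl⟩, rfl⟩
      have : LinearMap.inl ℝ E ℝ (p j - p i) = lft p j - lft p i := by
        simp [lft]
      change LinearMap.inl ℝ E ℝ (p j - p i) ∈ csp (lft p) S
      rw [this]
      exact sub_mem (csp_mem hj) (csp_mem hi)
  have h3 : (vectorSpan ℝ (p '' (S : Set ι))).map (LinearMap.inl ℝ E ℝ) ⊓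
      Submodule.span ℝ {lft p i} = ⊥ := by
    rw [eq_bot_iff]
    rintro x ⟨⟨y, -, rfl⟩, hx2⟩
    obtain ⟨c, hc⟩ := Submodule.mem_span_singleton.1 hx2
    have : c = 0 := by
      have := congrArg Prod.snd hc
      simpa [lft] using this
    rw [← hc, this, zero_smul]
    exact Submodule.zero_mem _
  have h4 := Submodule.finrank_sup_add_finrank_inf_eq
    ((vectorSpan ℝ (p '' (S : Set ι))).map (LinearMap.inl ℝ E ℝ)) (Submodule.span ℝ {lft p i})
  have h5 : lft p i ≠ 0 := fun h => by
    have := congrArg Prod.snd h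
    simp [lft] at this
  rw [h3, finrank_bot, finrank_span_singleton h5, ← h2,
    ← (Submodule.equivMapOfInjective (LinearMap.inl ℝ E ℝ) LinearMap.inl_injective _).finrank_eq] at h4
  rw [h1]
  exact h4

theorem bridge (hs : ∀ i, p i ∉ convexHull ℝ (p '' {i}ᶜ)) {k : ℕ}
    (hk : k + 1 < crk (lft p) Finset.univ) :
    {F : Set E | F ≠ ∅ ∧ F ≠ hul p Finset.univ ∧ IsExposed ℝ (hul p Finset.univ) F ∧
      Module.finrank ℝ (vectorSpan ℝ F) = k}.ncard = (fc (lft p) (k + 1)).card := by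
  have : {F : Set E | F ≠ ∅ ∧ F ≠ hul p Finset.univ ∧ IsExposed ℝ (hul p Finset.univ) F ∧
      Module.finrank ℝ (vectorSpan ℝ F) = k} = hul p '' (fc (lft p) (k + 1) : Set (Finset ι)) := by
    ext F
    simp only [Set.mem_setOf_eq, Set.mem_image, Finset.mem_coe, mem_fc]
    constructor
    · rintro ⟨h1, h2, h3, h4⟩
      obtain ⟨S, hS, rfl⟩ := exposed_hul h3 h1
      refine ⟨S, ⟨hS, ?_⟩, rfl⟩
      rw [crk_hul, h4]
      exact Finset.nonempty_iff_ne_empty.2 fun h => h1 (hul_empty_iff.2 h)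
    · rintro ⟨S, ⟨hS, hr⟩, rfl⟩
      have hne : S.Nonempty := by
        rw [Finset.nonempty_iff_ne_empty]
        rintro rfl
        rw [crk_empty] at hr
        omega
      refine ⟨fun h => hne.ne_empty (hul_empty_iff.1 h), fun h => ?_, hul_exposed hS hne, ?_⟩
      · have hu : CFace (lft p) Finset.univ := ⟨0, fun i => by simp⟩
        have := hul_inj hS hu h
        subst this
        omega
      · rw [crk_hul hne] at hr
        omega
  rw [this, Set.ncard_image_of_injOn, Set.ncard_coe_finset]
  intro S hS T hT h
  exact hul_inj (mem_fc.1 hS).1 (mem_fc.1 hT).1 h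

theorem lft_sing (hs : ∀ i, p i ∉ convexHull ℝ (p '' {i}ᶜ)) (i : ι) : CFace (lft p) {i} := by
  have hc : IsClosed (convexHull ℝ (p '' {i}ᶜ)) := (Set.toFinite (p '' {i}ᶜ)).isClosed_convexHull ℝ
  obtain ⟨f, u, h1, h2⟩ := geometric_hahn_banach_point_closed (convex_convexHull ℝ _) hc (hs i)
  refine ⟨(f : E →ₗ[ℝ] ℝ) ∘ₗ LinearMap.fst ℝ E ℝ - f (p i) • LinearMap.snd ℝ E ℝ, fun j => ?_⟩
  by_cases hj : j = i
  · subst hj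
    simp [lft]
  · have := h2 (p j) (subset_convexHull ℝ _ ⟨j, hj, rfl⟩)
    have h0 : 0 < f (p j) - f (p i) := by linarith
    simp only [lft, Finset.mem_singleton, hj, iff_false, LinearMap.sub_apply, LinearMap.comp_apply, LinearMap.fst_apply, ContinuousLinearMap.coe_coe, LinearMap.smul_apply, LinearMap.snd_apply, smul_eq_mul, mul_one]
    exact ⟨h0.le, h0.ne'⟩

end Bridge

theorem main_aux (V : Set (EuclideanSpace ℝ (Fin 4))) (hV : V.Finite)
    (f : ℕ → ℕ) (hf : ∀ k, f k = {F : Set (EuclideanSpace ℝ (Fin 4)) | F ≠ ∅ ∧ F ≠ convexHull ℝ V ∧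
      IsExposed ℝ (convexHull ℝ V) F ∧ Module.finrank ℝ (vectorSpan ℝ F) = k}.ncard)
    (h0 : f 0 = 10) (h1 : f 1 = 33) (h2 : f 2 = 35) (h3 : f 3 = 12) : False := by
  classical
  let X : Set (EuclideanSpace ℝ (Fin 4)) := (convexHull ℝ V).extremePoints ℝ
  have hX : X.Finite := hV.subset extremePoints_convexHull_subset
  have hXP : convexHull ℝ X = convexHull ℝ V := by
    rw [← closure_convexHull_extremePoints (hV.isCompact_convexHull ℝ) (convex_convexHull ℝ V)]
    exact ((hX.isClosed_convexHull ℝ).closure_eq).symm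
  have : Fintype X := hX.fintype
  let p : X → EuclideanSpace ℝ (Fin 4) := Subtype.val
  have hu : hul p Finset.univ = convexHull ℝ V := by
    rw [← hXP]
    simp [hul, p]
  have hs : ∀ i, p i ∉ convexHull ℝ (p '' {i}ᶜ) := by
    intro i hi
    have h := (convex_convexHull ℝ V).mem_extremePoints_iff_mem_sdiff_convexHull_sdiff.1 i.2
    refine h.2 (convexHull_mono ?_ hi)
    rintro _ ⟨j, hj, rfl⟩
    exact ⟨extremePoints_subset j.2, fun h => hj (Subtype.ext h)⟩
  simp only [← hu] at hf
  have hr : crk (lft p) Finset.univ = 5 := by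
    apply le_antisymm
    · refine (Submodule.finrank_le _).trans ?_
      simp [Module.finrank_prod]
    · have : {F : Set (EuclideanSpace ℝ (Fin 4)) | F ≠ ∅ ∧ F ≠ hul p Finset.univ ∧
        IsExposed ℝ (hul p Finset.univ) F ∧ Module.finrank ℝ (vectorSpan ℝ F) = 3}.Nonempty := by
        apply Set.nonempty_of_ncard_ne_zero
        rw [← hf, h3]
        norm_num
      obtain ⟨F, a1, a2, a3, a4⟩ := this
      obtain ⟨S, hS, rfl⟩ := exposed_hul a3 a1
      have hne : S.Nonempty := Finset.nonempty_iff_ne_empty.2 fun h => a1 (hul_empty_iff.2 h)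
      have h4 := crk_hul (p := p) hne
      have h5 : S ⊂ Finset.univ := by
        rw [Finset.ssubset_univ_iff]
        rintro rfl
        exact a2 rfl
      have := hS.crk_lt h5
      omega
  have hP : PolyW (lft p) := ⟨⟨LinearMap.snd ℝ _ ℝ, fun i => rfl⟩, lft_sing hs, hr⟩
  have hb : ∀ k, k < 4 → (fc (lft p) (k + 1)).card = f k := fun k hk => by
    rw [hf, bridge hs (by omega)]
  refine Cnt.false (v := lft p) ⟨hP, ?_, ?_, ?_, ?_⟩
  · rw [← h0, ← hb 0 (by norm_num), ← Finset.card_univ]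
    refine Finset.card_bij (fun i _ => {i}) (fun i _ => hP.single i) ?_ ?_
    · intro i _ j _ h
      simpa using h
    · intro S hS
      obtain ⟨i, rfl⟩ := hP.card1 hS
      exact ⟨i, Finset.mem_univ i, rfl⟩
  · rw [hb 1 (by norm_num), h1]
  · rw [hb 2 (by norm_num), h2]
  · rw [hb 3 (by norm_num), h3]

/-- `(10,33,35,12)` is not the f-vector of any convex 4-polytope. -/
theorem no_polytope_10_33_35_12 :
    ¬ ∃ V : Set (EuclideanSpace ℝ (Fin 4)), V.Finite ∧
      fVec V 0 = 10 ∧ fVec V 1 = 33 ∧ fVec V 2 = 35 ∧ fVec V 3 = 12 := by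
  rintro ⟨V, hV, h0, h1, h2, h3⟩
  exact main_aux V hV (fVec V) (fun k => rfl) h0 h1 h2 h3
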